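/- For every ε ∈ (0,1/10) there exist γ₀ ∈ (0,1), h₀ ∈ (0,1) and a constant C, depending only on ε and the cutoffs, such that for all 0 < h ≤ h₀, all γ with h^{2/3−ε} ≤ γ ≤ γ₀, all a with 0 < a < γ/4, all X ≥ 0, Y ∈ ℝ, and every T with λ_γ² ≤ |T| ≤ 2γ^{−1/2}: (i) for every integer N with λ_γ² ≤ |N| ≤ 2γ^{−1/2}, |W_{N,γ}(T,X,Y)| ≤ C γ²/(h³ λ_γ^{5/6} |N|); (ii) |G^♭(T,X,Y)| ≤ C h^{1/3}/(h² λ_γ^{3/2}). -/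

import Mathlib

open Real Complex Filter MeasureTheory

/-- `A₊(z) = e^{-iπ/3} Ai(e^{-iπ/3} z)`. -/
noncomputable def Aplus (Ai : ℂ → ℂ) (z : ℂ) : ℂ :=
  Complex.exp (-(Real.pi / 3 : ℂ) * Complex.I) * Ai (Complex.exp (-(Real.pi / 3 : ℂ) * Complex.I) * z)

/-- `A₋(z) = e^{iπ/3} Ai(e^{iπ/3} z)`. -/
noncomputable def Aminus (Ai : ℂ → ℂ) (z : ℂ) : ℂ :=
  Complex.exp ((Real.pi / 3 : ℂ) * Complex.I) * Ai (Complex.exp ((Real.pi / 3 : ℂ) * Complex.I) * z)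

/-- `B(u) = (4/3)u + π/2 − L(u^{2/3})`. -/
noncomputable def Bfun (L : ℝ → ℝ) (u : ℝ) : ℝ :=
  (4/3) * u + Real.pi / 2 - L (u ^ ((2 : ℝ)/3))

/-- The phase `Ψ_{N,a,γ}(T,X,Y,Υ,S,A,η)` of the transverse reflected waves,
with `λ_γ = γ^{3/2}/h`. -/
noncomputable def PsiTrans (L : ℝ → ℝ) (h γ a : ℝ) (N : ℤ) (T X Y Υ S A η : ℝ) : ℝ :=
  η * (Y + Υ ^ 3 / 3 + Υ * (X - A) + S ^ 3 / 3 + S * (a / γ - A)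
      + T * (A - 1) / (Real.sqrt (1 + γ * A) + Real.sqrt (1 + γ))
      - (4/3) * (N : ℝ) * A ^ ((3:ℝ)/2))
    + ((N : ℝ) / (γ ^ ((3:ℝ)/2) / h)) * Bfun L (η * (γ ^ ((3:ℝ)/2) / h) * A ^ ((3:ℝ)/2))

/-- The `N`-th transverse reflected wave `W_{N,γ}(T,X,Y)`; the integration variables are
`S = v.1`, `Υ = v.2.1`, `A = v.2.2.1`, `η = v.2.2.2`. -/
noncomputable def Wtrans (L : ℝ → ℝ) (ψ χ₂ ψ₂ : ℝ → ℝ)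
    (h γ a : ℝ) (N : ℤ) (T X Y : ℝ) : ℂ :=
  ((γ ^ 2 / (2 * Real.pi * h) ^ 3 : ℝ) : ℂ) * ∫ v : ℝ × ℝ × ℝ × ℝ,
    Complex.exp (Complex.I *
      (((γ ^ ((3:ℝ)/2) / h) * PsiTrans L h γ a N T X Y v.2.1 v.1 v.2.2.1 v.2.2.2 : ℝ) : ℂ)) *
    ((v.2.2.2 ^ 2 * ψ v.2.2.2 * χ₂ v.1 * χ₂ v.2.1 * ψ₂ v.2.2.1 : ℝ) : ℂ)

/-- `G^♭(T,X,Y) = Σ_{|N| ≤ 2γ^{−1/2}} W_{N,γ}(T,X,Y)`. -/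
noncomputable def Gflat (L : ℝ → ℝ) (ψ χ₂ ψ₂ : ℝ → ℝ)
    (h γ a : ℝ) (T X Y : ℝ) : ℂ :=
  ∑' N : ℤ, Set.indicator {N : ℤ | |(N : ℝ)| ≤ 2 / Real.sqrt γ}
    (fun N => Wtrans L ψ χ₂ ψ₂ h γ a N T X Y) N

namespace TransverseWave

/-- First-derivative test: if `k₁' = h k₀ + e` with `h` monotone and `|h| ≥ δ`, the integral of
`k₀` is controlled by `k₁` and `e`. -/
theorem norm_integral_le_of_le_abs {a b δ M₁ D : ℝ} (hab : a ≤ b) (hδ : 0 < δ)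
    {h h' : ℝ → ℝ} {k₀ k₁ e : ℝ → ℂ}
    (hh : ∀ x ∈ Set.Icc a b, HasDerivAt h (h' x) x)
    (hk : ∀ x ∈ Set.Icc a b, HasDerivAt k₁ (h x * k₀ x + e x) x)
    (hh'c : ContinuousOn h' (Set.Icc a b)) (hk₀c : ContinuousOn k₀ (Set.Icc a b))
    (hec : ContinuousOn e (Set.Icc a b))
    (hmono : ∀ x ∈ Set.Icc a b, 0 ≤ h' x)
    (hfar : ∀ x ∈ Set.Icc a b, δ ≤ |h x|)
    (hM : ∀ x ∈ Set.Icc a b, ‖k₁ x‖ ≤ M₁) (hD : ∀ x ∈ Set.Icc a b, ‖e x‖ ≤ D) :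
    ‖∫ x in a..b, k₀ x‖ ≤ 4 * M₁ / δ + D * ∫ x in a..b, 1 / |h x| := by
  have hIcc : Set.uIcc a b = Set.Icc a b := Set.uIcc_of_le hab
  have hne : ∀ x ∈ Set.Icc a b, h x ≠ 0 := fun x hx h0 => by
    have := hfar x hx; rw [h0, abs_zero] at this; linarith
  have hneC : ∀ x ∈ Set.Icc a b, (h x : ℂ) ≠ 0 := fun x hx => by exact_mod_cast hne x hx
  have hhc : ContinuousOn h (Set.Icc a b) := fun x hx => (hh x hx).continuousAt.continuousWithinAt
  have hk₁c : ContinuousOn k₁ (Set.Icc a b) := fun x hx =>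
    (hk x hx).continuousAt.continuousWithinAt
  have hhcC : ContinuousOn (fun x => (h x : ℂ)) (Set.Icc a b) :=
    Complex.continuous_ofReal.comp_continuousOn hhc
  have hh'cC : ContinuousOn (fun x => (h' x : ℂ)) (Set.Icc a b) :=
    Complex.continuous_ofReal.comp_continuousOn hh'c
  have hM0 : 0 ≤ M₁ := (norm_nonneg _).trans (hM a ⟨le_rfl, hab⟩)
  have hD0 : 0 ≤ D := (norm_nonneg _).trans (hD a ⟨le_rfl, hab⟩)
  have hder : ∀ x ∈ Set.Icc a b, HasDerivAt (fun x => k₁ x / (h x : ℂ))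
      (k₀ x + (e x / h x - k₁ x * ((h' x / h x ^ 2 : ℝ) : ℂ))) x := by
    intro x hx
    refine ((hk x hx).div (hh x hx).ofReal_comp (hneC x hx)).congr_deriv ?_
    have := hneC x hx
    push_cast
    field_simp
    ring
  have hc1 : ContinuousOn (fun x => e x / (h x : ℂ)) (Set.Icc a b) := hec.div hhcC hneC
  have hc2r : ContinuousOn (fun x => h' x / h x ^ 2) (Set.Icc a b) :=
    hh'c.div (hhc.pow 2) fun x hx => pow_ne_zero _ (hne x hx)
  have hc2 : ContinuousOn (fun x => k₁ x * ((h' x / h x ^ 2 : ℝ) : ℂ)) (Set.Icc a b) :=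
    hk₁c.mul (Complex.continuous_ofReal.comp_continuousOn hc2r)
  have hI0 : IntervalIntegrable k₀ volume a b := (hIcc ▸ hk₀c).intervalIntegrable
  have hI1 : IntervalIntegrable (fun x => e x / (h x : ℂ)) volume a b :=
    (hIcc ▸ hc1).intervalIntegrable
  have hI2 : IntervalIntegrable (fun x => k₁ x * ((h' x / h x ^ 2 : ℝ) : ℂ)) volume a b :=
    (hIcc ▸ hc2).intervalIntegrable
  have hI3 : IntervalIntegrable (fun x => h' x / h x ^ 2) volume a b :=
    (hIcc ▸ hc2r).intervalIntegrable
  have hI4 : IntervalIntegrable (fun x => 1 / |h x|) volume a b := by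
    refine ContinuousOn.intervalIntegrable ?_
    rw [hIcc]
    exact continuousOn_const.div hhc.abs fun x hx => abs_ne_zero.2 (hne x hx)
  have key := intervalIntegral.integral_eq_sub_of_hasDerivAt
    (fun x hx => hder x (hIcc ▸ hx)) (hI0.add (hI1.sub hI2))
  rw [intervalIntegral.integral_add hI0 (hI1.sub hI2), intervalIntegral.integral_sub hI1 hI2] at key
  have hinv : ∫ x in a..b, h' x / h x ^ 2 = (h a)⁻¹ - (h b)⁻¹ := by
    have := intervalIntegral.integral_eq_sub_of_hasDerivAt (f := fun x => -(h x)⁻¹)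
      (f' := fun x => h' x / h x ^ 2) (a := a) (b := b)
      (fun x hx => ((hh x (hIcc ▸ hx)).inv (hne x (hIcc ▸ hx))).neg.congr_deriv (by ring)) hI3
    rw [this]; ring
  have hinvle : ∀ x ∈ Set.Icc a b, |(h x)⁻¹| ≤ 1 / δ := fun x hx => by
    rw [abs_inv, ← one_div]; exact one_div_le_one_div_of_le hδ (hfar x hx)
  have hbdry : ∀ x ∈ Set.Icc a b, ‖k₁ x / (h x : ℂ)‖ ≤ M₁ / δ := fun x hx => by
    rw [norm_div, Complex.norm_real, Real.norm_eq_abs]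
    exact div_le_div₀ hM0 (hM x hx) hδ (hfar x hx)
  have b1 : ‖∫ x in a..b, e x / (h x : ℂ)‖ ≤ D * ∫ x in a..b, 1 / |h x| := by
    rw [← intervalIntegral.integral_const_mul]
    refine intervalIntegral.norm_integral_le_of_norm_le hab (ae_of_all _ fun x hx => ?_)
      (hI4.const_mul D)
    have hx' : x ∈ Set.Icc a b := ⟨hx.1.le, hx.2⟩
    rw [norm_div, Complex.norm_real, Real.norm_eq_abs, mul_one_div]
    exact div_le_div_of_nonneg_right (hD x hx') (abs_nonneg _)
  have b2 : ‖∫ x in a..b, k₁ x * ((h' x / h x ^ 2 : ℝ) : ℂ)‖ ≤ M₁ * (2 / δ) := by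
    have : ‖∫ x in a..b, k₁ x * ((h' x / h x ^ 2 : ℝ) : ℂ)‖ ≤
        ∫ x in a..b, M₁ * (h' x / h x ^ 2) := by
      refine intervalIntegral.norm_integral_le_of_norm_le hab (ae_of_all _ fun x hx => ?_)
        (hI3.const_mul M₁)
      have hx' : x ∈ Set.Icc a b := ⟨hx.1.le, hx.2⟩
      have hp : 0 ≤ h' x / h x ^ 2 := div_nonneg (hmono x hx') (sq_nonneg _)
      rw [norm_mul, Complex.norm_real, Real.norm_eq_abs, abs_of_nonneg hp]
      exact mul_le_mul_of_nonneg_right (hM x hx') hp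
    refine this.trans ?_
    rw [intervalIntegral.integral_const_mul, hinv]
    refine mul_le_mul_of_nonneg_left ?_ hM0
    have h1 := hinvle a ⟨le_rfl, hab⟩
    have h2 := hinvle b ⟨hab, le_rfl⟩
    rw [abs_le] at h1 h2
    have : 2 / δ = 1 / δ + 1 / δ := by ring
    linarith
  have b3 := hbdry a ⟨le_rfl, hab⟩
  have b4 := hbdry b ⟨hab, le_rfl⟩
  have : ∫ x in a..b, k₀ x = (k₁ b / h b - k₁ a / h a) - (∫ x in a..b, e x / (h x : ℂ)) +
      ∫ x in a..b, k₁ x * ((h' x / h x ^ 2 : ℝ) : ℂ) := by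
    rw [← key]; ring
  rw [this]
  refine (norm_add_le _ _).trans ?_
  have t1 := norm_sub_le (k₁ b / h b - k₁ a / h a) (∫ x in a..b, e x / (h x : ℂ))
  have t2 := norm_sub_le (k₁ b / (h b : ℂ)) (k₁ a / h a)
  have : 4 * M₁ / δ = M₁ / δ + M₁ / δ + M₁ * (2 / δ) := by ring
  linarith

theorem integral_one_div_abs_le {a b δ : ℝ} (hab : a ≤ b) (hδ : 0 < δ) {h : ℝ → ℝ}
    (hhc : ContinuousOn h (Set.Icc a b)) (hfar : ∀ x ∈ Set.Icc a b, δ ≤ |h x|) :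
    ∫ x in a..b, 1 / |h x| ≤ (b - a) / δ := by
  have hne : ∀ x ∈ Set.Icc a b, |h x| ≠ 0 := fun x hx => (hδ.trans_le (hfar x hx)).ne'
  have : ∫ x in a..b, 1 / |h x| ≤ ∫ _ in a..b, 1 / δ := by
    refine intervalIntegral.integral_mono_on hab ?_ (by simp) fun x hx =>
      one_div_le_one_div_of_le hδ (hfar x hx)
    refine ContinuousOn.intervalIntegrable ?_
    rw [Set.uIcc_of_le hab]
    exact continuousOn_const.div hhc.abs hne
  refine this.trans (le_of_eq ?_)
  simp [div_eq_mul_inv]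

theorem integral_one_div_abs_le_log {a b δ g m : ℝ} (hab : a ≤ b) (hδ : 0 < δ) (hm : 0 < m)
    {h h' : ℝ → ℝ} (hh : ∀ x ∈ Set.Icc a b, HasDerivAt h (h' x) x)
    (hh'c : ContinuousOn h' (Set.Icc a b)) (hslope : ∀ x ∈ Set.Icc a b, m ≤ h' x)
    (hfar : (∀ x ∈ Set.Icc a b, δ ≤ h x) ∨ (∀ x ∈ Set.Icc a b, h x ≤ -δ))
    (hg : ∀ x ∈ Set.Icc a b, |h x| ≤ g) :
    ∫ x in a..b, 1 / |h x| ≤ Real.log (g / δ) / m := by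
  have hIcc : Set.uIcc a b = Set.Icc a b := Set.uIcc_of_le hab
  obtain ⟨s, hs, hsabs⟩ : ∃ s : ℝ, (s = 1 ∨ s = -1) ∧ ∀ x ∈ Set.Icc a b, |h x| = s * h x := by
    rcases hfar with hf | hf
    · exact ⟨1, Or.inl rfl, fun x hx => by rw [one_mul, abs_of_pos (hδ.trans_le (hf x hx))]⟩
    · exact ⟨-1, Or.inr rfl, fun x hx => by
        rw [neg_one_mul, abs_of_neg (by linarith [hf x hx])]⟩
  have hfar' : ∀ x ∈ Set.Icc a b, δ ≤ |h x| := by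
    rcases hfar with hf | hf
    · exact fun x hx => (hf x hx).trans (le_abs_self _)
    · exact fun x hx => le_abs.2 (Or.inr (by linarith [hf x hx]))
  have hne : ∀ x ∈ Set.Icc a b, h x ≠ 0 := fun x hx h0 => by
    have := hfar' x hx; rw [h0, abs_zero] at this; linarith
  have hhc : ContinuousOn h (Set.Icc a b) := fun x hx => (hh x hx).continuousAt.continuousWithinAt
  have hI1 : IntervalIntegrable (fun x => s * (h' x / h x) / m) volume a b := by
    refine ContinuousOn.intervalIntegrable ?_
    rw [hIcc]
    exact (continuousOn_const.mul (hh'c.div hhc hne)).div_const _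
  have hI4 : IntervalIntegrable (fun x => 1 / |h x|) volume a b := by
    refine ContinuousOn.intervalIntegrable ?_
    rw [hIcc]
    exact continuousOn_const.div hhc.abs fun x hx => abs_ne_zero.2 (hne x hx)
  have hs2 : s * s = 1 := by rcases hs with rfl | rfl <;> norm_num
  have step : ∫ x in a..b, 1 / |h x| ≤ ∫ x in a..b, s * (h' x / h x) / m := by
    refine intervalIntegral.integral_mono_on hab hI4 hI1 fun x hx => ?_
    have hpos : 0 < |h x| := abs_pos.2 (hne x hx)
    have : s * (h' x / h x) = h' x / |h x| := by
      rw [hsabs x hx]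
      have := hne x hx
      rcases hs with rfl | rfl <;> field_simp
    rw [this, div_right_comm, div_le_div_iff_of_pos_right hpos, le_div_iff₀ hm, one_mul]
    exact hslope x hx
  refine step.trans ?_
  have hval : ∫ x in a..b, s * (h' x / h x) / m =
      s * Real.log (h b) / m - s * Real.log (h a) / m :=
    intervalIntegral.integral_eq_sub_of_hasDerivAt
      (f := fun x => s * Real.log (h x) / m)
      (fun x hx => (((hh x (hIcc ▸ hx)).log (hne x (hIcc ▸ hx))).const_mul s).div_const m) hI1
  rw [hval, ← sub_div, ← mul_sub]
  refine div_le_div_of_nonneg_right ?_ hm.le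
  have hlo : ∀ x ∈ Set.Icc a b, Real.log δ ≤ Real.log (h x) := fun x hx => by
    rw [← Real.log_abs (h x)]; exact Real.log_le_log hδ (hfar' x hx)
  have hhi : ∀ x ∈ Set.Icc a b, Real.log (h x) ≤ Real.log g := fun x hx => by
    rw [← Real.log_abs (h x)]
    exact Real.log_le_log (abs_pos.2 (hne x hx)) (hg x hx)
  have ha : a ∈ Set.Icc a b := ⟨le_rfl, hab⟩
  have hb : b ∈ Set.Icc a b := ⟨hab, le_rfl⟩
  have hgp : 0 < g := hδ.trans_le ((hfar' a ha).trans (hg a ha))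
  rw [Real.log_div hgp.ne' hδ.ne']
  have := hlo a ha; have := hlo b hb; have := hhi a ha; have := hhi b hb
  rcases hs with rfl | rfl <;> linarith

/-- A continuous monotone function crosses the level `t` at most once. -/
theorem exists_level_split {a b : ℝ} (hab : a ≤ b) {h : ℝ → ℝ}
    (hc : ContinuousOn h (Set.Icc a b)) (hm : MonotoneOn h (Set.Icc a b)) (t : ℝ) :
    ∃ c ∈ Set.Icc a b, (c = a ∨ ∀ x ∈ Set.Icc a c, h x ≤ t) ∧
      (c = b ∨ ∀ x ∈ Set.Icc c b, t ≤ h x) := by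
  by_cases h1 : t ≤ h a
  · exact ⟨a, ⟨le_rfl, hab⟩, Or.inl rfl,
      Or.inr fun x hx => h1.trans (hm ⟨le_rfl, hab⟩ hx hx.1)⟩
  by_cases h2 : h b ≤ t
  · exact ⟨b, ⟨hab, le_rfl⟩, Or.inr fun x hx => (hm hx ⟨hab, le_rfl⟩ hx.2).trans h2, Or.inl rfl⟩
  obtain ⟨c, hcm, hct⟩ := intermediate_value_Icc hab hc ⟨(not_le.1 h1).le, (not_le.1 h2).le⟩
  exact ⟨c, hcm, Or.inr fun x hx => hct ▸ hm ⟨hx.1, hx.2.trans hcm.2⟩ hcm hx.2,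
    Or.inr fun x hx => hct ▸ hm hcm ⟨hcm.1.trans hx.1, hx.2⟩ hx.1⟩

/-- Data for an oscillatory integral `∫ k₀` with `k₁' = h k₀ + e` and `h` nondecreasing. -/
structure OscData (a b : ℝ) (h h' : ℝ → ℝ) (k₀ k₁ e : ℝ → ℂ) : Prop where
  hasDerivAt_h : ∀ x ∈ Set.Icc a b, HasDerivAt h (h' x) x
  hasDerivAt_k : ∀ x ∈ Set.Icc a b, HasDerivAt k₁ (h x * k₀ x + e x) x
  cont_h' : ContinuousOn h' (Set.Icc a b)
  cont_k : ContinuousOn k₀ (Set.Icc a b)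
  cont_e : ContinuousOn e (Set.Icc a b)
  nonneg : ∀ x ∈ Set.Icc a b, 0 ≤ h' x

namespace OscData

variable {a b : ℝ} {h h' : ℝ → ℝ} {k₀ k₁ e : ℝ → ℂ}

theorem mono (H : OscData a b h h' k₀ k₁ e) {a' b' : ℝ} (ha : a ≤ a') (hb : b' ≤ b) :
    OscData a' b' h h' k₀ k₁ e := by
  have hs : Set.Icc a' b' ⊆ Set.Icc a b := Set.Icc_subset_Icc ha hb
  exact ⟨fun x hx => H.1 x (hs hx), fun x hx => H.2 x (hs hx), H.3.mono hs, H.4.mono hs,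
    H.5.mono hs, fun x hx => H.6 x (hs hx)⟩

theorem cont_h (H : OscData a b h h' k₀ k₁ e) : ContinuousOn h (Set.Icc a b) :=
  fun x hx => (H.1 x hx).continuousAt.continuousWithinAt

theorem monotoneOn (H : OscData a b h h' k₀ k₁ e) : MonotoneOn h (Set.Icc a b) := by
  refine monotoneOn_of_deriv_nonneg (convex_Icc a b) H.cont_h ?_ ?_
  · intro x hx
    exact (H.1 x (interior_subset hx)).differentiableAt.differentiableWithinAt
  · intro x hx
    rw [(H.1 x (interior_subset hx)).deriv]
    exact H.6 x (interior_subset hx)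

theorem intervalIntegrable (H : OscData a b h h' k₀ k₁ e) {c d : ℝ} (hc : c ∈ Set.Icc a b)
    (hd : d ∈ Set.Icc a b) : IntervalIntegrable k₀ volume c d :=
  (H.cont_k.mono (Set.uIcc_subset_Icc hc hd)).intervalIntegrable

theorem norm_integral_le_far (H : OscData a b h h' k₀ k₁ e) (hab : a ≤ b) {δ M₁ D : ℝ}
    (hδ : 0 < δ) (hfar : ∀ x ∈ Set.Icc a b, δ ≤ |h x|)
    (hM : ∀ x ∈ Set.Icc a b, ‖k₁ x‖ ≤ M₁) (hD : ∀ x ∈ Set.Icc a b, ‖e x‖ ≤ D) :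
    ‖∫ x in a..b, k₀ x‖ ≤ 4 * M₁ / δ + D * ((b - a) / δ) := by
  have hD0 : 0 ≤ D := (norm_nonneg _).trans (hD a ⟨le_rfl, hab⟩)
  refine (norm_integral_le_of_le_abs hab hδ H.1 H.2 H.3 H.4 H.5 H.6 hfar hM hD).trans ?_
  gcongr
  exact integral_one_div_abs_le hab hδ H.cont_h hfar

/-- Splitting of the domain of integration at the levels `±t` of `h`. -/
theorem norm_integral_le_split (H : OscData a b h h' k₀ k₁ e) (hab : a ≤ b) {t B₁ B₂ : ℝ}
    (hB₁ : 0 ≤ B₁) (hB₂ : 0 ≤ B₂)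
    (hfar : ∀ c ∈ Set.Icc a b, ∀ d ∈ Set.Icc a b, c ≤ d →
      ((∀ x ∈ Set.Icc c d, t ≤ h x) ∨ (∀ x ∈ Set.Icc c d, h x ≤ -t)) →
      ‖∫ x in c..d, k₀ x‖ ≤ B₁)
    (hnear : ∀ c ∈ Set.Icc a b, ∀ d ∈ Set.Icc a b, c ≤ d →
      (∀ x ∈ Set.Icc c d, |h x| ≤ t) → ‖∫ x in c..d, k₀ x‖ ≤ B₂) :
    ‖∫ x in a..b, k₀ x‖ ≤ 2 * B₁ + B₂ := by
  obtain ⟨c, hc, hc1, hc2⟩ := exists_level_split hab H.cont_h H.monotoneOn (-t)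
  have Hc := H.mono hc.1 le_rfl
  obtain ⟨d, hd, hd1, hd2⟩ := exists_level_split hc.2 Hc.cont_h Hc.monotoneOn t
  have hd' : d ∈ Set.Icc a b := ⟨hc.1.trans hd.1, hd.2⟩
  have ha : a ∈ Set.Icc a b := ⟨le_rfl, hab⟩
  have hb : b ∈ Set.Icc a b := ⟨hab, le_rfl⟩
  have e1 : ‖∫ x in a..c, k₀ x‖ ≤ B₁ := by
    rcases hc1 with rfl | h1
    · simpa using hB₁
    · exact hfar a ha c hc hc.1 (Or.inr h1)
  have e3 : ‖∫ x in d..b, k₀ x‖ ≤ B₁ := by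
    rcases hd2 with rfl | h1
    · simpa using hB₁
    · exact hfar d hd' b hb hd.2 (Or.inl h1)
  have e2 : ‖∫ x in c..d, k₀ x‖ ≤ B₂ := by
    rcases hd1 with rfl | h1
    · simpa using hB₂
    rcases hc2 with rfl | h2
    · obtain rfl : d = c := le_antisymm hd.2 hd.1
      simpa using hB₂
    · exact hnear c hc d hd' hd.1 fun x hx =>
        abs_le.2 ⟨h2 x ⟨hx.1, hx.2.trans hd.2⟩, h1 x hx⟩
  have hsum : ∫ x in a..b, k₀ x = (∫ x in a..c, k₀ x) + (∫ x in c..d, k₀ x) +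
      ∫ x in d..b, k₀ x := by
    rw [intervalIntegral.integral_add_adjacent_intervals (H.intervalIntegrable ha hc)
      (H.intervalIntegrable hc hd'), intervalIntegral.integral_add_adjacent_intervals
      (H.intervalIntegrable ha hd') (H.intervalIntegrable hd' hb)]
  rw [hsum]
  refine (norm_add₃_le).trans ?_
  linarith

/-- Van der Corput estimate in terms of the width `ω` of the sublevel set `|h| ≤ δ`. -/
theorem norm_integral_le (H : OscData a b h h' k₀ k₁ e) (hab : a ≤ b) {δ ω M M₁ D : ℝ}
    (hδ : 0 < δ) (hω : 0 ≤ ω)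
    (hM₀ : ∀ x ∈ Set.Icc a b, ‖k₀ x‖ ≤ M)
    (hM : ∀ x ∈ Set.Icc a b, ‖k₁ x‖ ≤ M₁) (hD : ∀ x ∈ Set.Icc a b, ‖e x‖ ≤ D)
    (hw : ∀ x ∈ Set.Icc a b, ∀ y ∈ Set.Icc a b, x ≤ y → |h x| ≤ δ → |h y| ≤ δ → y - x ≤ ω) :
    ‖∫ x in a..b, k₀ x‖ ≤ 2 * (4 * M₁ / δ + D * ((b - a) / δ)) + M * ω := by
  have ha : a ∈ Set.Icc a b := ⟨le_rfl, hab⟩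
  have hM0 : 0 ≤ M := (norm_nonneg _).trans (hM₀ a ha)
  have hM10 : 0 ≤ M₁ := (norm_nonneg _).trans (hM a ha)
  have hD0 : 0 ≤ D := (norm_nonneg _).trans (hD a ha)
  have hba : 0 ≤ b - a := sub_nonneg.2 hab
  refine H.norm_integral_le_split hab (t := δ) (by positivity) (by positivity) ?_ ?_
  · intro c hc d hd hcd hf
    have hs : Set.Icc c d ⊆ Set.Icc a b := Set.Icc_subset_Icc hc.1 hd.2
    refine ((H.mono hc.1 hd.2).norm_integral_le_far hcd hδ ?_ (fun x hx => hM x (hs hx))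
      (fun x hx => hD x (hs hx))).trans ?_
    · rcases hf with hf | hf
      · exact fun x hx => (hf x hx).trans (le_abs_self _)
      · exact fun x hx => le_abs.2 (Or.inr (by linarith [hf x hx]))
    · gcongr
      · exact hd.2
      · exact hc.1
  · intro c hc d hd hcd hn
    have := intervalIntegral.norm_integral_le_of_norm_le_const (a := c) (b := d) (f := k₀)
      (C := M) fun x hx => by
        rw [Set.uIoc_of_le hcd] at hx
        exact hM₀ x ⟨hc.1.trans hx.1.le, hx.2.trans hd.2⟩
    refine this.trans ?_
    rw [abs_of_nonneg (sub_nonneg.2 hcd)]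
    exact mul_le_mul_of_nonneg_left (hw c hc d hd hcd (hn c ⟨le_rfl, hcd⟩)
      (hn d ⟨hcd, le_rfl⟩)) hM0

/-- Van der Corput estimate with uniform slope `h' ≥ m`, with separate bounds in the regions
`|h| ≥ g` and `|h| ≤ g`. -/
theorem norm_integral_le_near_far (H : OscData a b h h' k₀ k₁ e) (hab : a ≤ b)
    {δ g m M M₁ D Mf Df : ℝ} (hδ : 0 < δ) (hδg : δ ≤ g) (hm : 0 < m)
    (hslope : ∀ x ∈ Set.Icc a b, m ≤ h' x)
    (hM : 0 ≤ M) (hM₁ : 0 ≤ M₁) (hD : 0 ≤ D) (hMf : 0 ≤ Mf) (hDf : 0 ≤ Df)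
    (hkn : ∀ x ∈ Set.Icc a b, |h x| ≤ g → ‖k₀ x‖ ≤ M)
    (hk₁n : ∀ x ∈ Set.Icc a b, |h x| ≤ g → ‖k₁ x‖ ≤ M₁)
    (hen : ∀ x ∈ Set.Icc a b, |h x| ≤ g → ‖e x‖ ≤ D)
    (hk₁f : ∀ x ∈ Set.Icc a b, g ≤ |h x| → ‖k₁ x‖ ≤ Mf)
    (hef : ∀ x ∈ Set.Icc a b, g ≤ |h x| → ‖e x‖ ≤ Df) :
    ‖∫ x in a..b, k₀ x‖ ≤ 2 * (4 * Mf / g + Df * ((b - a) / g)) +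
      (2 * (4 * M₁ / δ + D * (Real.log (g / δ) / m)) + M * (2 * δ / m)) := by
  have hg : 0 < g := hδ.trans_le hδg
  have hlog : 0 ≤ Real.log (g / δ) := Real.log_nonneg ((one_le_div hδ).2 hδg)
  have hba : 0 ≤ b - a := sub_nonneg.2 hab
  refine H.norm_integral_le_split hab (t := g) (by positivity) (by positivity) ?_ ?_
  · intro c hc d hd hcd hf
    have hs : Set.Icc c d ⊆ Set.Icc a b := Set.Icc_subset_Icc hc.1 hd.2
    have hf' : ∀ x ∈ Set.Icc c d, g ≤ |h x| := by
      rcases hf with hf | hf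
      · exact fun x hx => (hf x hx).trans (le_abs_self _)
      · exact fun x hx => le_abs.2 (Or.inr (by linarith [hf x hx]))
    refine ((H.mono hc.1 hd.2).norm_integral_le_far hcd hg hf'
      (fun x hx => hk₁f x (hs hx) (hf' x hx)) (fun x hx => hef x (hs hx) (hf' x hx))).trans ?_
    gcongr
    · exact hd.2
    · exact hc.1
  · intro c hc d hd hcd hn
    have hs : Set.Icc c d ⊆ Set.Icc a b := Set.Icc_subset_Icc hc.1 hd.2
    have H' := H.mono hc.1 hd.2
    refine H'.norm_integral_le_split hcd (t := δ) (by positivity) (by positivity) ?_ ?_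
    · intro p hp q hq hpq hf
      have hs' : Set.Icc p q ⊆ Set.Icc c d := Set.Icc_subset_Icc hp.1 hq.2
      have hf' : ∀ x ∈ Set.Icc p q, δ ≤ |h x| := by
        rcases hf with hf | hf
        · exact fun x hx => (hf x hx).trans (le_abs_self _)
        · exact fun x hx => le_abs.2 (Or.inr (by linarith [hf x hx]))
      have H'' := H'.mono hp.1 hq.2
      refine (norm_integral_le_of_le_abs hpq hδ H''.1 H''.2 H''.3 H''.4 H''.5 H''.6 hf'
        (fun x hx => hk₁n x (hs (hs' hx)) (hn x (hs' hx)))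
        (fun x hx => hen x (hs (hs' hx)) (hn x (hs' hx)))).trans ?_
      gcongr
      exact integral_one_div_abs_le_log hpq hδ hm H''.1 H''.3
        (fun x hx => hslope x (hs (hs' hx))) hf (fun x hx => hn x (hs' hx))
    · intro p hp q hq hpq hn'
      have := intervalIntegral.norm_integral_le_of_norm_le_const (a := p) (b := q) (f := k₀)
        (C := M) fun x hx => by
          rw [Set.uIoc_of_le hpq] at hx
          have hx' : x ∈ Set.Icc c d := ⟨hp.1.trans hx.1.le, hx.2.trans hq.2⟩
          exact hkn x (hs hx') (hn x hx')
      refine this.trans ?_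
      rw [abs_of_nonneg (sub_nonneg.2 hpq)]
      refine mul_le_mul_of_nonneg_left ?_ hM
      rw [le_div_iff₀ hm]
      have hmv : m * (q - p) ≤ h q - h p := by
        have H'' := H'.mono hp.1 hq.2
        have := Convex.mul_sub_le_image_sub_of_le_deriv (convex_Icc p q) (f := h)
          H''.cont_h (fun x hx =>
            (H''.1 x (interior_subset hx)).differentiableAt.differentiableWithinAt)
          (C := m) (fun x hx => by
            have hx' := interior_subset hx
            rw [(H''.1 x hx').deriv]
            exact hslope x (hs ⟨hp.1.trans hx'.1, hx'.2.trans hq.2⟩))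
          p ⟨le_rfl, hpq⟩ q ⟨hpq, le_rfl⟩ hpq
        exact this
      have h1 := abs_le.1 (hn' p ⟨le_rfl, hpq⟩)
      have h2 := abs_le.1 (hn' q ⟨hpq, le_rfl⟩)
      linarith

end OscData

/-- The moment `∫₀^∞ t^q e^{-ωt-ct³} dt`. -/
noncomputable def moment (q ω c : ℝ) : ℝ :=
  ∫ t in Set.Ioi (0:ℝ), t ^ q * Real.exp (-ω * t - c * t ^ 3)

theorem integrableOn_moment {q c : ℝ} (hq : -1 < q) (hc : 0 < c) (ω : ℝ) :
    IntegrableOn (fun t : ℝ => t ^ q * Real.exp (-ω * t - c * t ^ 3)) (Set.Ioi 0) := by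
  have h1 := (integrableOn_rpow_mul_exp_neg_mul_rpow (p := 1) (s := q) (b := 1) hq one_pos
    one_pos).const_mul (Real.exp ((|ω| + 1) * ((|ω| + 1) / c + 1)))
  refine Integrable.mono' h1 ?_ ?_
  · refine ContinuousOn.aestronglyMeasurable ?_ measurableSet_Ioi
    refine ContinuousOn.mul (fun t ht => (Real.continuousAt_rpow_const _ _
      (Or.inl ht.out.ne')).continuousWithinAt) ?_
    fun_prop
  · refine (ae_restrict_iff' measurableSet_Ioi).2 (ae_of_all _ fun t ht => ?_)
    have ht0 : 0 < t := ht
    have hr : 0 ≤ t ^ q := Real.rpow_nonneg ht0.le _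
    rw [Real.norm_eq_abs, abs_of_nonneg (by positivity), Real.rpow_one]
    rw [mul_left_comm, ← Real.exp_add]
    gcongr
    have hω := neg_abs_le ω
    set m := |ω| + 1 with hm
    have hm1 : 0 < m := by positivity
    set R := m / c + 1 with hR
    have hR1 : 1 ≤ R := by rw [hR]; linarith [div_pos hm1 hc]
    have hcR : m ≤ c * R := by rw [hR, mul_add, mul_div_cancel₀ _ hc.ne']; linarith
    have key : m * t ≤ m * R + c * t ^ 3 := by
      rcases le_total t R with h | h
      · have : 0 ≤ c * t ^ 3 := by positivity
        nlinarith
      · have h2 : c * R ≤ c * t ^ 2 := by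
          apply mul_le_mul_of_nonneg_left _ hc.le
          nlinarith
        have h3 : m * t ≤ c * t ^ 2 * t := mul_le_mul_of_nonneg_right (hcR.trans h2) ht0.le
        have : 0 ≤ m * R := by positivity
        nlinarith
    have : (-ω) * t ≤ (m - 1) * t := mul_le_mul_of_nonneg_right (by rw [hm]; linarith) ht0.le
    linarith

theorem aestronglyMeasurable_moment (q ω c : ℝ) :
    AEStronglyMeasurable (fun t : ℝ => t ^ q * Real.exp (-ω * t - c * t ^ 3))
      (volume.restrict (Set.Ioi 0)) := by
  refine ContinuousOn.aestronglyMeasurable ?_ measurableSet_Ioi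
  refine ContinuousOn.mul (fun t ht => (Real.continuousAt_rpow_const _ _
    (Or.inl ht.out.ne')).continuousWithinAt) ?_
  fun_prop

theorem hasDerivAt_moment_left {q c : ℝ} (hq : -1 < q) (hc : 0 < c) (ω : ℝ) :
    HasDerivAt (fun ω => moment q ω c) (-moment (q + 1) ω c) ω := by
  have := hasDerivAt_integral_of_dominated_loc_of_deriv_le
    (μ := volume.restrict (Set.Ioi (0:ℝ)))
    (F := fun ω t => t ^ q * Real.exp (-ω * t - c * t ^ 3))
    (F' := fun ω t => -(t ^ (q + 1) * Real.exp (-ω * t - c * t ^ 3)))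
    (x₀ := ω) (s := Metric.ball ω 1) (bound := fun t => t ^ (q + 1) *
      Real.exp (-(ω - 1) * t - c * t ^ 3)) (Metric.ball_mem_nhds _ one_pos)
    (Eventually.of_forall fun x => aestronglyMeasurable_moment q x c)
    (integrableOn_moment hq hc ω) (aestronglyMeasurable_moment (q + 1) ω c).neg ?_
    (integrableOn_moment (by linarith) hc (ω - 1)) ?_
  · have h2 := this.2
    rw [integral_neg] at h2
    exact h2
  · refine (ae_restrict_iff' measurableSet_Ioi).2 (ae_of_all _ fun t ht x hx => ?_)
    have ht0 : 0 < t := ht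
    have hr : 0 ≤ t ^ (q + 1) := Real.rpow_nonneg ht0.le _
    rw [norm_neg, Real.norm_eq_abs, abs_of_nonneg (by positivity)]
    have := (abs_lt.1 (by simpa [Real.dist_eq] using hx : |x - ω| < 1)).1
    gcongr
    linarith
  · refine (ae_restrict_iff' measurableSet_Ioi).2 (ae_of_all _ fun t ht x hx => ?_)
    have ht0 : 0 < t := ht
    have h1 : HasDerivAt (fun x : ℝ => -x * t - c * t ^ 3) (-1 * t) x :=
      ((hasDerivAt_id x).neg.mul_const t).sub_const _
    refine (h1.exp.const_mul (t ^ q)).congr_deriv ?_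
    rw [Real.rpow_add_one ht0.ne']
    ring

theorem hasDerivAt_moment_right {q c : ℝ} (hq : -1 < q) (hc : 0 < c) (ω : ℝ) :
    HasDerivAt (fun c => moment q ω c) (-moment (q + 3) ω c) c := by
  have := hasDerivAt_integral_of_dominated_loc_of_deriv_le
    (μ := volume.restrict (Set.Ioi (0:ℝ)))
    (F := fun c t => t ^ q * Real.exp (-ω * t - c * t ^ 3))
    (F' := fun c t => -(t ^ (q + 3) * Real.exp (-ω * t - c * t ^ 3)))
    (x₀ := c) (s := Metric.ball c (c / 2)) (bound := fun t => t ^ (q + 3) *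
      Real.exp (-ω * t - c / 2 * t ^ 3)) (Metric.ball_mem_nhds _ (by positivity))
    (Eventually.of_forall fun x => aestronglyMeasurable_moment q ω x)
    (integrableOn_moment hq hc ω) (aestronglyMeasurable_moment (q + 3) ω c).neg ?_
    (integrableOn_moment (by linarith) (by positivity) ω) ?_
  · have h2 := this.2
    rw [integral_neg] at h2
    exact h2
  · refine (ae_restrict_iff' measurableSet_Ioi).2 (ae_of_all _ fun t ht x hx => ?_)
    have ht0 : 0 < t := ht
    have hr : 0 ≤ t ^ (q + 3) := Real.rpow_nonneg ht0.le _
    rw [norm_neg, Real.norm_eq_abs, abs_of_nonneg (by positivity)]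
    have := (abs_lt.1 (by simpa [Real.dist_eq] using hx : |x - c| < c / 2)).1
    gcongr
    linarith
  · refine (ae_restrict_iff' measurableSet_Ioi).2 (ae_of_all _ fun t ht x hx => ?_)
    have ht0 : 0 < t := ht
    have h1 : HasDerivAt (fun x : ℝ => -ω * t - x * t ^ 3) (-(1 * t ^ 3)) x :=
      ((hasDerivAt_id x).mul_const (t ^ 3)).const_sub _
    refine (h1.exp.const_mul (t ^ q)).congr_deriv ?_
    have : t ^ (q + 3) = t ^ q * t ^ 3 := by
      rw [Real.rpow_add ht0]; norm_cast
    rw [this]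
    ring

theorem moment_pos {q c : ℝ} (hq : -1 < q) (hc : 0 < c) (ω : ℝ) : 0 < moment q ω c := by
  refine (setIntegral_pos_iff_support_of_nonneg_ae ?_ (integrableOn_moment hq hc ω)).2 ?_
  · refine (ae_restrict_iff' measurableSet_Ioi).2 (ae_of_all _ fun t ht => ?_)
    have := Real.rpow_nonneg (le_of_lt ht.out) q
    simp only [Pi.zero_apply]
    positivity
  · have : Set.Ioi (0:ℝ) ⊆ Function.support
        (fun t : ℝ => t ^ q * Real.exp (-ω * t - c * t ^ 3)) := fun t ht =>
      mul_ne_zero (Real.rpow_pos_of_pos ht _).ne' (Real.exp_pos _).ne'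
    rw [Set.inter_eq_right.2 this]
    simp

theorem moment_antitone {q c c' : ℝ} (hq : -1 < q) (hc : 0 < c) (hcc' : c ≤ c') (ω : ℝ) :
    moment q ω c' ≤ moment q ω c := by
  refine setIntegral_mono_on (integrableOn_moment hq (hc.trans_le hcc') ω)
    (integrableOn_moment hq hc ω) measurableSet_Ioi fun t ht => ?_
  have ht0 : (0:ℝ) < t := ht
  have := Real.rpow_nonneg ht0.le q
  gcongr

theorem moment_le_Gamma {q c : ℝ} (hq : -1 < q) (hc : 0 < c) :
    moment q 1 c ≤ Real.Gamma (q + 1) := by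
  have h1 := integrableOn_rpow_mul_exp_neg_mul_rpow (p := 1) (s := q) (b := 1) hq one_pos one_pos
  have h2 := _root_.integral_rpow_mul_exp_neg_mul_rpow (p := 1) (q := q) (b := 1) one_pos hq one_pos
  simp only [Real.one_rpow, div_one, one_mul] at h2
  rw [← h2]
  refine setIntegral_mono_on (integrableOn_moment hq hc 1) h1 measurableSet_Ioi fun t ht => ?_
  have ht0 : (0:ℝ) < t := ht
  have := Real.rpow_nonneg ht0.le q
  rw [Real.rpow_one]
  gcongr
  have : 0 ≤ c * t ^ 3 := by positivity
  linarith

theorem moment_scaling {ω : ℝ} (hω : 0 < ω) (c : ℝ) :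
    moment (-(1/2)) ω c = ω ^ (-(1/2) : ℝ) * moment (-(1/2)) 1 (c * (ω ^ 3)⁻¹) := by
  have := integral_comp_mul_left_Ioi
    (fun t : ℝ => t ^ (-(1/2) : ℝ) * Real.exp (-1 * t - c * (ω ^ 3)⁻¹ * t ^ 3)) 0 hω
  rw [mul_zero, smul_eq_mul] at this
  have h2 : moment (-(1/2)) 1 (c * (ω ^ 3)⁻¹) = ω * ∫ x in Set.Ioi (0:ℝ),
      (ω * x) ^ (-(1/2) : ℝ) * Real.exp (-1 * (ω * x) - c * (ω ^ 3)⁻¹ * (ω * x) ^ 3) := by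
    rw [this, moment, mul_inv_cancel_left₀ hω.ne']
  rw [h2, moment]
  have h3 : ∀ x ∈ Set.Ioi (0:ℝ), (ω * x) ^ (-(1/2) : ℝ) *
      Real.exp (-1 * (ω * x) - c * (ω ^ 3)⁻¹ * (ω * x) ^ 3) =
      ω ^ (-(1/2) : ℝ) * (x ^ (-(1/2) : ℝ) * Real.exp (-ω * x - c * x ^ 3)) := by
    intro x hx
    rw [Real.mul_rpow hω.le (le_of_lt hx.out), mul_assoc]
    congr 3
    field_simp
  rw [setIntegral_congr_fun measurableSet_Ioi h3, integral_const_mul]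
  have h4 : ω ^ (-(1/2) : ℝ) * (ω * ω ^ (-(1/2) : ℝ)) = 1 := by
    rw [mul_left_comm, ← Real.rpow_add hω]
    norm_num
    rw [Real.rpow_neg_one, mul_inv_cancel₀ hω.ne']
  linear_combination (-(∫ a in Set.Ioi (0:ℝ), a ^ (-(1/2) : ℝ) *
    Real.exp (-ω * a - c * a ^ 3))) * h4

/-- The integration-by-parts relation behind the third order equation for
`∫ e^{-ωt-t³/12}t^{-1/2}`. -/
theorem moment_relation (ω : ℝ) :
    2 * moment (-(1/2)) ω (1/12) - 4 * ω * moment (1/2) ω (1/12) - moment (5/2) ω (1/12) = 0 := by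
  have i1 := integrableOn_moment (q := -(1/2)) (c := 1/12) (by norm_num) (by norm_num) ω
  have i2 := integrableOn_moment (q := 1/2) (c := 1/12) (by norm_num) (by norm_num) ω
  have i3 := integrableOn_moment (q := 5/2) (c := 1/12) (by norm_num) (by norm_num) ω
  have hd : ∀ t ∈ Set.Ioi (0:ℝ), HasDerivAt
      (fun t : ℝ => 4 * (t ^ (1/2 : ℝ) * Real.exp (-ω * t - 1/12 * t ^ 3)))
      (2 * (t ^ (-(1/2) : ℝ) * Real.exp (-ω * t - 1/12 * t ^ 3)) -
        4 * ω * (t ^ (1/2 : ℝ) * Real.exp (-ω * t - 1/12 * t ^ 3)) -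
        t ^ (5/2 : ℝ) * Real.exp (-ω * t - 1/12 * t ^ 3)) t := by
    intro t ht
    have ht0 : (0:ℝ) < t := ht
    have h1 : HasDerivAt (fun x : ℝ => -ω * x - 1/12 * x ^ 3) (-ω * 1 - 1/12 * (3 * t ^ 2)) t := by
      refine (((hasDerivAt_id t).const_mul (-ω)).sub
        ((hasDerivAt_pow 3 t).const_mul (1/12))).congr_deriv ?_
      norm_num
    have h2 := Real.hasDerivAt_rpow_const (x := t) (p := 1/2) (Or.inl ht0.ne')
    refine ((h2.mul h1.exp).const_mul 4).congr_deriv ?_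
    have e1 : t ^ (5/2 : ℝ) = t ^ (1/2 : ℝ) * t ^ 2 := by
      rw [show (5/2 : ℝ) = 1/2 + (2:ℕ) by norm_num, Real.rpow_add_natCast ht0.ne']
    rw [e1, show (1/2 - 1 : ℝ) = -(1/2) by norm_num]
    ring
  have hint := ((i1.const_mul 2).sub (i2.const_mul (4 * ω))).sub i3
  have hlim := tendsto_zero_of_hasDerivAt_of_integrableOn_Ioi hd hint (i2.const_mul 4)
  have key := integral_Ioi_of_hasDerivAt_of_tendsto (a := 0) (m := 0) ?_ hd hint hlim
  · rw [integral_sub, integral_sub, integral_const_mul, integral_const_mul] at key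
    · simpa [moment] using key
    · exact i1.const_mul 2
    · exact i2.const_mul _
    · exact (i1.const_mul 2).sub (i2.const_mul (4 * ω))
    · exact i3
  · refine ContinuousAt.continuousWithinAt ?_
    refine ContinuousAt.const_mul ?_ _
    refine (Real.continuousAt_rpow_const _ _ (Or.inr (by norm_num))).mul ?_
    fun_prop

theorem moment_zero {q c : ℝ} (hq : -1 < q) (hc : 0 < c) :
    moment q 0 c = c ^ (-(q + 1) / 3) * (1 / 3) * Real.Gamma ((q + 1) / 3) := by
  rw [← _root_.integral_rpow_mul_exp_neg_mul_rpow (by norm_num : (0:ℝ) < 3) hq hc, moment]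
  refine setIntegral_congr_fun measurableSet_Ioi fun t _ => ?_
  have : t ^ (3:ℝ) = t ^ 3 := by norm_cast
  simp only [this]
  simp

theorem Gamma_third_mul : Real.Gamma (1/3) * Real.Gamma (2/3) = 2 * π / √3 := by
  have := Real.Gamma_mul_Gamma_one_sub (1/3)
  rw [show π * (1/3) = π / 3 by ring, Real.sin_pi_div_three] at this
  rw [show (2/3 : ℝ) = 1 - 1/3 by norm_num, this]
  field_simp

theorem twelfth_rpow (e : ℝ) : (1/12 : ℝ) ^ (-e) = 2 ^ (2 * e) * 3 ^ e := by
  rw [one_div, Real.inv_rpow (by norm_num), Real.rpow_neg (by norm_num), inv_inv,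
    show (12:ℝ) = 2 ^ (2:ℝ) * 3 by norm_num, Real.mul_rpow (by norm_num) (by norm_num),
    ← Real.rpow_mul (by norm_num)]

theorem moment_neg_half_zero : moment (-(1/2)) 0 (1/12) =
    4 * (π * √π) * ((3:ℝ) ^ (-(2/3) : ℝ) / Real.Gamma (2/3)) ^ 2 := by
  have hG := Gamma_third_mul
  have hD := Real.Gamma_mul_Gamma_add_half (1/6)
  have h1 : (0:ℝ) < Real.Gamma (1/3) := Real.Gamma_pos_of_pos (by norm_num)
  have h2 : (0:ℝ) < Real.Gamma (2/3) := Real.Gamma_pos_of_pos (by norm_num)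
  rw [moment_zero (by norm_num) (by norm_num), show (-(-(1/2) + 1) / 3 : ℝ) = -(1/6) by norm_num,
    twelfth_rpow, show ((-(1/2) + 1) / 3 : ℝ) = 1/6 by norm_num]
  norm_num at hD ⊢
  set t : ℝ := 2 ^ (1/3 : ℝ) with ht
  set y : ℝ := 3 ^ (1/6 : ℝ) with hy
  have ht0 : 0 < t := by positivity
  have hy0 : 0 < y := by positivity
  have ht3 : t ^ 3 = 2 := by rw [ht, ← Real.rpow_natCast, ← Real.rpow_mul] <;> norm_num
  have hy6 : y ^ 6 = 3 := by rw [hy, ← Real.rpow_natCast, ← Real.rpow_mul] <;> norm_num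
  have e1 : (2:ℝ) ^ (2/3 : ℝ) = t ^ 2 := by
    rw [ht, ← Real.rpow_natCast, ← Real.rpow_mul] <;> norm_num
  have e2 : √3 = y ^ 3 := by
    rw [hy, ← Real.rpow_natCast, ← Real.rpow_mul, Real.sqrt_eq_rpow] <;> norm_num
  have e3 : (3:ℝ) ^ (-(2/3) : ℝ) = (y ^ 4)⁻¹ := by
    rw [hy, ← Real.rpow_natCast, ← Real.rpow_mul, ← Real.rpow_neg] <;> norm_num
  rw [e1] at hD
  rw [e2] at hG
  rw [e3]
  set u := √π
  have hG1 : Real.Gamma (1/3) = 2 * π / y ^ 3 / Real.Gamma (2/3) := by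
    rw [← hG]; field_simp
  rw [hG1] at hD
  have hG6 : Real.Gamma (1/6) =
      2 * π / y ^ 3 / Real.Gamma (2/3) * t ^ 2 * u / Real.Gamma (2/3) := by
    rw [← hD]; field_simp
  rw [hG6]
  field_simp
  linear_combination u * ((2 * y ^ 6) * ht3 + 4 * hy6)

theorem moment_half_zero : moment (1/2) 0 (1/12) =
    4 * (π * √π) * ((3:ℝ) ^ (-(2/3) : ℝ) / Real.Gamma (2/3)) *
      ((3:ℝ) ^ (-(1/3) : ℝ) / Real.Gamma (1/3)) := by
  have hG := Gamma_third_mul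
  have h1 : (0:ℝ) < Real.Gamma (1/3) := Real.Gamma_pos_of_pos (by norm_num)
  have h2 : (0:ℝ) < Real.Gamma (2/3) := Real.Gamma_pos_of_pos (by norm_num)
  rw [moment_zero (by norm_num) (by norm_num), show (-((1/2) + 1) / 3 : ℝ) = -(1/2) by norm_num,
    twelfth_rpow, show (((1/2) + 1) / 3 : ℝ) = 1/2 by norm_num, Real.Gamma_one_half_eq,
    ← Real.sqrt_eq_rpow, mul_one_div_cancel two_ne_zero, Real.rpow_one]
  have e : (3:ℝ) ^ (-(2/3) : ℝ) * (3:ℝ) ^ (-(1/3) : ℝ) = 1/3 := by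
    rw [← Real.rpow_add (by norm_num)]; norm_num
  have : 4 * (π * √π) * ((3:ℝ) ^ (-(2/3) : ℝ) / Real.Gamma (2/3)) *
      ((3:ℝ) ^ (-(1/3) : ℝ) / Real.Gamma (1/3)) = 4 * (π * √π) * ((3:ℝ) ^ (-(2/3) : ℝ) *
      (3:ℝ) ^ (-(1/3) : ℝ)) / (Real.Gamma (1/3) * Real.Gamma (2/3)) := by
    field_simp
  rw [this, e, hG]
  have h3 : √3 ^ 2 = 3 := Real.sq_sqrt (by norm_num)
  field_simp
  norm_num

theorem moment_three_half_zero : moment (3/2) 0 (1/12) / 2 =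
    4 * (π * √π) * ((3:ℝ) ^ (-(1/3) : ℝ) / Real.Gamma (1/3)) ^ 2 := by
  have hG := Gamma_third_mul
  have hD := Real.Gamma_mul_Gamma_add_half (1/3)
  have h1 : (0:ℝ) < Real.Gamma (1/3) := Real.Gamma_pos_of_pos (by norm_num)
  have h2 : (0:ℝ) < Real.Gamma (2/3) := Real.Gamma_pos_of_pos (by norm_num)
  rw [moment_zero (by norm_num) (by norm_num), show (-((3/2) + 1) / 3 : ℝ) = -(5/6) by norm_num,
    twelfth_rpow, show (((3/2) + 1) / 3 : ℝ) = 5/6 by norm_num]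
  norm_num at hD ⊢
  set t : ℝ := 2 ^ (1/3 : ℝ) with ht
  set y : ℝ := 3 ^ (1/6 : ℝ) with hy
  have ht0 : 0 < t := by positivity
  have hy0 : 0 < y := by positivity
  have ht3 : t ^ 3 = 2 := by rw [ht, ← Real.rpow_natCast, ← Real.rpow_mul] <;> norm_num
  have hy6 : y ^ 6 = 3 := by rw [hy, ← Real.rpow_natCast, ← Real.rpow_mul] <;> norm_num
  have e1 : (2:ℝ) ^ (5/3 : ℝ) = t ^ 5 := by
    rw [ht, ← Real.rpow_natCast, ← Real.rpow_mul] <;> norm_num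
  have e4 : (3:ℝ) ^ (5/6 : ℝ) = y ^ 5 := by
    rw [hy, ← Real.rpow_natCast, ← Real.rpow_mul] <;> norm_num
  have e2 : √3 = y ^ 3 := by
    rw [hy, ← Real.rpow_natCast, ← Real.rpow_mul, Real.sqrt_eq_rpow] <;> norm_num
  have e3 : (3:ℝ) ^ (-(1/3) : ℝ) = (y ^ 2)⁻¹ := by
    rw [hy, ← Real.rpow_natCast, ← Real.rpow_mul, ← Real.rpow_neg] <;> norm_num
  rw [e2] at hG
  rw [e1, e3, e4]
  set u := √π
  have hG1 : Real.Gamma (2/3) = 2 * π / y ^ 3 / Real.Gamma (1/3) := by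
    rw [← hG]; field_simp
  rw [hG1] at hD
  have hG6 : Real.Gamma (5/6) = 2 * π / y ^ 3 / Real.Gamma (1/3) * t * u / Real.Gamma (1/3) := by
    rw [← hD]; field_simp
  rw [hG6]
  field_simp
  have ht6 : t ^ 6 = 4 := by linear_combination (t ^ 3 + 2) * ht3
  linear_combination u * ((y ^ 6) * ht6 + 4 * hy6)

/-- Uniqueness for the first order form of the equation satisfied by products of Airy functions. -/
theorem airy_product_system_unique {p q r : ℝ → ℂ}
    (hp : ∀ t, HasDerivAt p (q t) t)
    (hq : ∀ t : ℝ, HasDerivAt q (-2 * t * p t + 2 * r t) t)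
    (hr : ∀ t : ℝ, HasDerivAt r (-t * q t) t)
    (hp0 : p 0 = 0) (hq0 : q 0 = 0) (hr0 : r 0 = 0) {ω : ℝ} (hω : 0 ≤ ω) : p ω = 0 := by
  have hd : ∀ t : ℝ, HasDerivAt (fun t => (p t, q t, r t))
      (q t, -2 * t * p t + 2 * r t, -t * q t) t := fun t =>
    (hp t).prodMk ((hq t).prodMk (hr t))
  have := norm_le_gronwallBound_of_norm_deriv_right_le (f := fun t => (p t, q t, r t))
    (f' := fun t : ℝ => (q t, -2 * t * p t + 2 * r t, -t * q t)) (δ := 0) (K := 2 * ω + 2) (ε := 0)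
    (a := 0) (b := ω) (fun t _ => (hd t).continuousAt.continuousWithinAt)
    (fun t _ => (hd t).hasDerivWithinAt) (by simp [hp0, hq0, hr0]) ?_ ω ⟨hω, le_rfl⟩
  · rw [gronwallBound_of_K_ne_0 (by linarith)] at this
    simp only [zero_mul, zero_div, add_zero] at this
    exact (Prod.ext_iff.1 (norm_le_zero_iff.1 this)).1
  · intro t ht
    have h0 := norm_nonneg (p t, q t, r t)
    have h1 : ‖p t‖ ≤ ‖(p t, q t, r t)‖ := norm_fst_le (p t, q t, r t)
    have h23 : ‖(q t, r t)‖ ≤ ‖(p t, q t, r t)‖ := norm_snd_le (p t, q t, r t)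
    have h2 : ‖q t‖ ≤ ‖(p t, q t, r t)‖ := (norm_fst_le (q t, r t)).trans h23
    have h3 : ‖r t‖ ≤ ‖(p t, q t, r t)‖ := (norm_snd_le (q t, r t)).trans h23
    set m := ‖(p t, q t, r t)‖
    have ht1 : |t| ≤ ω := by rw [abs_of_nonneg ht.1]; exact ht.2.le
    rw [add_zero]
    refine norm_prod_le_iff.2 ⟨?_, norm_prod_le_iff.2 ⟨?_, ?_⟩⟩
    · simp only; nlinarith
    · simp only
      refine (norm_add_le _ _).trans ?_
      rw [norm_mul, norm_mul, norm_mul, Complex.norm_real, Real.norm_eq_abs]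
      simp only [norm_neg, RCLike.norm_ofNat]
      have : |t| * ‖p t‖ ≤ ω * m := mul_le_mul ht1 h1 (norm_nonneg _) hω
      nlinarith
    · simp only
      rw [norm_mul, norm_neg, Complex.norm_real, Real.norm_eq_abs]
      have : |t| * ‖q t‖ ≤ ω * m := mul_le_mul ht1 h2 (norm_nonneg _) hω
      nlinarith

/-- The defining properties of the Airy function. -/
structure IsAiry (Ai : ℂ → ℂ) : Prop where
  diff : Differentiable ℂ Ai
  diff' : Differentiable ℂ (deriv Ai)
  ode : ∀ z : ℂ, deriv (deriv Ai) z = z * Ai z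
  zero : Ai 0 = (3 : ℂ) ^ (-(2 : ℂ)/3) / Complex.Gamma (2/3)
  zero' : deriv Ai 0 = -((3 : ℂ) ^ (-(1 : ℂ)/3)) / Complex.Gamma (1/3)

namespace IsAiry

variable {Ai : ℂ → ℂ}

theorem zero_eq (H : IsAiry Ai) :
    Ai 0 = ((3 ^ (-(2/3) : ℝ) / Real.Gamma (2/3) : ℝ) : ℂ) := by
  rw [H.zero, Complex.ofReal_div, Complex.ofReal_cpow (by norm_num), ← Complex.Gamma_ofReal]
  norm_num

theorem deriv_zero_eq (H : IsAiry Ai) :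
    deriv Ai 0 = ((-(3 ^ (-(1/3) : ℝ) / Real.Gamma (1/3)) : ℝ) : ℂ) := by
  rw [H.zero', Complex.ofReal_neg, Complex.ofReal_div, Complex.ofReal_cpow (by norm_num),
    ← Complex.Gamma_ofReal]
  norm_num
  ring

/-- Derivatives of `ω ↦ ζ Ai(ζω)` for `ζ³ = -1`. -/
theorem hasDerivAt_rot (H : IsAiry Ai) (ζ : ℂ) (t : ℝ) :
    HasDerivAt (fun t : ℝ => ζ * Ai (ζ * t)) (ζ ^ 2 * deriv Ai (ζ * t)) t := by
  have h1 : HasDerivAt (fun t : ℝ => ζ * (t : ℂ)) ζ t := by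
    simpa using (Complex.ofRealCLM.hasDerivAt (x := t)).const_mul ζ
  refine (((H.diff (ζ * t)).hasDerivAt.comp t h1).const_mul ζ).congr_deriv ?_
  ring

theorem hasDerivAt_rot' (H : IsAiry Ai) {ζ : ℂ} (hζ : ζ ^ 3 = -1) (t : ℝ) :
    HasDerivAt (fun t : ℝ => ζ ^ 2 * deriv Ai (ζ * t)) (-t * (ζ * Ai (ζ * t))) t := by
  have h1 : HasDerivAt (fun t : ℝ => ζ * (t : ℂ)) ζ t := by
    simpa using (Complex.ofRealCLM.hasDerivAt (x := t)).const_mul ζ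
  refine (((H.diff' (ζ * t)).hasDerivAt.comp t h1).const_mul (ζ ^ 2)).congr_deriv ?_
  rw [H.ode]
  linear_combination (ζ * t * Ai (ζ * t)) * hζ

end IsAiry

theorem exp_pi_div_three : Complex.exp ((Real.pi / 3 : ℂ) * Complex.I) = 1/2 + √3/2 * I := by
  rw [show ((Real.pi / 3 : ℂ)) = ((Real.pi / 3 : ℝ) : ℂ) by push_cast; rfl, Complex.exp_mul_I,
    ← Complex.ofReal_cos, ← Complex.ofReal_sin, Real.cos_pi_div_three, Real.sin_pi_div_three]
  push_cast; ring

theorem exp_neg_pi_div_three :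
    Complex.exp (-(Real.pi / 3 : ℂ) * Complex.I) = 1/2 - √3/2 * I := by
  rw [show (-(Real.pi / 3 : ℂ)) = ((-(Real.pi / 3) : ℝ) : ℂ) by push_cast; rfl, Complex.exp_mul_I,
    ← Complex.ofReal_cos, ← Complex.ofReal_sin, Real.cos_neg, Real.sin_neg,
    Real.cos_pi_div_three, Real.sin_pi_div_three]
  push_cast; ring

theorem sqrt_three_sq : (√3 : ℂ) ^ 2 = 3 := by
  rw [← Complex.ofReal_pow, Real.sq_sqrt (by norm_num)]; norm_num

namespace IsAiry

variable {Ai : ℂ → ℂ}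

/-- The product `A₊A₋` is a Laplace-type integral. -/
theorem Aplus_mul_Aminus (H : IsAiry Ai) {ω : ℝ} (hω : 0 ≤ ω) :
    Aplus Ai ω * Aminus Ai ω = ((moment (-(1/2)) ω (1/12) / (4 * (π * √π)) : ℝ) : ℂ) := by
  set K : ℝ := 4 * (π * √π) with hK
  have hK0 : K ≠ 0 := by positivity
  have hKC : (K : ℂ) ≠ 0 := by exact_mod_cast hK0
  set z₁ := Complex.exp (-(Real.pi / 3 : ℂ) * Complex.I) with hz₁
  set z₂ := Complex.exp ((Real.pi / 3 : ℂ) * Complex.I) with hz₂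
  have e1 : z₁ = 1/2 - √3/2 * I := exp_neg_pi_div_three
  have e2 : z₂ = 1/2 + √3/2 * I := exp_pi_div_three
  have h3 := sqrt_three_sq
  have hI := Complex.I_sq
  have c1 : z₁ ^ 3 = -1 := by
    rw [e1]; linear_combination (3/8 * √3 ^ 2 - √3 ^ 3 / 8 * I) * hI + (-3/8 + √3 / 8 * I) * h3
  have c2 : z₂ ^ 3 = -1 := by
    rw [e2]; linear_combination (3/8 * √3 ^ 2 + √3 ^ 3 / 8 * I) * hI + (-3/8 - √3 / 8 * I) * h3
  have hs : z₁ + z₂ = 1 := by rw [e1, e2]; ring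
  have hm : z₁ * z₂ = 1 := by rw [hz₁, hz₂, ← Complex.exp_add]; simp
  have du := H.hasDerivAt_rot z₁
  have dv := H.hasDerivAt_rot z₂
  have du' := H.hasDerivAt_rot' c1
  have dv' := H.hasDerivAt_rot' c2
  have i1 := moment_neg_half_zero
  have i2 := moment_half_zero
  have i3 := moment_three_half_zero
  rw [← hK] at i1 i2 i3
  have m1 := fun t => (hasDerivAt_moment_left (q := -(1/2)) (c := 1/12) (by norm_num)
    (by norm_num) t).ofReal_comp
  have m2 := fun t => (hasDerivAt_moment_left (q := 1/2) (c := 1/12) (by norm_num)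
    (by norm_num) t).ofReal_comp
  have m3 := fun t => (hasDerivAt_moment_left (q := 3/2) (c := 1/12) (by norm_num)
    (by norm_num) t).ofReal_comp
  rw [show (-(1/2) + 1 : ℝ) = 1/2 by norm_num] at m1
  rw [show (1/2 + 1 : ℝ) = 3/2 by norm_num] at m2
  rw [show (3/2 + 1 : ℝ) = 5/2 by norm_num] at m3
  have hrel : ∀ t : ℝ, 2 * (moment (-(1/2)) t (1/12) : ℂ) - 4 * t * moment (1/2) t (1/12) -
      moment (5/2) t (1/12) = 0 := fun t => by exact_mod_cast moment_relation t
  have key := airy_product_system_unique (ω := ω)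
    (p := fun t : ℝ => K * (z₁ * Ai (z₁ * t) * (z₂ * Ai (z₂ * t))) - moment (-(1/2)) t (1/12))
    (q := fun t : ℝ => K * (z₁ ^ 2 * deriv Ai (z₁ * t) * (z₂ * Ai (z₂ * t)) +
      z₁ * Ai (z₁ * t) * (z₂ ^ 2 * deriv Ai (z₂ * t))) + moment (1/2) t (1/12))
    (r := fun t : ℝ => K * (z₁ ^ 2 * deriv Ai (z₁ * t) * (z₂ ^ 2 * deriv Ai (z₂ * t))) -
      (moment (3/2) t (1/12) / 2 + t * moment (-(1/2)) t (1/12)))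
    (fun t => ((((du t).mul (dv t)).const_mul (K:ℂ)).sub (m1 t)).congr_deriv
      (by push_cast; ring))
    (fun t => ((((((du' t).mul (dv t)).add ((du t).mul (dv' t))).const_mul (K:ℂ)).add
      (m2 t)).congr_deriv ?_))
    (fun t => ?_) ?_ ?_ ?_ hω
  · have : (K : ℂ) * (Aplus Ai ω * Aminus Ai ω) = moment (-(1/2)) ω (1/12) :=
      sub_eq_zero.1 key
    rw [Complex.ofReal_div, eq_div_iff hKC, ← this]; ring
  · push_cast; ring
  · have hid : HasDerivAt (fun t : ℝ => (t : ℂ)) 1 t := Complex.ofRealCLM.hasDerivAt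
    refine ((((du' t).mul (dv' t)).const_mul (K:ℂ)).sub
      (((m3 t).div_const 2).add (hid.mul (m1 t)))).congr_deriv ?_
    push_cast
    linear_combination (-1/2 : ℂ) * hrel t
  · simp only [Complex.ofReal_zero, mul_zero]
    rw [H.zero_eq, i1]
    push_cast
    linear_combination (K : ℂ) * ((3 ^ (-(2/3) : ℝ) : ℝ) / Real.Gamma (2/3)) ^ 2 * hm
  · simp only [Complex.ofReal_zero, mul_zero]
    rw [H.zero_eq, H.deriv_zero_eq, i2]
    push_cast
    linear_combination (-(K : ℂ) * ((3 ^ (-(2/3) : ℝ) : ℝ) / Real.Gamma (2/3)) *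
      ((3 ^ (-(1/3) : ℝ) : ℝ) / Real.Gamma (1/3))) * ((z₁ + z₂) * hm + hs)
  · simp only [Complex.ofReal_zero, mul_zero, zero_mul, add_zero]
    rw [H.deriv_zero_eq, ← Complex.ofReal_ofNat, ← Complex.ofReal_div, i3]
    push_cast
    linear_combination (K : ℂ) * ((3 ^ (-(1/3) : ℝ) : ℝ) / Real.Gamma (1/3)) ^ 2 *
      ((z₁ * z₂ + 1) * hm)

/-- The Wronskian of `A₊` and `A₋`. -/
theorem wronskian (H : IsAiry Ai) {z₁ z₂ : ℂ} (hz₁ : z₁ = 1/2 - √3/2 * I)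
    (hz₂ : z₂ = 1/2 + √3/2 * I) (c1 : z₁ ^ 3 = -1) (c2 : z₂ ^ 3 = -1) (hm : z₁ * z₂ = 1) (t : ℝ) :
    z₂ ^ 2 * deriv Ai (z₂ * t) * (z₁ * Ai (z₁ * t)) -
      z₂ * Ai (z₂ * t) * (z₁ ^ 2 * deriv Ai (z₁ * t)) = -I / (2 * π) := by
  have du := H.hasDerivAt_rot z₁
  have dv := H.hasDerivAt_rot z₂
  have du' := H.hasDerivAt_rot' c1
  have dv' := H.hasDerivAt_rot' c2
  set W := fun t : ℝ => z₂ ^ 2 * deriv Ai (z₂ * t) * (z₁ * Ai (z₁ * t)) -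
      z₂ * Ai (z₂ * t) * (z₁ ^ 2 * deriv Ai (z₁ * t)) with hW
  have hd : ∀ t, HasDerivAt W 0 t := fun t =>
    (((dv' t).mul (du t)).sub ((dv t).mul (du' t))).congr_deriv (by ring)
  have hc : W t = W 0 := is_const_of_deriv_eq_zero (fun t => (hd t).differentiableAt)
    (fun t => (hd t).deriv) t 0
  change W t = _
  rw [hc, hW]
  simp only [Complex.ofReal_zero, mul_zero]
  rw [H.zero_eq, H.deriv_zero_eq]
  have e : (3:ℝ) ^ (-(2/3) : ℝ) * (3:ℝ) ^ (-(1/3) : ℝ) = 1/3 := by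
    rw [← Real.rpow_add (by norm_num)]; norm_num
  have h1 : (0:ℝ) < Real.Gamma (1/3) := Real.Gamma_pos_of_pos (by norm_num)
  have h2 : (0:ℝ) < Real.Gamma (2/3) := Real.Gamma_pos_of_pos (by norm_num)
  have e2 : (3 ^ (-(2/3) : ℝ) / Real.Gamma (2/3)) * (-(3 ^ (-(1/3) : ℝ) / Real.Gamma (1/3))) =
      -(√3 / (6 * π)) := by
    rw [mul_neg, div_mul_div_comm, e, mul_comm (Real.Gamma _), Gamma_third_mul]
    field_simp
    norm_num
  have e2C : (((3 ^ (-(2/3) : ℝ) / Real.Gamma (2/3) : ℝ)) : ℂ) *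
      ((-(3 ^ (-(1/3) : ℝ) / Real.Gamma (1/3)) : ℝ) : ℂ) = -(√3 / (6 * π)) := by
    rw [← Complex.ofReal_mul, e2]; push_cast; ring
  have hd : z₂ - z₁ = √3 * I := by rw [hz₁, hz₂]; ring
  have hπ : (π : ℂ) ≠ 0 := by exact_mod_cast Real.pi_ne_zero
  have h3 := sqrt_three_sq
  set x : ℂ := (((3 ^ (-(2/3) : ℝ) / Real.Gamma (2/3) : ℝ)) : ℂ)
  set y : ℂ := ((-(3 ^ (-(1/3) : ℝ) / Real.Gamma (1/3)) : ℝ) : ℂ)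
  have : z₂ ^ 2 * y * (z₁ * x) - z₂ * x * (z₁ ^ 2 * y) = (z₁ * z₂) * (z₂ - z₁) * (x * y) := by ring
  rw [this, hm, hd, e2C]
  field_simp
  linear_combination (-2 : ℂ) * h3

/-- The derivative of the phase function `L`. -/
theorem hasDerivAt_phase (H : IsAiry Ai) {L : ℝ → ℝ} (hLc : Continuous L)
    (hAp : ∀ w : ℝ, Aplus Ai w ≠ 0)
    (hL : ∀ w : ℝ, Complex.exp (-(L w : ℂ) * Complex.I) = -(Aminus Ai w) / (Aplus Ai w))
    {ω : ℝ} (hω : 0 ≤ ω) : HasDerivAt L (2 * √π / moment (-(1/2)) ω (1/12)) ω := by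
  have hp := H.Aplus_mul_Aminus hω
  set z₁ := Complex.exp (-(Real.pi / 3 : ℂ) * Complex.I) with hz₁
  set z₂ := Complex.exp ((Real.pi / 3 : ℂ) * Complex.I) with hz₂
  have e1 : z₁ = 1/2 - √3/2 * I := exp_neg_pi_div_three
  have e2 : z₂ = 1/2 + √3/2 * I := exp_pi_div_three
  have h3 := sqrt_three_sq
  have hI := Complex.I_sq
  have c1 : z₁ ^ 3 = -1 := by
    rw [e1]; linear_combination (3/8 * √3 ^ 2 - √3 ^ 3 / 8 * I) * hI + (-3/8 + √3 / 8 * I) * h3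
  have c2 : z₂ ^ 3 = -1 := by
    rw [e2]; linear_combination (3/8 * √3 ^ 2 + √3 ^ 3 / 8 * I) * hI + (-3/8 - √3 / 8 * I) * h3
  have hm : z₁ * z₂ = 1 := by rw [hz₁, hz₂, ← Complex.exp_add]; simp
  have hw := H.wronskian e1 e2 c1 c2 hm ω
  have du : HasDerivAt (fun t : ℝ => Aplus Ai t) _ ω := H.hasDerivAt_rot z₁ ω
  have dv : HasDerivAt (fun t : ℝ => Aminus Ai t) _ ω := H.hasDerivAt_rot z₂ ω
  have hf := (dv.neg.div du (hAp ω))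
  set E : ℝ → ℂ := fun w => Complex.exp (-(L w : ℂ) * Complex.I) with hE
  have hEf : E = fun w : ℝ => -(Aminus Ai w) / (Aplus Ai w) := funext hL
  have hv : Aminus Ai ω ≠ 0 := by
    intro h0
    have := hL ω
    rw [h0, neg_zero, zero_div] at this
    exact Complex.exp_ne_zero _ this
  have hPpos : 0 < moment (-(1/2)) ω (1/12) := moment_pos (by norm_num) (by norm_num) ω
  have hdE : HasDerivAt E (E ω * (-(2 * √π / moment (-(1/2)) ω (1/12) : ℝ) * I)) ω := by
    rw [hEf]
    refine hf.congr_deriv ?_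
    have hu := hAp ω
    have hπ : (π : ℂ) ≠ 0 := by exact_mod_cast Real.pi_ne_zero
    have hPC : ((moment (-(1/2)) ω (1/12) : ℝ) : ℂ) ≠ 0 := by exact_mod_cast hPpos.ne'
    have hs : ((√π : ℝ) : ℂ) ≠ 0 := by exact_mod_cast (Real.sqrt_pos.2 Real.pi_pos).ne'
    change (-(z₂ ^ 2 * deriv Ai (z₂ * ω)) * Aplus Ai ω - -(Aminus Ai ω) *
      (z₁ ^ 2 * deriv Ai (z₁ * ω))) / (Aplus Ai ω) ^ 2 = _
    have hw' : z₂ ^ 2 * deriv Ai (z₂ * ω) * Aplus Ai ω - Aminus Ai ω *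
      (z₁ ^ 2 * deriv Ai (z₁ * ω)) = -I / (2 * π) := hw
    have hnum : (-(z₂ ^ 2 * deriv Ai (z₂ * ω)) * Aplus Ai ω - -(Aminus Ai ω) *
      (z₁ ^ 2 * deriv Ai (z₁ * ω))) = I / (2 * π) := by
      linear_combination (-1 : ℂ) * hw'
    rw [hnum]
    rw [Complex.ofReal_div] at hp
    rw [eq_div_iff (by push_cast; simp [hπ, hs])] at hp
    push_cast at hp ⊢
    field_simp
    linear_combination (-1 : ℂ) * hp
  have hlog : (fun w => (L w : ℂ)) =ᶠ[nhds ω]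
      fun w => (L ω : ℂ) + I * Complex.log (E w / E ω) := by
    have : ∀ᶠ w in nhds ω, |L w - L ω| < 1 := by
      have := (Metric.tendsto_nhds.1 (hLc.tendsto ω)) 1 one_pos
      simpa [Real.dist_eq] using this
    filter_upwards [this] with w hw1
    have hb := abs_lt.1 hw1
    have hpi := Real.pi_gt_three
    have : E w / E ω = Complex.exp (-((L w - L ω : ℝ) : ℂ) * I) := by
      rw [hE]; simp only
      rw [← Complex.exp_sub]; congr 1; push_cast; ring
    rw [this, Complex.log_exp]
    · push_cast
      linear_combination ((L w : ℂ) - L ω) * hI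
    · simp; linarith
    · simp; linarith
  have hEne : E ω ≠ 0 := Complex.exp_ne_zero _
  have hdL : HasDerivAt (fun w => (L w : ℂ)) ((2 * √π / moment (-(1/2)) ω (1/12) : ℝ) : ℂ) ω := by
    refine HasDerivAt.congr_of_eventuallyEq ?_ hlog
    have h1 := (hdE.div_const (E ω)).clog_real (by rw [div_self hEne]; simp)
    refine ((h1.const_mul I).const_add _).congr_deriv ?_
    rw [div_self hEne, div_one, mul_div_cancel_left₀ _ hEne]
    linear_combination (-((2 * √π / moment (-(1/2)) ω (1/12) : ℝ) : ℂ)) * hI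
  exact (Complex.reCLM.hasFDerivAt (x := (L ω : ℂ))).comp_hasDerivAt ω hdL

end IsAiry
theorem Gamma_sub_le_moment {q c : ℝ} (hq : -1 < q) (hc : 0 < c) :
    Real.Gamma (q + 1) - c * Real.Gamma (q + 4) ≤ moment q 1 c := by
  have h1 := integrableOn_rpow_mul_exp_neg_mul_rpow (p := 1) (s := q) (b := 1) hq one_pos one_pos
  have h3 := integrableOn_rpow_mul_exp_neg_mul_rpow (p := 1) (s := q + 3) (b := 1) (by linarith)
    one_pos one_pos
  have h2 := _root_.integral_rpow_mul_exp_neg_mul_rpow (p := 1) (q := q) (b := 1) one_pos hq one_pos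
  have h4 := _root_.integral_rpow_mul_exp_neg_mul_rpow (p := 1) (q := q + 3) (b := 1) one_pos
    (by linarith) one_pos
  simp only [Real.one_rpow, div_one, one_mul] at h2 h4
  rw [show q + 3 + 1 = q + 4 by ring] at h4
  rw [← h2, ← h4, ← integral_const_mul, ← integral_sub h1 (h3.const_mul c)]
  refine setIntegral_mono_on (h1.sub (h3.const_mul c)) (integrableOn_moment hq hc 1)
    measurableSet_Ioi fun t ht => ?_
  have ht0 : (0:ℝ) < t := ht
  have hr := Real.rpow_nonneg ht0.le q
  have e : t ^ (q + 3) = t ^ q * t ^ 3 := by rw [Real.rpow_add ht0]; norm_cast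
  have h5 := Real.add_one_le_exp (-(c * t ^ 3))
  rw [Real.rpow_one, e, sub_eq_add_neg (-1 * t), Real.exp_add]
  have : 0 ≤ t ^ q * Real.exp (-1 * t) := by positivity
  nlinarith

namespace IsAiry

variable {Ai : ℂ → ℂ}

theorem hasDerivAt_Bfun (H : IsAiry Ai) {L : ℝ → ℝ} (hLc : Continuous L)
    (hAp : ∀ w : ℝ, Aplus Ai w ≠ 0)
    (hL : ∀ w : ℝ, Complex.exp (-(L w : ℂ) * Complex.I) = -(Aminus Ai w) / (Aplus Ai w))
    {u : ℝ} (hu : 0 < u) :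
    HasDerivAt (Bfun L) (4/3 * (1 - √π / moment (-(1/2)) 1 (1/12 * (u ^ 2)⁻¹))) u := by
  have hw : 0 < u ^ ((2:ℝ)/3) := Real.rpow_pos_of_pos hu _
  have h1 := (H.hasDerivAt_phase hLc hAp hL hw.le).comp u
    (Real.hasDerivAt_rpow_const (x := u) (p := 2/3) (Or.inl hu.ne'))
  have h2 : HasDerivAt (fun u => (4/3) * u + Real.pi / 2) (4/3 * 1) u :=
    ((hasDerivAt_id u).const_mul _).add_const _
  refine (h2.sub h1).congr_deriv ?_
  rw [moment_scaling hw]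
  have e1 : (u ^ ((2:ℝ)/3)) ^ 3 = u ^ 2 := by
    rw [← Real.rpow_natCast, ← Real.rpow_mul hu.le]; norm_num
  have e2 : (u ^ ((2:ℝ)/3)) ^ (-(1/2) : ℝ) = u ^ (-(1/3) : ℝ) := by
    rw [← Real.rpow_mul hu.le]; norm_num
  rw [e1, e2, show ((2:ℝ)/3 - 1) = -(1/3) by norm_num]
  have h3 : 0 < u ^ (-(1/3) : ℝ) := Real.rpow_pos_of_pos hu _
  have h4 : 0 < moment (-(1/2)) 1 (1/12 * (u ^ 2)⁻¹) :=
    moment_pos (by norm_num) (by positivity) _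
  field_simp
  ring

/-- Uniform bounds for the rescaled remainder phase `ρ ↦ λ B(λρ)`. -/
theorem exists_remainder_bounds (H : IsAiry Ai) {L : ℝ → ℝ} (hLc : Continuous L)
    (hAp : ∀ w : ℝ, Aplus Ai w ≠ 0)
    (hL : ∀ w : ℝ, Complex.exp (-(L w : ℂ) * Complex.I) = -(Aminus Ai w) / (Aplus Ai w)) :
    ∃ c > 0, ∃ C : ℝ, ∀ l : ℝ, 8 ≤ l → ∃ b₁ b₂ b₃ : ℝ → ℝ,
      (∀ ρ ∈ Set.Icc (1/8 : ℝ) 3, HasDerivAt (fun ρ => l * Bfun L (l * ρ)) (b₁ ρ) ρ ∧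
        HasDerivAt b₁ (b₂ ρ) ρ ∧ HasDerivAt b₂ (b₃ ρ) ρ ∧
        |b₁ ρ| ≤ C ∧ c ≤ b₂ ρ ∧ b₂ ρ ≤ C ∧ |b₃ ρ| ≤ C) ∧
      ContinuousOn b₃ (Set.Icc (1/8 : ℝ) 3) := by
  set μ := moment (-(1/2)) 1 (1/12) with hμ
  set ν := moment (5/2) 1 (1/12) with hν
  set G₁ := Real.Gamma (7/2) with hG₁
  set G₂ := Real.Gamma (13/2) with hG₂
  have hμ0 : 0 < μ := moment_pos (by norm_num) (by norm_num) _
  have hν0 : 0 < ν := moment_pos (by norm_num) (by norm_num) _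
  have hG10 : 0 < G₁ := Real.Gamma_pos_of_pos (by norm_num)
  have hG20 : 0 < G₂ := Real.Gamma_pos_of_pos (by norm_num)
  have hs : 0 < √π := Real.sqrt_pos.2 Real.pi_pos
  refine ⟨2/9 * √π * (1/27) * (ν / √π ^ 2), by positivity,
    4/3 * (64/12 * G₁ / μ) + 2/9 * √π * 512 * (G₁ / μ ^ 2) + 2/9 * √π * (3 * 4096 * (G₁ / μ ^ 2) +
      512 * (G₂ * 512 / μ ^ 2 + 2 * G₁ * (G₁ * 512) / μ ^ 3)), fun l hl => ?_⟩
  have hl0 : 0 < l := by linarith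
  set c : ℝ → ℝ := fun ρ => 1/12 * ((l * ρ) ^ 2)⁻¹ with hc
  set d : ℝ → ℝ := fun ρ => 1/6 * (l ^ 2 * ρ ^ 3)⁻¹ with hd
  set m₀ : ℝ → ℝ := fun ρ => moment (-(1/2)) 1 (c ρ) with hm₀
  set m₁ : ℝ → ℝ := fun ρ => moment (5/2) 1 (c ρ) with hm₁
  set m₂ : ℝ → ℝ := fun ρ => moment (11/2) 1 (c ρ) with hm₂
  have hcp : ∀ ρ : ℝ, 0 < ρ → 0 < c ρ := fun ρ h => by simp only [hc]; positivity
  have dc : ∀ ρ : ℝ, 0 < ρ → HasDerivAt c (-d ρ) ρ := fun ρ h => by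
    have h1 : HasDerivAt (fun ρ => (l * ρ) ^ 2) (2 * (l * ρ) * l) ρ := by
      exact (((hasDerivAt_id ρ).const_mul l).pow 2).congr_deriv (by simp)
    refine ((h1.inv (by positivity)).const_mul (1/12)).congr_deriv ?_
    simp only [hd]
    field_simp
    norm_num
  have dm₀ : ∀ ρ : ℝ, 0 < ρ → HasDerivAt m₀ (m₁ ρ * d ρ) ρ := fun ρ h => by
    refine ((hasDerivAt_moment_right (q := -(1/2)) (by norm_num) (hcp ρ h) 1).comp ρ
      (dc ρ h)).congr_deriv ?_
    simp only [hm₁]; norm_num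
  have dm₁ : ∀ ρ : ℝ, 0 < ρ → HasDerivAt m₁ (m₂ ρ * d ρ) ρ := fun ρ h => by
    refine ((hasDerivAt_moment_right (q := 5/2) (by norm_num) (hcp ρ h) 1).comp ρ
      (dc ρ h)).congr_deriv ?_
    simp only [hm₂]; norm_num
  have cm₂ : ∀ ρ : ℝ, 0 < ρ → ContinuousAt m₂ ρ := fun ρ h =>
    ((hasDerivAt_moment_right (q := 11/2) (by norm_num) (hcp ρ h) 1).comp ρ
      (dc ρ h)).continuousAt
  have m₀p : ∀ ρ : ℝ, 0 < ρ → 0 < m₀ ρ := fun ρ h => moment_pos (by norm_num) (hcp ρ h) _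
  have m₁p : ∀ ρ : ℝ, 0 < ρ → 0 < m₁ ρ := fun ρ h => moment_pos (by norm_num) (hcp ρ h) _
  have m₂p : ∀ ρ : ℝ, 0 < ρ → 0 < m₂ ρ := fun ρ h => moment_pos (by norm_num) (hcp ρ h) _
  refine ⟨fun ρ => l ^ 2 * (4/3 * (1 - √π / m₀ ρ)),
    fun ρ => 2/9 * √π * (ρ ^ 3)⁻¹ * (m₁ ρ / m₀ ρ ^ 2),
    fun ρ => 2/9 * √π * (-3 * (ρ ^ 4)⁻¹ * (m₁ ρ / m₀ ρ ^ 2) +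
      (ρ ^ 3)⁻¹ * (m₂ ρ * d ρ / m₀ ρ ^ 2 - 2 * m₁ ρ * (m₁ ρ * d ρ) / m₀ ρ ^ 3)),
    fun ρ hρ => ?_, ?_⟩
  · have hρ0 : 0 < ρ := by linarith [hρ.1]
    have p0 := m₀p ρ hρ0
    have p1 := m₁p ρ hρ0
    have p2 := m₂p ρ hρ0
    have hcl : c ρ ≤ 1/12 := by
      have : 1 ≤ (l * ρ) ^ 2 := by
        have : 1 ≤ l * ρ := by nlinarith [hρ.1]
        exact one_le_pow₀ this
      simp only [hc]
      have := inv_le_one_of_one_le₀ this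
      linarith
    have hρ3 : (ρ ^ 3)⁻¹ ≤ 512 := by
      rw [inv_le_comm₀ (by positivity) (by norm_num)]
      calc (512:ℝ)⁻¹ = (1/8) ^ 3 := by norm_num
        _ ≤ ρ ^ 3 := by gcongr; exact hρ.1
    have hρ4 : (ρ ^ 4)⁻¹ ≤ 4096 := by
      rw [inv_le_comm₀ (by positivity) (by norm_num)]
      calc (4096:ℝ)⁻¹ = (1/8) ^ 4 := by norm_num
        _ ≤ ρ ^ 4 := by gcongr; exact hρ.1
    have hρ3' : 1/27 ≤ (ρ ^ 3)⁻¹ := by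
      rw [one_div, inv_le_inv₀ (by norm_num) (by positivity)]
      calc ρ ^ 3 ≤ 3 ^ 3 := by gcongr; exact hρ.2
        _ = 27 := by norm_num
    have hd0 : 0 ≤ d ρ := by simp only [hd]; positivity
    have hd1 : d ρ ≤ 512 := by
      simp only [hd]
      rw [mul_inv]
      have : (l ^ 2)⁻¹ ≤ 1 := inv_le_one_of_one_le₀ (by nlinarith)
      have h3 : 0 ≤ (ρ ^ 3)⁻¹ := by positivity
      nlinarith
    have b0 : μ ≤ m₀ ρ := moment_antitone (by norm_num) (hcp ρ hρ0) hcl 1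
    have b0' : m₀ ρ ≤ √π := by
      have := moment_le_Gamma (q := -(1/2)) (by norm_num) (hcp ρ hρ0)
      rwa [show (-(1/2) + 1 : ℝ) = 1/2 by norm_num, Real.Gamma_one_half_eq] at this
    have b1 : ν ≤ m₁ ρ := moment_antitone (by norm_num) (hcp ρ hρ0) hcl 1
    have b1' : m₁ ρ ≤ G₁ := by
      have := moment_le_Gamma (q := 5/2) (by norm_num) (hcp ρ hρ0)
      rwa [show (5/2 + 1 : ℝ) = 7/2 by norm_num] at this
    have b2' : m₂ ρ ≤ G₂ := by
      have := moment_le_Gamma (q := 11/2) (by norm_num) (hcp ρ hρ0)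
      rwa [show (11/2 + 1 : ℝ) = 13/2 by norm_num] at this
    have b3 : √π - c ρ * G₁ ≤ m₀ ρ := by
      have := Gamma_sub_le_moment (q := -(1/2)) (by norm_num) (hcp ρ hρ0)
      rwa [show (-(1/2) + 1 : ℝ) = 1/2 by norm_num, Real.Gamma_one_half_eq,
        show (-(1/2) + 4 : ℝ) = 7/2 by norm_num] at this
    have q1 : 0 ≤ 4/3 * (64/12 * G₁ / μ) := by positivity
    have q2 : 0 ≤ 2/9 * √π * 512 * (G₁ / μ ^ 2) := by positivity
    have q3 : 0 ≤ 2/9 * √π * (3 * 4096 * (G₁ / μ ^ 2) +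
      512 * (G₂ * 512 / μ ^ 2 + 2 * G₁ * (G₁ * 512) / μ ^ 3)) := by positivity
    refine ⟨?_, ?_, ?_, ?_, ?_, ?_, ?_⟩
    · have h1 : HasDerivAt (fun ρ => l * ρ) l ρ := by simpa using (hasDerivAt_id ρ).const_mul l
      refine (((H.hasDerivAt_Bfun hLc hAp hL (mul_pos hl0 hρ0)).comp ρ h1).const_mul
        l).congr_deriv ?_
      simp only [hm₀, hc]; ring
    · refine (((((dm₀ ρ hρ0).inv p0.ne').const_mul (√π)).const_sub 1).const_mul
        (l ^ 2 * (4/3))).congr_deriv ?_ |>.congr_of_eventuallyEq (Eventually.of_forall fun x => ?_)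
      · simp only [hd]
        field_simp
        ring
      · simp only [Pi.inv_apply]; ring
    · have h1 : HasDerivAt (fun ρ : ℝ => (ρ ^ 3)⁻¹) (-3 * (ρ ^ 4)⁻¹) ρ := by
        refine ((hasDerivAt_pow 3 ρ).inv (by positivity)).congr_deriv ?_
        field_simp; norm_num; ring
      refine ((h1.const_mul (2/9 * √π)).mul
        ((dm₁ ρ hρ0).div ((dm₀ ρ hρ0).pow 2) (pow_ne_zero 2 p0.ne'))).congr_deriv ?_
      simp only [Pi.div_apply, Pi.pow_apply]
      field_simp
      ring
    · have : |l ^ 2 * (4/3 * (1 - √π / m₀ ρ))| ≤ 4/3 * (64/12 * G₁ / μ) := by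
        have e : l ^ 2 * (4/3 * (1 - √π / m₀ ρ)) = -(4/3 * (l ^ 2 * (√π - m₀ ρ) / m₀ ρ)) := by
          field_simp; ring
        have h0 : 0 ≤ √π - m₀ ρ := by linarith
        rw [e, abs_neg, abs_of_nonneg (by positivity)]
        have h5 : l ^ 2 * c ρ ≤ 64/12 := by
          have : l ^ 2 * c ρ = 1/12 * (ρ ^ 2)⁻¹ := by simp only [hc]; field_simp
          rw [this]
          have : (ρ ^ 2)⁻¹ ≤ 64 := by
            rw [inv_le_comm₀ (by positivity) (by norm_num)]
            calc (64:ℝ)⁻¹ = (1/8) ^ 2 := by norm_num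
              _ ≤ ρ ^ 2 := by gcongr; exact hρ.1
          linarith
        have h6 : l ^ 2 * (√π - m₀ ρ) ≤ 64/12 * G₁ := by
          calc l ^ 2 * (√π - m₀ ρ) ≤ l ^ 2 * (c ρ * G₁) := by gcongr; linarith
            _ = (l ^ 2 * c ρ) * G₁ := by ring
            _ ≤ _ := by gcongr
        gcongr
      linarith
    · show _ ≤ 2/9 * √π * (ρ ^ 3)⁻¹ * (m₁ ρ / m₀ ρ ^ 2)
      gcongr
    · show 2/9 * √π * (ρ ^ 3)⁻¹ * (m₁ ρ / m₀ ρ ^ 2) ≤ _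
      have : 2/9 * √π * (ρ ^ 3)⁻¹ * (m₁ ρ / m₀ ρ ^ 2) ≤ 2/9 * √π * 512 * (G₁ / μ ^ 2) := by
        gcongr
      linarith
    · have t1 : |-3 * (ρ ^ 4)⁻¹ * (m₁ ρ / m₀ ρ ^ 2)| ≤ 3 * 4096 * (G₁ / μ ^ 2) := by
        rw [show -3 * (ρ ^ 4)⁻¹ * (m₁ ρ / m₀ ρ ^ 2) = -(3 * (ρ ^ 4)⁻¹ * (m₁ ρ / m₀ ρ ^ 2)) by ring,
          abs_neg, abs_of_nonneg (by positivity)]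
        gcongr
      have t2 : |m₂ ρ * d ρ / m₀ ρ ^ 2 - 2 * m₁ ρ * (m₁ ρ * d ρ) / m₀ ρ ^ 3| ≤
          G₂ * 512 / μ ^ 2 + 2 * G₁ * (G₁ * 512) / μ ^ 3 := by
        refine (abs_sub _ _).trans ?_
        rw [abs_of_nonneg (by positivity), abs_of_nonneg (by positivity)]
        gcongr
      have t3 : |(ρ ^ 3)⁻¹ * (m₂ ρ * d ρ / m₀ ρ ^ 2 - 2 * m₁ ρ * (m₁ ρ * d ρ) / m₀ ρ ^ 3)| ≤
          512 * (G₂ * 512 / μ ^ 2 + 2 * G₁ * (G₁ * 512) / μ ^ 3) := by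
        rw [abs_mul, abs_of_nonneg (by positivity : 0 ≤ (ρ ^ 3)⁻¹)]
        gcongr
      have : |2/9 * √π * (-3 * (ρ ^ 4)⁻¹ * (m₁ ρ / m₀ ρ ^ 2) +
          (ρ ^ 3)⁻¹ * (m₂ ρ * d ρ / m₀ ρ ^ 2 - 2 * m₁ ρ * (m₁ ρ * d ρ) / m₀ ρ ^ 3))| ≤
          2/9 * √π * (3 * 4096 * (G₁ / μ ^ 2) +
            512 * (G₂ * 512 / μ ^ 2 + 2 * G₁ * (G₁ * 512) / μ ^ 3)) := by
        rw [abs_mul, abs_of_nonneg (by positivity : 0 ≤ 2/9 * √π)]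
        gcongr
        exact (abs_add_le _ _).trans (add_le_add t1 t3)
      linarith
  · intro ρ hρ
    have hρ0 : 0 < ρ := by linarith [hρ.1]
    have c0 := (dm₀ ρ hρ0).continuousAt
    have c1 := (dm₁ ρ hρ0).continuousAt
    have c2 := cm₂ ρ hρ0
    have p0 := m₀p ρ hρ0
    have cd : ContinuousAt d ρ := by
      simp only [hd]
      refine ContinuousAt.mul continuousAt_const (ContinuousAt.inv₀ (by fun_prop) (by positivity))
    refine ContinuousAt.continuousWithinAt ?_
    refine continuousAt_const.mul (ContinuousAt.add ?_ ?_)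
    · refine (continuousAt_const.mul (ContinuousAt.inv₀ (by fun_prop) (by positivity))).mul
        (c1.div (c0.pow 2) (by positivity))
    · refine (ContinuousAt.inv₀ (by fun_prop) (by positivity)).mul (ContinuousAt.sub ?_ ?_)
      · exact (c2.mul cd).div (c0.pow 2) (by positivity)
      · exact ((continuousAt_const.mul c1).mul (c1.mul cd)).div (c0.pow 3) (by positivity)

end IsAiry
/-- Differentiation under an integral over a compact interval. -/
theorem hasDerivAt_intervalIntegral {F F' : ℝ → ℝ → ℂ} (hF : Continuous F.uncurry)
    (hF' : Continuous F'.uncurry) (hd : ∀ w x, HasDerivAt (fun w => F w x) (F' w x) w)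
    (a b w : ℝ) :
    HasDerivAt (fun w => ∫ x in a..b, F w x) (∫ x in a..b, F' w x) w := by
  obtain ⟨C, hC⟩ := ((isCompact_Icc (a := w - 1) (b := w + 1)).prod
    (isCompact_uIcc (a := a) (b := b))).exists_bound_of_continuousOn hF'.continuousOn
  refine (intervalIntegral.hasDerivAt_integral_of_dominated_loc_of_deriv_le
    (s := Set.Icc (w - 1) (w + 1)) (bound := fun _ => C) (Icc_mem_nhds (by linarith) (by linarith))
    (Eventually.of_forall fun x => ?_) ?_ ?_ (Eventually.of_forall fun t ht x hx => ?_) (by simp)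
    (Eventually.of_forall fun t _ x _ => hd x t)).2
  · exact (hF.comp (Continuous.prodMk_right x)).aestronglyMeasurable
  · exact (hF.comp (Continuous.prodMk_right w)).intervalIntegrable _ _
  · exact (hF'.comp (Continuous.prodMk_right w)).aestronglyMeasurable
  · exact hC (x, t) ⟨hx, Set.uIoc_subset_uIcc ht⟩

/-- The operator `F ↦ ∫ f(x) F(z + α (x³/3 + p x)) dx`. -/
noncomputable def airyInt (f : ℝ → ℝ) (p α : ℝ) (F : ℝ → ℂ) (z : ℝ) : ℂ :=
  ∫ x in (-(3/2))..(3/2), (f x : ℂ) * F (z + α * (x ^ 3 / 3 + p * x))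

theorem hasDerivAt_airyInt {f : ℝ → ℝ} (hf : Continuous f) (p α : ℝ) {F F' : ℝ → ℂ}
    (hF : ∀ z, HasDerivAt F (F' z) z) (hF' : Continuous F') (z : ℝ) :
    HasDerivAt (airyInt f p α F) (airyInt f p α F' z) z := by
  have hFc : Continuous F := continuous_iff_continuousAt.2 fun z => (hF z).continuousAt
  refine hasDerivAt_intervalIntegral
    (F := fun z x => (f x : ℂ) * F (z + α * (x ^ 3 / 3 + p * x)))
    (F' := fun z x => (f x : ℂ) * F' (z + α * (x ^ 3 / 3 + p * x))) ?_ ?_ ?_ _ _ z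
  · simp only [Function.uncurry_def]; fun_prop
  · simp only [Function.uncurry_def]; fun_prop
  · intro z x
    exact ((hF (z + α * (x ^ 3 / 3 + p * x))).comp_add_const z _).const_mul _

theorem continuous_airyInt {f : ℝ → ℝ} (hf : Continuous f) (p α : ℝ) {F : ℝ → ℂ}
    (hF : Continuous F) : Continuous (airyInt f p α F) := by
  refine intervalIntegral.continuous_parametric_intervalIntegral_of_continuous'
    (f := fun z x => (f x : ℂ) * F (z + α * (x ^ 3 / 3 + p * x))) ?_ _ _
  simp only [Function.uncurry_def]; fun_prop

theorem airyInt_const_mul (f : ℝ → ℝ) (p α : ℝ) (c : ℂ) (F : ℝ → ℂ) (z : ℝ) :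
    airyInt f p α (fun x => c * F x) z = c * airyInt f p α F z := by
  rw [airyInt, airyInt, ← intervalIntegral.integral_const_mul]
  congr 1; ext x; ring

theorem norm_airyInt_le {f : ℝ → ℝ} {p α K M : ℝ} {F : ℝ → ℂ} {z : ℝ} 
    (hf : ∀ x ∈ Set.Icc (-(3/2) : ℝ) (3/2), |f x| ≤ K)
    (hM : ∀ x ∈ Set.Icc (-(3/2) : ℝ) (3/2), ‖F (z + α * (x ^ 3 / 3 + p * x))‖ ≤ M) :
    ‖airyInt f p α F z‖ ≤ 3 * K * M := by
  have hK : 0 ≤ K := (abs_nonneg _).trans (hf 0 (by norm_num))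
  refine (intervalIntegral.norm_integral_le_of_norm_le_const (C := K * M) fun x hx => ?_).trans ?_
  · rw [Set.uIoc_of_le (by norm_num)] at hx
    have hx' : x ∈ Set.Icc (-(3/2) : ℝ) (3/2) := ⟨hx.1.le, hx.2⟩
    rw [norm_mul, norm_real, Real.norm_eq_abs]
    exact mul_le_mul (hf x hx') (hM x hx') (norm_nonneg _) hK
  · rw [abs_of_nonneg (by norm_num)]
    exact le_of_eq (by ring)

/-- Van der Corput estimate for a cubic phase on the positive half-line. -/
theorem norm_integral_cubic_half_le {f f' : ℝ → ℝ} {F F₁ : ℝ → ℂ} {p α K M Λ δ ω z s : ℝ}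
    (hs : s = 1 ∨ s = -1)
    (hf : ∀ x, HasDerivAt f (f' x) x) (hf' : Continuous f')
    (hK : ∀ x ∈ Set.Icc (0 : ℝ) (3/2), |f x| ≤ K)
    (hK' : ∀ x ∈ Set.Icc (0 : ℝ) (3/2), |f' x| ≤ K)
    (hF : ∀ y, HasDerivAt F₁ (F y) y) (hFc : Continuous F) (hα : 1/2 ≤ α) (hΛ : 0 < Λ) (hδ : 0 < δ)
    (hω : 0 ≤ ω)
    (hM : ∀ x ∈ Set.Icc (0 : ℝ) (3/2), ‖F (z + s * (α * (x ^ 3 / 3 + p * x)))‖ ≤ M)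
    (hM₁ : ∀ x ∈ Set.Icc (0 : ℝ) (3/2), ‖F₁ (z + s * (α * (x ^ 3 / 3 + p * x)))‖ ≤ M / Λ)
    (hw : ∀ x y : ℝ, 0 ≤ x → x ≤ y → y ≤ 3/2 → |α * (x ^ 2 + p)| ≤ δ → |α * (y ^ 2 + p)| ≤ δ →
      y - x ≤ ω) :
    ‖∫ x in (0:ℝ)..(3/2), (f x : ℂ) * F (z + s * (α * (x ^ 3 / 3 + p * x)))‖ ≤
      K * M * (11 / (Λ * δ) + ω) := by
  have h0 : (0:ℝ) ∈ Set.Icc (0:ℝ) (3/2) := by norm_num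
  have hK0 : 0 ≤ K := (abs_nonneg _).trans (hK 0 h0)
  have hM0 : 0 ≤ M := (norm_nonneg _).trans (hM 0 h0)
  have hfc : Continuous f := continuous_iff_continuousAt.2 fun z => (hf z).continuousAt
  have hF1c : Continuous F₁ := continuous_iff_continuousAt.2 fun z => (hF z).continuousAt
  have hs2 : (s : ℂ) * s = 1 := by rcases hs with rfl | rfl <;> norm_num
  have hsn : ‖(s : ℂ)‖ = 1 := by rcases hs with rfl | rfl <;> norm_num
  have H : OscData 0 (3/2) (fun x => α * (x ^ 2 + p)) (fun x => α * (2 * x))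
      (fun x => (f x : ℂ) * F (z + s * (α * (x ^ 3 / 3 + p * x))))
      (fun x => (s : ℂ) * (f x * F₁ (z + s * (α * (x ^ 3 / 3 + p * x)))))
      (fun x => (s : ℂ) * (f' x * F₁ (z + s * (α * (x ^ 3 / 3 + p * x))))) := by
    refine ⟨fun x _ => ?_, fun x _ => ?_, by fun_prop, by fun_prop, by fun_prop, fun x hx => ?_⟩
    · refine ((((hasDerivAt_id x).pow 2).add_const p).const_mul α).congr_deriv ?_
      simp
    · have e : HasDerivAt (fun x : ℝ => z + s * (α * (x ^ 3 / 3 + p * x)))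
          (s * (α * (x ^ 2 + p))) x := by
        refine (((((((hasDerivAt_id x).pow 3).div_const 3).add
          ((hasDerivAt_id x).const_mul p)).const_mul α).const_mul s).const_add z).congr_deriv ?_
        simp
      refine (((hf x).ofReal_comp.mul ((hF _).scomp x e)).const_mul (s : ℂ)).congr_deriv ?_
      rw [real_smul]
      simp only [Function.comp_apply]
      push_cast
      linear_combination (α * (x ^ 2 + p) * f x * F (z + s * (α * (x ^ 3 / 3 + p * x)))) * hs2
    · have := hx.1; positivity
  have key := H.norm_integral_le (by norm_num) (δ := δ) (ω := ω) (M := K * M) (M₁ := K * (M / Λ))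
    (D := K * (M / Λ)) hδ hω ?_ ?_ ?_ (fun x hx y hy hxy h1 h2 => hw x y hx.1 hxy hy.2 h1 h2)
  · refine key.trans (le_of_eq ?_)
    field_simp
    ring
  · intro x hx
    rw [norm_mul, norm_real, Real.norm_eq_abs]
    exact mul_le_mul (hK x hx) (hM x hx) (norm_nonneg _) hK0
  · intro x hx
    rw [norm_mul, hsn, one_mul, norm_mul, norm_real, Real.norm_eq_abs]
    exact mul_le_mul (hK x hx) (hM₁ x hx) (norm_nonneg _) hK0
  · intro x hx
    rw [norm_mul, hsn, one_mul, norm_mul, norm_real, Real.norm_eq_abs]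
    exact mul_le_mul (hK' x hx) (hM₁ x hx) (norm_nonneg _) hK0

/-- Van der Corput estimate for `airyInt`. -/
theorem norm_airyInt_le_of_width {f f' : ℝ → ℝ} {F F₁ : ℝ → ℂ} {p α K M Λ δ ω z : ℝ}
    (hf : ∀ x, HasDerivAt f (f' x) x) (hf' : Continuous f')
    (hK : ∀ x ∈ Set.Icc (-(3/2) : ℝ) (3/2), |f x| ≤ K)
    (hK' : ∀ x ∈ Set.Icc (-(3/2) : ℝ) (3/2), |f' x| ≤ K)
    (hF : ∀ y, HasDerivAt F₁ (F y) y) (hFc : Continuous F) (hα : 1/2 ≤ α) (hΛ : 0 < Λ) (hδ : 0 < δ)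
    (hω : 0 ≤ ω)
    (hM : ∀ x ∈ Set.Icc (-(3/2) : ℝ) (3/2), ‖F (z + α * (x ^ 3 / 3 + p * x))‖ ≤ M)
    (hM₁ : ∀ x ∈ Set.Icc (-(3/2) : ℝ) (3/2), ‖F₁ (z + α * (x ^ 3 / 3 + p * x))‖ ≤ M / Λ)
    (hw : ∀ x y : ℝ, 0 ≤ x → x ≤ y → y ≤ 3/2 → |α * (x ^ 2 + p)| ≤ δ → |α * (y ^ 2 + p)| ≤ δ →
      y - x ≤ ω) :
    ‖airyInt f p α F z‖ ≤ K * M * (22 / (Λ * δ) + 2 * ω) := by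
  have hfc : Continuous f := continuous_iff_continuousAt.2 fun z => (hf z).continuousAt
  have pos : ∀ x ∈ Set.Icc (0:ℝ) (3/2), x ∈ Set.Icc (-(3/2) : ℝ) (3/2) := fun x hx =>
    ⟨by linarith [hx.1], hx.2⟩
  have neg : ∀ x ∈ Set.Icc (0:ℝ) (3/2), -x ∈ Set.Icc (-(3/2) : ℝ) (3/2) := fun x hx =>
    ⟨by linarith [hx.2], by linarith [hx.1]⟩
  have hodd : ∀ x : ℝ, z + (-1) * (α * (x ^ 3 / 3 + p * x)) =
      z + α * ((-x) ^ 3 / 3 + p * (-x)) := fun x => by ring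
  have h1 := norm_integral_cubic_half_le (s := 1) (z := z) (Or.inl rfl) hf hf'
    (fun x hx => hK x (pos x hx)) (fun x hx => hK' x (pos x hx)) hF hFc hα hΛ hδ hω
    (fun x hx => by simpa using hM x (pos x hx)) (fun x hx => by simpa using hM₁ x (pos x hx)) hw
  have h2 := norm_integral_cubic_half_le (f := fun x => f (-x)) (f' := fun x => -f' (-x)) (s := -1)
    (z := z) (Or.inr rfl) (fun x => ((hf (-x)).comp x (hasDerivAt_neg x)).congr_deriv (by ring))
    (by fun_prop) (fun x hx => hK _ (neg x hx))
    (fun x hx => by simpa using hK' _ (neg x hx)) hF hFc hα hΛ hδ hω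
    (fun x hx => by rw [hodd]; exact hM _ (neg x hx))
    (fun x hx => by rw [hodd]; exact hM₁ _ (neg x hx)) hw
  have hc : Continuous fun x : ℝ => (f x : ℂ) * F (z + α * (x ^ 3 / 3 + p * x)) := by fun_prop
  have hsplit : airyInt f p α F z =
      (∫ x in (0:ℝ)..(3/2), (f (-x) : ℂ) * F (z + (-1) * (α * (x ^ 3 / 3 + p * x)))) +
      ∫ x in (0:ℝ)..(3/2), (f x : ℂ) * F (z + 1 * (α * (x ^ 3 / 3 + p * x))) := by
    rw [airyInt, ← intervalIntegral.integral_add_adjacent_intervals (b := 0)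
      (hc.intervalIntegrable _ _) (hc.intervalIntegrable _ _)]
    congr 1
    · have := intervalIntegral.integral_comp_neg (a := 0) (b := 3/2)
        (fun x : ℝ => (f x : ℂ) * F (z + α * (x ^ 3 / 3 + p * x)))
      rw [neg_zero] at this
      rw [← this]
      congr 1; ext x; rw [hodd]
    · simp
  rw [hsplit]
  refine (norm_add_le _ _).trans ((add_le_add h2 h1).trans (le_of_eq ?_))
  ring

/-- Airy-type decay `Λ^{-1/3}`. -/
theorem norm_airyInt_le_third {f f' : ℝ → ℝ} {F F₁ : ℝ → ℂ} {p α K M Λ z : ℝ}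
    (hf : ∀ x, HasDerivAt f (f' x) x) (hf' : Continuous f')
    (hK : ∀ x ∈ Set.Icc (-(3/2) : ℝ) (3/2), |f x| ≤ K)
    (hK' : ∀ x ∈ Set.Icc (-(3/2) : ℝ) (3/2), |f' x| ≤ K)
    (hF : ∀ y, HasDerivAt F₁ (F y) y) (hFc : Continuous F) (hα : 1/2 ≤ α) (hΛ : 0 < Λ)
    (hM : ∀ x ∈ Set.Icc (-(3/2) : ℝ) (3/2), ‖F (z + α * (x ^ 3 / 3 + p * x))‖ ≤ M)
    (hM₁ : ∀ x ∈ Set.Icc (-(3/2) : ℝ) (3/2), ‖F₁ (z + α * (x ^ 3 / 3 + p * x))‖ ≤ M / Λ) :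
    ‖airyInt f p α F z‖ ≤ 26 * K * M * Λ ^ (-(1/3) : ℝ) := by
  have hδ : 0 < Λ ^ (-(2/3) : ℝ) := by positivity
  have hsq : (Λ ^ (-(1/3) : ℝ)) ^ 2 = Λ ^ (-(2/3) : ℝ) := by
    rw [← Real.rpow_natCast, ← Real.rpow_mul hΛ.le]; norm_num
  refine (norm_airyInt_le_of_width hf hf' hK hK' hF hFc hα hΛ hδ
    (ω := 2 * Λ ^ (-(1/3) : ℝ)) (by positivity) hM hM₁ ?_).trans (le_of_eq ?_)
  · intro x y hx hxy _ h1 h2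
    refine abs_le_of_sq_le_sq' ?_ (by positivity) |>.2
    rw [mul_pow, hsq]
    have e1 := (abs_le.1 h1).1
    have e2 := (abs_le.1 h2).2
    have e3 : α * (y ^ 2 - x ^ 2) ≤ 2 * Λ ^ (-(2/3) : ℝ) := by linarith
    have e4 : (y - x) ^ 2 ≤ y ^ 2 - x ^ 2 := by nlinarith
    have e5 : (y ^ 2 - x ^ 2) * (1/2) ≤ α * (y ^ 2 - x ^ 2) := by
      have : 0 ≤ y ^ 2 - x ^ 2 := by nlinarith
      nlinarith
    linarith
  · have : (22 / (Λ * Λ ^ (-(2/3) : ℝ))) = 22 * Λ ^ (-(1/3) : ℝ) := by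
      have : Λ * Λ ^ (-(2/3) : ℝ) = Λ ^ (1/3 : ℝ) := by
        rw [← Real.rpow_one_add' hΛ.le (by norm_num)]; norm_num
      rw [this, Real.rpow_neg hΛ.le]
      rfl
    rw [this]; ring

/-- Nondegenerate decay `Λ^{-1/2}`. -/
theorem norm_airyInt_le_half {f f' : ℝ → ℝ} {F F₁ : ℝ → ℂ} {p α K M Λ z : ℝ}
    (hf : ∀ x, HasDerivAt f (f' x) x) (hf' : Continuous f')
    (hK : ∀ x ∈ Set.Icc (-(3/2) : ℝ) (3/2), |f x| ≤ K)
    (hK' : ∀ x ∈ Set.Icc (-(3/2) : ℝ) (3/2), |f' x| ≤ K)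
    (hF : ∀ y, HasDerivAt F₁ (F y) y) (hFc : Continuous F) (hα : 1/2 ≤ α) (hΛ : 0 < Λ)
    (hp : p ≤ -(1/4))
    (hM : ∀ x ∈ Set.Icc (-(3/2) : ℝ) (3/2), ‖F (z + α * (x ^ 3 / 3 + p * x))‖ ≤ M)
    (hM₁ : ∀ x ∈ Set.Icc (-(3/2) : ℝ) (3/2), ‖F₁ (z + α * (x ^ 3 / 3 + p * x))‖ ≤ M / Λ) :
    ‖airyInt f p α F z‖ ≤ 70 * K * M * Λ ^ (-(1/2) : ℝ) := by
  set d := Λ ^ (-(1/2) : ℝ) with hd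
  have hδ : 0 < d := by positivity
  refine (norm_airyInt_le_of_width hf hf' hK hK' hF hFc hα hΛ hδ
    (ω := 24 * d) (by positivity) hM hM₁ ?_).trans (le_of_eq ?_)
  · intro x y hx hxy hy h1 h2
    rcases le_or_gt (1/16) d with hd' | hd'
    · linarith
    have e1 := (abs_le.1 h1).1
    have e2 := (abs_le.1 h2).2
    have e6 : -(2 * d) ≤ x ^ 2 + p := by
      by_contra! hcon
      nlinarith
    have e7 : 1/4 ≤ x := by nlinarith
    have e3 : α * (y ^ 2 - x ^ 2) ≤ 2 * d := by linarith
    have e5 : (y ^ 2 - x ^ 2) * (1/2) ≤ α * (y ^ 2 - x ^ 2) := by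
      have : 0 ≤ y ^ 2 - x ^ 2 := by nlinarith
      nlinarith
    have e8 : (y - x) * (1/2) ≤ y ^ 2 - x ^ 2 := by nlinarith
    linarith
  · have : (22 / (Λ * d)) = 22 * d := by
      have : Λ * d = Λ ^ (1/2 : ℝ) := by
        rw [hd, ← Real.rpow_one_add' hΛ.le (by norm_num)]; norm_num
      rw [this, hd, Real.rpow_neg hΛ.le]
      rfl
    rw [this]; ring

/-- Repeated integration by parts against a phase without stationary points. -/
theorem exists_norm_nonstationary_le (k : ℕ) : ∀ (j : ℕ) {g : ℝ → ℝ}, ContDiff ℝ (⊤ : ℕ∞) g →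
    tsupport g ⊆ Set.Ioo (-(3/2) : ℝ) (3/2) →
    ∃ C, ∀ {p α M z : ℝ} {F : ℕ → ℝ → ℂ}, 1/2 ≤ p → 1/2 ≤ α →
      (∀ i y, HasDerivAt (F (i + 1)) (F i y) y) → Continuous (F 0) → (∀ y, ‖F k y‖ ≤ M) →
      ‖∫ x in (-(3/2) : ℝ)..(3/2), ((g x / (x ^ 2 + p) ^ j : ℝ) : ℂ) *
        F 0 (z + α * (x ^ 3 / 3 + p * x))‖ ≤ C * M := by
  induction k with
  | zero =>
    intro j g hg hgs
    obtain ⟨K, hK⟩ := (isCompact_Icc (a := (-(3/2) : ℝ)) (b := 3/2)).exists_bound_of_continuousOn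
      hg.continuous.continuousOn
    refine ⟨K * 2 ^ j * 3, fun {p α M z F} hp hα hF hF0 hM => ?_⟩
    refine (intervalIntegral.norm_integral_le_of_norm_le_const (C := K * 2 ^ j * M)
      fun x hx => ?_).trans (le_of_eq ?_)
    · rw [Set.uIoc_of_le (by norm_num)] at hx
      have hgx := hK x ⟨hx.1.le, hx.2⟩
      have hK0 : 0 ≤ K := (norm_nonneg _).trans hgx
      rw [norm_mul, norm_real, norm_div, norm_pow]
      have h2 : 1/2 ≤ ‖x ^ 2 + p‖ := by
        rw [Real.norm_eq_abs, abs_of_nonneg (by positivity)]; nlinarith [sq_nonneg x]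
      refine mul_le_mul ?_ (hM _) (norm_nonneg _) (by positivity)
      rw [div_le_iff₀ (by positivity)]
      calc ‖g x‖ ≤ K * 1 := by linarith
        _ ≤ K * (2 * ‖x ^ 2 + p‖) ^ j := by
          gcongr; exact one_le_pow₀ (by linarith)
        _ = _ := by rw [mul_pow]; ring
    · rw [abs_of_nonneg (by norm_num)]; ring
  | succ k ih =>
    intro j g hg hgs
    have hg' : ContDiff ℝ (⊤ : ℕ∞) (deriv g) := by
      have := (contDiff_infty_iff_deriv (𝕜 := ℝ)).1 hg
      exact this.2
    have hgs' : tsupport (deriv g) ⊆ Set.Ioo (-(3/2) : ℝ) (3/2) :=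
      tsupport_deriv_subset.trans hgs
    have hg2 : ContDiff ℝ (⊤ : ℕ∞) (fun x => (2 * ((j : ℝ) + 1) * x) * g x) := by fun_prop
    have hgs2 : tsupport (fun x => (2 * ((j : ℝ) + 1) * x) * g x) ⊆ Set.Ioo (-(3/2) : ℝ) (3/2) :=
      (tsupport_mul_subset_right).trans hgs
    obtain ⟨C₁, h₁⟩ := ih (j + 1) hg' hgs'
    obtain ⟨C₂, h₂⟩ := ih (j + 2) hg2 hgs2
    refine ⟨2 * (C₁ + C₂), fun {p α M z F} hp hα hF hF0 hM => ?_⟩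
    have hF1 : Continuous (F 1) := continuous_iff_continuousAt.2 fun y => (hF 0 y).continuousAt
    have b₁ := h₁ (p := p) (α := α) (M := M) (z := z) (F := fun i => F (i + 1)) hp hα
      (fun i y => hF (i + 1) y) hF1 hM
    have b₂ := h₂ (p := p) (α := α) (M := M) (z := z) (F := fun i => F (i + 1)) hp hα
      (fun i y => hF (i + 1) y) hF1 hM
    have hα0 : (α : ℂ) ≠ 0 := by
      have : α ≠ 0 := by linarith
      exact_mod_cast this
    have hpos : ∀ x : ℝ, x ^ 2 + p ≠ 0 := fun x => by nlinarith [sq_nonneg x]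
    have hgd : ∀ x, HasDerivAt g (deriv g x) x := fun x =>
      (hg.differentiable (by simp) x).hasDerivAt
    have hgc := hg.continuous
    have hgc' := hg'.continuous
    have hend : ∀ x : ℝ, x = -(3/2) ∨ x = 3/2 → g x = 0 := fun x hx => by
      refine image_eq_zero_of_notMem_tsupport fun hmem => ?_
      rcases hx with rfl | rfl
      · exact lt_irrefl _ (hgs hmem).1
      · exact lt_irrefl _ (hgs hmem).2
    set u : ℝ → ℝ := fun x => g x / (x ^ 2 + p) ^ (j + 1) with hu
    set u' : ℝ → ℝ := fun x => deriv g x / (x ^ 2 + p) ^ (j + 1) -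
      (2 * ((j : ℝ) + 1) * x) * g x / (x ^ 2 + p) ^ (j + 2) with hu'
    have hud : ∀ x, HasDerivAt u (u' x) x := fun x => by
      have h1 : HasDerivAt (fun x : ℝ => (x ^ 2 + p) ^ (j + 1))
          ((j + 1) * (x ^ 2 + p) ^ j * (2 * x)) x :=
        ((((hasDerivAt_id x).pow 2).add_const p).pow (j + 1)).congr_deriv (by simp)
      refine ((hgd x).div h1 (pow_ne_zero _ (hpos x))).congr_deriv ?_
      simp only [hu']
      have := hpos x
      field_simp
      ring
    have hcpow : ∀ n : ℕ, Continuous fun x : ℝ => ((x ^ 2 + p) ^ n)⁻¹ := fun n =>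
      Continuous.inv₀ (by fun_prop) fun x => pow_ne_zero _ (hpos x)
    have hc1 : Continuous fun x : ℝ => deriv g x / (x ^ 2 + p) ^ (j + 1) := by
      simp only [div_eq_mul_inv]; exact hgc'.mul (hcpow _)
    have hc2 : Continuous fun x : ℝ => (2 * ((j : ℝ) + 1) * x) * g x / (x ^ 2 + p) ^ (j + 2) := by
      simp only [div_eq_mul_inv]; exact Continuous.mul (by fun_prop) (hcpow _)
    have hu'c : Continuous u' := hc1.sub hc2
    have hv : ∀ x, HasDerivAt (fun x : ℝ => F 1 (z + α * (x ^ 3 / 3 + p * x)))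
        ((α * (x ^ 2 + p) : ℝ) * F 0 (z + α * (x ^ 3 / 3 + p * x))) x := fun x => by
      have e : HasDerivAt (fun x : ℝ => z + α * (x ^ 3 / 3 + p * x)) (α * (x ^ 2 + p)) x := by
        refine ((((((hasDerivAt_id x).pow 3).div_const 3).add
          ((hasDerivAt_id x).const_mul p)).const_mul α).const_add z).congr_deriv ?_
        simp
      refine ((hF 0 _).scomp x e).congr_deriv ?_
      rw [real_smul]
    have parts := intervalIntegral.integral_mul_deriv_eq_deriv_mul (a := -(3/2)) (b := 3/2)
      (fun x _ => (hud x).ofReal_comp) (fun x _ => hv x)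
      (Continuous.intervalIntegrable (by fun_prop) _ _)
      (Continuous.intervalIntegrable (by fun_prop) _ _)
    have ue : u (3/2) = 0 ∧ u (-(3/2)) = 0 := by
      simp only [hu]
      rw [hend _ (Or.inl rfl), hend _ (Or.inr rfl)]; simp
    rw [ue.1, ue.2] at parts
    have key : (α : ℂ) * ∫ x in (-(3/2) : ℝ)..(3/2), ((g x / (x ^ 2 + p) ^ j : ℝ) : ℂ) *
        F 0 (z + α * (x ^ 3 / 3 + p * x)) =
        (∫ x in (-(3/2) : ℝ)..(3/2), (((2 * ((j : ℝ) + 1) * x) * g x / (x ^ 2 + p) ^ (j + 2) : ℝ) : ℂ) *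
          F 1 (z + α * (x ^ 3 / 3 + p * x))) -
        ∫ x in (-(3/2) : ℝ)..(3/2), ((deriv g x / (x ^ 2 + p) ^ (j + 1) : ℝ) : ℂ) *
          F 1 (z + α * (x ^ 3 / 3 + p * x)) := by
      rw [← intervalIntegral.integral_sub (Continuous.intervalIntegrable (by fun_prop) _ _)
        (Continuous.intervalIntegrable (by fun_prop) _ _), ← intervalIntegral.integral_const_mul]
      have : ∫ x in (-(3/2) : ℝ)..(3/2), (α : ℂ) * (((g x / (x ^ 2 + p) ^ j : ℝ) : ℂ) *
          F 0 (z + α * (x ^ 3 / 3 + p * x))) =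
          ∫ x in (-(3/2) : ℝ)..(3/2), (u x : ℂ) * ((α * (x ^ 2 + p) : ℝ) *
            F 0 (z + α * (x ^ 3 / 3 + p * x))) := by
        congr 1; ext x
        have h0 : ((x : ℂ) ^ 2 + p) ≠ 0 := by exact_mod_cast hpos x
        simp only [hu]
        push_cast
        field_simp
        ring
      rw [this, parts]
      simp only [ofReal_zero, zero_mul, sub_zero, zero_sub, ← intervalIntegral.integral_neg]
      congr 1; ext x
      simp only [hu', ofReal_sub]
      ring
    have hn : ‖(α : ℂ)‖ = α := by rw [norm_real, Real.norm_eq_abs, abs_of_nonneg (by linarith)]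
    have t := norm_sub_le (∫ x in (-(3/2) : ℝ)..(3/2),
        (((2 * ((j : ℝ) + 1) * x) * g x / (x ^ 2 + p) ^ (j + 2) : ℝ) : ℂ) *
          F 1 (z + α * (x ^ 3 / 3 + p * x)))
      (∫ x in (-(3/2) : ℝ)..(3/2), ((deriv g x / (x ^ 2 + p) ^ (j + 1) : ℝ) : ℂ) *
          F 1 (z + α * (x ^ 3 / 3 + p * x)))
    rw [← key, norm_mul, hn] at t
    have b₁' := b₁
    have b₂' := b₂
    simp only [zero_add] at b₁' b₂'
    have hnn := norm_nonneg (∫ x in (-(3/2) : ℝ)..(3/2), ((g x / (x ^ 2 + p) ^ j : ℝ) : ℂ) *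
        F 0 (z + α * (x ^ 3 / 3 + p * x)))
    nlinarith

/-- Rapid decay of `airyInt` in the absence of stationary points. -/
theorem exists_norm_airyInt_le_of_nonstationary (k : ℕ) {g : ℝ → ℝ} (hg : ContDiff ℝ (⊤ : ℕ∞) g)
    (hgs : tsupport g ⊆ Set.Ioo (-(3/2) : ℝ) (3/2)) :
    ∃ C, ∀ {p α M z : ℝ} {F : ℕ → ℝ → ℂ}, 1/2 ≤ p → 1/2 ≤ α →
      (∀ i y, HasDerivAt (F (i + 1)) (F i y) y) → Continuous (F 0) → (∀ y, ‖F k y‖ ≤ M) →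
      ‖airyInt g p α (F 0) z‖ ≤ C * M := by
  obtain ⟨C, hC⟩ := exists_norm_nonstationary_le k 0 hg hgs
  refine ⟨C, fun hp hα hF hF0 hM => ?_⟩
  simpa [airyInt] using hC hp hα hF hF0 hM

/-- Two integrations by parts against `e^{iΦ}` with `Φ' = q` bounded below. -/
theorem norm_integral_le_of_large_slope {a b K Q : ℝ} (hab : a ≤ b) (hQ : 0 < Q)
    {u u₁ u₂ Φ q q₁ q₂ : ℝ → ℝ}
    (hu : ∀ x ∈ Set.Icc a b, HasDerivAt u (u₁ x) x)
    (hu₁ : ∀ x ∈ Set.Icc a b, HasDerivAt u₁ (u₂ x) x) (hu₂ : ContinuousOn u₂ (Set.Icc a b))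
    (hΦ : ∀ x ∈ Set.Icc a b, HasDerivAt Φ (q x) x)
    (hq : ∀ x ∈ Set.Icc a b, HasDerivAt q (q₁ x) x)
    (hq₁ : ∀ x ∈ Set.Icc a b, HasDerivAt q₁ (q₂ x) x) (hq₂ : ContinuousOn q₂ (Set.Icc a b))
    (hua : u a = 0) (hub : u b = 0) (hua₁ : u₁ a = 0) (hub₁ : u₁ b = 0)
    (hK : ∀ x ∈ Set.Icc a b, |u x| ≤ K ∧ |u₁ x| ≤ K ∧ |u₂ x| ≤ K)
    (hQq : ∀ x ∈ Set.Icc a b, Q ≤ |q x|) (hQ₁ : ∀ x ∈ Set.Icc a b, |q₁ x| ≤ Q)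
    (hQ₂ : ∀ x ∈ Set.Icc a b, |q₂ x| ≤ Q) :
    ‖∫ x in a..b, (u x : ℂ) * Complex.exp (I * Φ x)‖ ≤ 8 * K / Q ^ 2 * (b - a) := by
  have hIcc : Set.uIcc a b = Set.Icc a b := Set.uIcc_of_le hab
  have hq0 : ∀ x ∈ Set.Icc a b, q x ≠ 0 := fun x hx => by
    have := hQq x hx
    exact abs_pos.1 (hQ.trans_le this)
  have cΦ : ContinuousOn Φ (Set.Icc a b) := fun x hx =>
    (hΦ x hx).continuousAt.continuousWithinAt
  have cu : ContinuousOn u (Set.Icc a b) := fun x hx => (hu x hx).continuousAt.continuousWithinAt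
  have cu₁ : ContinuousOn u₁ (Set.Icc a b) := fun x hx =>
    (hu₁ x hx).continuousAt.continuousWithinAt
  have cq : ContinuousOn q (Set.Icc a b) := fun x hx => (hq x hx).continuousAt.continuousWithinAt
  have cq₁ : ContinuousOn q₁ (Set.Icc a b) := fun x hx =>
    (hq₁ x hx).continuousAt.continuousWithinAt
  set r : ℝ → ℝ := fun x => u₂ x / q x ^ 2 - 3 * (u₁ x * q₁ x) / q x ^ 3 - u x * q₂ x / q x ^ 3 +
    3 * (u x * q₁ x ^ 2) / q x ^ 4 with hr
  have cr : ContinuousOn r (Set.Icc a b) := by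
    simp only [hr]
    refine (((hu₂.div (cq.pow 2) ?_).sub ((continuousOn_const.mul
      (cu₁.mul cq₁)).div (cq.pow 3) ?_)).sub
      ((cu.mul hq₂).div (cq.pow 3) ?_)).add
      ((continuousOn_const.mul (cu.mul (cq₁.pow 2))).div (cq.pow 4) ?_) <;>
    exact fun x hx => pow_ne_zero _ (hq0 x hx)
  have ce : ContinuousOn (fun x => Complex.exp (I * Φ x)) (Set.Icc a b) := by fun_prop
  have hprim : ∀ x ∈ Set.Icc a b, HasDerivAt
      (fun x => (-I * (u x / q x : ℝ) + (u₁ x / q x ^ 2 - u x * q₁ x / q x ^ 3 : ℝ)) *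
        Complex.exp (I * Φ x))
      (u x * Complex.exp (I * Φ x) + r x * Complex.exp (I * Φ x)) x := by
    intro x hx
    have h0 := hq0 x hx
    have d1 : HasDerivAt (fun x => u x / q x) ((u₁ x * q x - u x * q₁ x) / q x ^ 2) x :=
      (hu x hx).div (hq x hx) h0
    have d2 : HasDerivAt (fun x => u₁ x / q x ^ 2 - u x * q₁ x / q x ^ 3) (r x) x := by
      refine (((hu₁ x hx).div ((hq x hx).pow 2) (pow_ne_zero _ h0)).sub
        (((hu x hx).mul (hq₁ x hx)).div ((hq x hx).pow 3) (pow_ne_zero _ h0))).congr_deriv ?_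
      simp only [hr, Pi.pow_apply, Pi.mul_apply]
      field_simp
      ring
    have d3 : HasDerivAt (fun x => Complex.exp (I * Φ x)) (Complex.exp (I * Φ x) * (I * q x)) x :=
      ((hΦ x hx).ofReal_comp.const_mul I).cexp
    refine (((d1.ofReal_comp.const_mul (-I)).add d2.ofReal_comp).mul d3).congr_deriv ?_
    have h0' : (q x : ℂ) ≠ 0 := by exact_mod_cast h0
    simp only [Pi.add_apply]
    push_cast
    field_simp
    ring_nf
    simp only [I_sq]
    ring
  have hint : ContinuousOn (fun x => (u x : ℂ) * Complex.exp (I * Φ x)) (Set.Icc a b) := by fun_prop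
  have hint' : ContinuousOn (fun x => (r x : ℂ) * Complex.exp (I * Φ x)) (Set.Icc a b) := by fun_prop
  have hi1 : IntervalIntegrable (fun x => (u x : ℂ) * Complex.exp (I * Φ x)) volume a b :=
    ContinuousOn.intervalIntegrable (by rwa [hIcc])
  have hi2 : IntervalIntegrable (fun x => (r x : ℂ) * Complex.exp (I * Φ x)) volume a b :=
    ContinuousOn.intervalIntegrable (by rwa [hIcc])
  have ftc := intervalIntegral.integral_eq_sub_of_hasDerivAt (fun x hx => hprim x (hIcc ▸ hx))
    (hi1.add hi2)
  rw [intervalIntegral.integral_add hi1 hi2] at ftc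
  simp only [hua, hub, hua₁, hub₁, zero_div, zero_mul, sub_zero, ofReal_zero, mul_zero,
    add_zero] at ftc
  rw [eq_neg_of_add_eq_zero_left ftc, norm_neg]
  refine (intervalIntegral.norm_integral_le_of_norm_le_const (C := 8 * K / Q ^ 2)
    fun x hx => ?_).trans (le_of_eq (by rw [abs_of_nonneg (sub_nonneg.2 hab)]))
  rw [Set.uIoc_of_le hab] at hx
  have hx' : x ∈ Set.Icc a b := ⟨hx.1.le, hx.2⟩
  obtain ⟨k0, k1, k2⟩ := hK x hx'
  have hK0 : 0 ≤ K := (abs_nonneg _).trans k0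
  have g0 := hQq x hx'
  have g1 := (hQ₁ x hx').trans g0
  have g2 := (hQ₂ x hx').trans g0
  have gp : 0 < |q x| := hQ.trans_le g0
  rw [norm_mul, mul_comm I, norm_exp_ofReal_mul_I, mul_one, norm_real, Real.norm_eq_abs]
  have t1 : |u₂ x / q x ^ 2| ≤ K / Q ^ 2 := by
    rw [abs_div, abs_pow]; gcongr
  have t2 : |3 * (u₁ x * q₁ x) / q x ^ 3| ≤ 3 * (K / Q ^ 2) := by
    rw [abs_div, abs_mul, abs_mul, abs_pow, abs_of_pos (by norm_num : (0:ℝ) < 3)]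
    calc 3 * (|u₁ x| * |q₁ x|) / |q x| ^ 3 ≤ 3 * (K * |q x|) / |q x| ^ 3 := by gcongr
      _ = 3 * (K / |q x| ^ 2) := by field_simp
      _ ≤ _ := by gcongr
  have t3 : |u x * q₂ x / q x ^ 3| ≤ K / Q ^ 2 := by
    rw [abs_div, abs_mul, abs_pow]
    calc |u x| * |q₂ x| / |q x| ^ 3 ≤ K * |q x| / |q x| ^ 3 := by gcongr
      _ = (K / |q x| ^ 2) := by field_simp
      _ ≤ _ := by gcongr
  have t4 : |3 * (u x * q₁ x ^ 2) / q x ^ 4| ≤ 3 * (K / Q ^ 2) := by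
    rw [abs_div, abs_mul, abs_mul, abs_pow, abs_pow, abs_of_pos (by norm_num : (0:ℝ) < 3)]
    calc 3 * (|u x| * |q₁ x| ^ 2) / |q x| ^ 4 ≤ 3 * (K * |q x| ^ 2) / |q x| ^ 4 := by gcongr
      _ = 3 * (K / |q x| ^ 2) := by field_simp
      _ ≤ _ := by gcongr
  have e : 8 * K / Q ^ 2 = K / Q ^ 2 + 3 * (K / Q ^ 2) + K / Q ^ 2 + 3 * (K / Q ^ 2) := by ring
  rw [e]
  refine (abs_add_le _ _).trans (add_le_add ((abs_sub _ _).trans (add_le_add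
    ((abs_sub _ _).trans (add_le_add t1 t2)) t3)) t4)

/-- Amplitudes supported in `[1/2, 3/2]` with bounded `C²` norm. -/
structure Amp (K : ℝ) (u : ℝ → ℝ) : Prop where
  smooth : ContDiff ℝ (⊤ : ℕ∞) u
  supp : tsupport u ⊆ Set.Icc (1/2 : ℝ) (3/2)
  bound : ∀ x, |u x| ≤ K
  bound_deriv : ∀ x, |deriv u x| ≤ K
  bound_deriv₂ : ∀ x, |deriv (deriv u) x| ≤ K

namespace Amp

variable {K : ℝ} {u : ℝ → ℝ}

theorem nonneg (h : Amp K u) : 0 ≤ K := (abs_nonneg _).trans (h.bound 0)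

theorem mono {K' : ℝ} (h : Amp K u) (hK : K ≤ K') : Amp K' u :=
  ⟨h.1, h.2, fun x => (h.3 x).trans hK, fun x => (h.4 x).trans hK, fun x => (h.5 x).trans hK⟩

theorem smooth_deriv (h : ContDiff ℝ (⊤ : ℕ∞) u) : ContDiff ℝ (⊤ : ℕ∞) (deriv u) :=
  ((contDiff_infty_iff_deriv (𝕜 := ℝ)).1 h).2

theorem exists_of_smooth (hu : ContDiff ℝ (⊤ : ℕ∞) u) (hs : tsupport u ⊆ Set.Icc (1/2 : ℝ) (3/2)) :
    ∃ K, Amp K u := by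
  have hc : HasCompactSupport u := isCompact_Icc.of_isClosed_subset (isClosed_tsupport u) hs
  obtain ⟨K₀, h₀⟩ := hc.exists_bound_of_continuous hu.continuous
  obtain ⟨K₁, h₁⟩ := hc.deriv.exists_bound_of_continuous (smooth_deriv hu).continuous
  obtain ⟨K₂, h₂⟩ := hc.deriv.deriv.exists_bound_of_continuous
    (smooth_deriv (smooth_deriv hu)).continuous
  exact ⟨max K₀ (max K₁ K₂), hu, hs, fun x => (h₀ x).trans (le_max_left _ _),
    fun x => (h₁ x).trans ((le_max_left _ _).trans (le_max_right _ _)),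
    fun x => (h₂ x).trans ((le_max_right _ _).trans (le_max_right _ _))⟩

theorem eq_zero_of_lt (hs : tsupport u ⊆ Set.Icc (1/2 : ℝ) (3/2)) {x : ℝ}
    (hx : x < 1/2 ∨ 3/2 < x) : u x = 0 :=
  image_eq_zero_of_notMem_tsupport fun h => by
    have := hs h
    rcases hx with hx | hx
    · linarith [this.1]
    · linarith [this.2]

theorem supp_deriv (hs : tsupport u ⊆ Set.Icc (1/2 : ℝ) (3/2)) :
    tsupport (deriv u) ⊆ Set.Icc (1/2 : ℝ) (3/2) :=
  tsupport_deriv_subset.trans hs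

theorem smooth_div_id (hu : ContDiff ℝ (⊤ : ℕ∞) u) (hs : tsupport u ⊆ Set.Icc (1/2 : ℝ) (3/2)) :
    ContDiff ℝ (⊤ : ℕ∞) (fun x => u x / x) := by
  refine contDiff_iff_contDiffAt.2 fun x => ?_
  rcases lt_or_ge x (1/2) with hx | hx
  · refine (contDiffAt_const (c := (0 : ℝ))).congr_of_eventuallyEq ?_
    filter_upwards [Iio_mem_nhds hx] with y hy
    rw [eq_zero_of_lt hs (Or.inl hy), zero_div]
  · exact hu.contDiffAt.div contDiffAt_id (show x ≠ 0 by linarith)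

theorem supp_div_id (hs : tsupport u ⊆ Set.Icc (1/2 : ℝ) (3/2)) :
    tsupport (fun x => u x / x) ⊆ Set.Icc (1/2 : ℝ) (3/2) := by
  simp only [div_eq_mul_inv]
  exact (tsupport_mul_subset_left).trans hs

theorem smooth_id_mul_deriv (hu : ContDiff ℝ (⊤ : ℕ∞) u) :
    ContDiff ℝ (⊤ : ℕ∞) (fun x => x * deriv u x) :=
  contDiff_id.mul (smooth_deriv hu)

theorem supp_id_mul_deriv (hs : tsupport u ⊆ Set.Icc (1/2 : ℝ) (3/2)) :
    tsupport (fun x => x * deriv u x) ⊆ Set.Icc (1/2 : ℝ) (3/2) :=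
  (tsupport_mul_subset_right).trans (supp_deriv hs)

end Amp

/-- The phase of one reflection: `-(4/3) l ρ` plus a remainder `b/l` with bounded derivatives and
`b'' ≥ c`. -/
structure ReflPhase (l c C : ℝ) (ph b₁ b₂ b₃ : ℝ → ℝ) : Prop where
  cont : Continuous ph
  hasDerivAt : ∀ ρ ∈ Set.Icc (1/8 : ℝ) 3, HasDerivAt ph (-(4/3) * l + b₁ ρ / l) ρ
  hasDerivAt₁ : ∀ ρ ∈ Set.Icc (1/8 : ℝ) 3, HasDerivAt b₁ (b₂ ρ) ρ
  hasDerivAt₂ : ∀ ρ ∈ Set.Icc (1/8 : ℝ) 3, HasDerivAt b₂ (b₃ ρ) ρ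
  cont₃ : ContinuousOn b₃ (Set.Icc (1/8 : ℝ) 3)
  bound₁ : ∀ ρ ∈ Set.Icc (1/8 : ℝ) 3, |b₁ ρ| ≤ C
  le₂ : ∀ ρ ∈ Set.Icc (1/8 : ℝ) 3, c ≤ b₂ ρ
  bound₂ : ∀ ρ ∈ Set.Icc (1/8 : ℝ) 3, b₂ ρ ≤ C
  bound₃ : ∀ ρ ∈ Set.Icc (1/8 : ℝ) 3, |b₃ ρ| ≤ C

/-- The integral over the rescaled frequency. -/
noncomputable def freqInt (D : ℝ → ℂ) (l α : ℝ) (u : ℝ → ℝ) (E : ℝ) : ℂ :=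
  ∫ ρ in (1/8 : ℝ)..3, (u (α * ρ) : ℂ) * D ρ * Complex.exp (I * (l * ρ * E : ℝ))

/-- The sum of the reflection factors. -/
noncomputable def reflSum (F : Finset ℤ) (ph : ℝ → ℝ) (ρ : ℝ) : ℂ :=
  ∑ N ∈ F, Complex.exp (I * (N * ph ρ : ℝ))

theorem continuous_reflSum (F : Finset ℤ) {ph : ℝ → ℝ} (h : Continuous ph) :
    Continuous (reflSum F ph) := by
  unfold reflSum; fun_prop

theorem continuous_freqInt {D : ℝ → ℂ} (hD : Continuous D) (l α : ℝ) {u : ℝ → ℝ}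
    (hu : Continuous u) : Continuous (freqInt D l α u) := by
  refine intervalIntegral.continuous_parametric_intervalIntegral_of_continuous'
    (f := fun E ρ => (u (α * ρ) : ℂ) * D ρ * Complex.exp (I * (l * ρ * E : ℝ))) ?_ _ _
  simp only [Function.uncurry_def]; fun_prop

theorem hasDerivAt_freqInt {D : ℝ → ℂ} (hD : Continuous D) (l : ℝ) {α : ℝ} (hα : α ≠ 0)
    {u u₁ : ℝ → ℝ} (hu₁ : Continuous u₁) (h : ∀ x, x * u₁ x = u x) (E : ℝ) :
    HasDerivAt (freqInt D l α u₁) (I * l / α * freqInt D l α u E) E := by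
  have hα' : (α : ℂ) ≠ 0 := by exact_mod_cast hα
  have := hasDerivAt_intervalIntegral
    (F := fun E ρ => (u₁ (α * ρ) : ℂ) * D ρ * Complex.exp (I * (l * ρ * E : ℝ)))
    (F' := fun E ρ => (u₁ (α * ρ) : ℂ) * D ρ * (Complex.exp (I * (l * ρ * E : ℝ)) *
      (I * (l * ρ : ℝ)))) (by simp only [Function.uncurry_def]; fun_prop)
      (by simp only [Function.uncurry_def]; fun_prop) (fun w x => ?_) (1/8) 3 E
  · refine this.congr_deriv ?_
    rw [freqInt, ← intervalIntegral.integral_const_mul]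
    congr 1; ext ρ
    rw [← h]
    push_cast
    field_simp
  · refine HasDerivAt.const_mul _ ?_
    have e : HasDerivAt (fun E : ℝ => l * x * E) (l * x) w := by
      simpa using (hasDerivAt_id w).const_mul (l * x)
    exact (e.ofReal_comp.const_mul I).cexp

theorem freqInt_reflSum (F : Finset ℤ) {ph : ℝ → ℝ} (h : Continuous ph) (l α : ℝ) {u : ℝ → ℝ}
    (hu : Continuous u) (E : ℝ) :
    freqInt (reflSum F ph) l α u E = ∑ N ∈ F, ∫ ρ in (1/8 : ℝ)..3,
      (u (α * ρ) : ℂ) * Complex.exp (I * (l * ρ * E + N * ph ρ : ℝ)) := by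
  rw [← intervalIntegral.integral_finsetSum fun N _ =>
    Continuous.intervalIntegrable (by fun_prop) _ _, freqInt]
  congr 1; ext ρ
  rw [reflSum, Finset.mul_sum, Finset.sum_mul]
  refine Finset.sum_congr rfl fun N _ => ?_
  rw [mul_assoc, ← Complex.exp_add]
  congr 2
  push_cast; ring

theorem norm_freqInt_le {D : ℝ → ℂ} {l α K M E : ℝ} {u : ℝ → ℝ} (hu : Amp K u)
    (hD : ∀ ρ, ‖D ρ‖ ≤ M) : ‖freqInt D l α u E‖ ≤ 3 * (K * M) := by
  have hM : 0 ≤ M := (norm_nonneg _).trans (hD 0)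
  refine (intervalIntegral.norm_integral_le_of_norm_le_const (C := K * M) fun ρ _ => ?_).trans ?_
  · rw [norm_mul, mul_comm I, norm_exp_ofReal_mul_I, mul_one, norm_mul, norm_real]
    exact mul_le_mul (hu.bound _) (hD ρ) (norm_nonneg _) hu.nonneg
  · rw [abs_of_nonneg (by norm_num), mul_comm]
    have := mul_nonneg hu.nonneg hM
    nlinarith

theorem norm_reflSum_le (F : Finset ℤ) (ph : ℝ → ℝ) (ρ : ℝ) : ‖reflSum F ph ρ‖ ≤ F.card := by
  refine (norm_sum_le _ _).trans (le_of_eq ?_)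
  simp only [mul_comm I, norm_exp_ofReal_mul_I, Finset.sum_const, nsmul_eq_mul, mul_one]

namespace ReflPhase

variable {l c C : ℝ} {ph b₁ b₂ b₃ : ℝ → ℝ}

theorem hasDerivAt_phase (H : ReflPhase l c C ph b₁ b₂ b₃) (N : ℤ) (E : ℝ) :
    ∀ ρ ∈ Set.Icc (1/8 : ℝ) 3, HasDerivAt (fun ρ => l * ρ * E + N * ph ρ)
      (l * (E - 4/3 * N) + N / l * b₁ ρ) ρ := fun ρ hρ => by
  have e : HasDerivAt (fun ρ : ℝ => l * ρ * E) (l * E) ρ := by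
    simpa using ((hasDerivAt_id ρ).const_mul l).mul_const E
  refine (e.add ((H.hasDerivAt ρ hρ).const_mul (N : ℝ))).congr_deriv ?_
  ring

theorem hasDerivAt_slope (H : ReflPhase l c C ph b₁ b₂ b₃) (N : ℤ) (E : ℝ) :
    ∀ ρ ∈ Set.Icc (1/8 : ℝ) 3, HasDerivAt (fun ρ => l * (E - 4/3 * N) + N / l * b₁ ρ)
      (N / l * b₂ ρ) ρ := fun ρ hρ =>
  ((H.hasDerivAt₁ ρ hρ).const_mul _).const_add _

theorem const_nonneg (H : ReflPhase l c C ph b₁ b₂ b₃) : 0 ≤ C :=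
  (abs_nonneg _).trans (H.bound₁ 1 (by norm_num))

theorem hasDerivAt_amp {K α : ℝ} {u : ℝ → ℝ} (hu : Amp K u) (ρ : ℝ) :
    HasDerivAt (fun ρ => u (α * ρ)) (α * deriv u (α * ρ)) ρ ∧
    HasDerivAt (fun ρ => α * deriv u (α * ρ)) (α ^ 2 * deriv (deriv u) (α * ρ)) ρ := by
  have e : HasDerivAt (fun ρ : ℝ => α * ρ) α ρ := by simpa using (hasDerivAt_id ρ).const_mul α
  have h1 : HasDerivAt u (deriv u (α * ρ)) (α * ρ) :=
    (hu.smooth.differentiable (by simp) _).hasDerivAt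
  have h2 : HasDerivAt (deriv u) (deriv (deriv u) (α * ρ)) (α * ρ) :=
    ((Amp.smooth_deriv hu.smooth).differentiable (by simp) _).hasDerivAt
  exact ⟨(h1.comp ρ e).congr_deriv (by ring), ((h2.comp ρ e).const_mul α).congr_deriv (by ring)⟩

/-- Second-derivative test for one reflection. -/
theorem norm_integral_le_sqrt (H : ReflPhase l c C ph b₁ b₂ b₃) (hc : 0 < c) (hl : 0 < l)
    {K α : ℝ} {u : ℝ → ℝ} (hu : Amp K u) (hα : α ∈ Set.Icc (27/50 : ℝ) (29/10)) {N : ℤ} (hN : N ≠ 0)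
    (E : ℝ) :
    ‖∫ ρ in (1/8 : ℝ)..3, (u (α * ρ) : ℂ) * Complex.exp (I * (l * ρ * E + N * ph ρ : ℝ))‖ ≤
      (32 + 2 / c) * K * √(l / |(N : ℝ)|) := by
  have hN' : (0:ℝ) < |(N : ℝ)| := abs_pos.2 (by exact_mod_cast hN)
  obtain ⟨s, hs, hsN⟩ : ∃ s : ℝ, (s = 1 ∨ s = -1) ∧ s * N = |(N : ℝ)| := by
    rcases le_total 0 (N : ℝ) with h | h
    · exact ⟨1, Or.inl rfl, by rw [abs_of_nonneg h, one_mul]⟩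
    · exact ⟨-1, Or.inr rfl, by rw [abs_of_nonpos h]; ring⟩
  have hs2 : (s : ℂ) * s = 1 := by rcases hs with rfl | rfl <;> norm_num
  have hsn : ‖(s : ℂ)‖ = 1 := by rcases hs with rfl | rfl <;> norm_num
  have hK := hu.nonneg
  have cu := hu.smooth.continuous
  have cu' := (Amp.smooth_deriv hu.smooth).continuous
  have cph := H.cont
  have cb2 : ContinuousOn b₂ (Set.Icc (1/8 : ℝ) 3) := fun ρ hρ =>
    (H.hasDerivAt₂ ρ hρ).continuousAt.continuousWithinAt
  have O : OscData (1/8) 3 (fun ρ => s * (l * (E - 4/3 * N) + N / l * b₁ ρ))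
      (fun ρ => s * (N / l * b₂ ρ))
      (fun ρ => (u (α * ρ) : ℂ) * Complex.exp (I * (l * ρ * E + N * ph ρ : ℝ)))
      (fun ρ => -(I * s) * ((u (α * ρ) : ℂ) * Complex.exp (I * (l * ρ * E + N * ph ρ : ℝ))))
      (fun ρ => -(I * s) * (((α * deriv u (α * ρ) : ℝ) : ℂ) *
        Complex.exp (I * (l * ρ * E + N * ph ρ : ℝ)))) := by
    refine ⟨fun ρ hρ => (H.hasDerivAt_slope N E ρ hρ).const_mul s, fun ρ hρ => ?_, ?_, ?_, ?_,
      fun ρ hρ => ?_⟩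
    · have d1 := (hasDerivAt_amp (α := α) hu ρ).1
      have d2 := ((H.hasDerivAt_phase N E ρ hρ).ofReal_comp.const_mul I).cexp
      refine ((d1.ofReal_comp.mul d2).const_mul (-(I * s))).congr_deriv ?_
      push_cast
      ring_nf
      simp only [I_sq]
      ring
    · fun_prop
    · fun_prop
    · fun_prop
    · have e : s * (N / l * b₂ ρ) = |(N : ℝ)| / l * b₂ ρ := by rw [← hsN]; ring
      rw [e]
      have := hc.le.trans (H.le₂ ρ hρ)
      positivity
  have hn : ∀ t : ℝ, ‖Complex.exp (I * (t : ℂ))‖ = 1 := fun t => by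
    rw [mul_comm, norm_exp_ofReal_mul_I]
  have hδ : 0 < √(|(N : ℝ)| / l) := Real.sqrt_pos.2 (by positivity)
  have hk0 : ∀ ρ : ℝ, ‖(u (α * ρ) : ℂ) * Complex.exp (I * (l * ρ * E + N * ph ρ : ℝ))‖ ≤ K :=
    fun ρ => by
      rw [norm_mul, hn, mul_one, norm_real]; exact hu.bound _
  have hIs : ‖-(I * (s : ℂ))‖ = 1 := by rw [norm_neg, norm_mul, hsn, norm_I, one_mul]
  have key := O.norm_integral_le (by norm_num) (δ := √(|(N : ℝ)| / l))
    (ω := 2 / c * √(l / |(N : ℝ)|)) (M := K) (M₁ := K) (D := 4 * K) hδ (by positivity)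
    (fun ρ _ => hk0 ρ) (fun ρ _ => by rw [norm_mul, hIs, one_mul]; exact hk0 ρ)
    (fun ρ _ => ?_) ?_
  · refine key.trans ?_
    have e : √(l / |(N : ℝ)|) = 1 / √(|(N : ℝ)| / l) := by
      rw [← Real.sqrt_one, ← Real.sqrt_div (by norm_num)]
      congr 1; field_simp
    rw [e]
    have e2 : 2 * (4 * K / √(|(N : ℝ)| / l) + 4 * K * ((3 - 1/8) / √(|(N : ℝ)| / l))) =
        31 * (K * (1 / √(|(N : ℝ)| / l))) := by ring
    rw [e2]
    have : 0 ≤ K * (1 / √(|(N : ℝ)| / l)) := by positivity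
    linarith
  · rw [norm_mul, hIs, one_mul, norm_mul, hn, mul_one, norm_real, norm_mul, Real.norm_eq_abs,
      Real.norm_eq_abs, abs_of_nonneg (by linarith [hα.1])]
    exact mul_le_mul (by linarith [hα.2]) (hu.bound_deriv _) (abs_nonneg _) (by norm_num)
  · intro x hx y hy hxy h1 h2
    -- monotonicity with slope
    have hmono : |(N : ℝ)| / l * c * (y - x) ≤
        s * (l * (E - 4/3 * N) + N / l * b₁ y) - s * (l * (E - 4/3 * N) + N / l * b₁ x) := by
      have hd : MonotoneOn (fun ρ => s * (l * (E - 4/3 * N) + N / l * b₁ ρ) -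
          |(N : ℝ)| / l * c * ρ) (Set.Icc (1/8 : ℝ) 3) := by
        have hder : ∀ ρ ∈ Set.Icc (1/8 : ℝ) 3, HasDerivAt (fun ρ =>
            s * (l * (E - 4/3 * N) + N / l * b₁ ρ) - |(N : ℝ)| / l * c * ρ)
            (s * (N / l * b₂ ρ) - |(N : ℝ)| / l * c) ρ := fun ρ hρ => by
          refine ((O.1 ρ hρ).sub ((hasDerivAt_id ρ).const_mul (|(N : ℝ)| / l * c))).congr_deriv ?_
          simp
        refine monotoneOn_of_deriv_nonneg (convex_Icc _ _) (fun ρ hρ =>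
          (hder ρ hρ).continuousAt.continuousWithinAt) (fun ρ hρ =>
          (hder ρ (interior_subset hρ)).differentiableAt.differentiableWithinAt) fun ρ hρ => ?_
        have hρ' := interior_subset hρ
        rw [(hder ρ hρ').deriv]
        have e : s * (N / l * b₂ ρ) = |(N : ℝ)| / l * b₂ ρ := by rw [← hsN]; ring
        rw [e]
        have := mul_le_mul_of_nonneg_left (H.le₂ ρ hρ') (by positivity : 0 ≤ |(N : ℝ)| / l)
        linarith
      have := hd hx hy hxy
      simp only at this
      linarith
    have a1 := (abs_le.1 h1).1
    have a2 := (abs_le.1 h2).2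
    have hsq : √(|(N : ℝ)| / l) = |(N : ℝ)| / l * √(l / |(N : ℝ)|) := by
      have h1 := Real.sq_sqrt (by positivity : 0 ≤ l / |(N : ℝ)|)
      rw [eq_comm, ← Real.sqrt_sq (by positivity : 0 ≤ |(N : ℝ)| / l * √(l / |(N : ℝ)|)),
        mul_pow, h1]
      congr 1
      field_simp
    rw [hsq] at a1 a2
    have hpos : 0 < |(N : ℝ)| / l := by positivity
    have : |(N : ℝ)| / l * (c * (y - x)) ≤ |(N : ℝ)| / l * (2 * √(l / |(N : ℝ)|)) := by linarith
    have := le_of_mul_le_mul_left this hpos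
    rw [div_mul_eq_mul_div, le_div_iff₀ hc]
    linarith

/-- Nonstationary estimate for one reflection. -/
theorem norm_integral_le_far (H : ReflPhase l c C ph b₁ b₂ b₃) (hc : 0 < c) (hl : 0 < l)
    {K α : ℝ} {u : ℝ → ℝ} (hu : Amp K u) (hα : α ∈ Set.Icc (27/50 : ℝ) (29/10)) {N : ℤ} {E : ℝ}
    (hE : 0 < |E - 4/3 * N|) (hEN : 2 * C * |(N : ℝ)| / l ^ 2 ≤ |E - 4/3 * N|) :
    ‖∫ ρ in (1/8 : ℝ)..3, (u (α * ρ) : ℂ) * Complex.exp (I * (l * ρ * E + N * ph ρ : ℝ))‖ ≤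
      864 * K / (l * |E - 4/3 * N|) ^ 2 := by
  have hα0 : 0 ≤ α := by linarith [hα.1]
  have hK := hu.nonneg
  have hC := H.const_nonneg
  have hNl : C * (|(N : ℝ)| / l) ≤ l * |E - 4/3 * N| / 2 := by
    have := mul_le_mul_of_nonneg_left hEN hl.le
    have e : l * (2 * C * |(N : ℝ)| / l ^ 2) = 2 * (C * (|(N : ℝ)| / l)) := by field_simp
    linarith
  have habs : |(N : ℝ) / l| = |(N : ℝ)| / l := by rw [abs_div, abs_of_pos hl]
  have hz : ∀ x : ℝ, x < 1/2 ∨ 3/2 < x → u x = 0 ∧ deriv u x = 0 := fun x hx =>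
    ⟨Amp.eq_zero_of_lt hu.supp hx, Amp.eq_zero_of_lt (Amp.supp_deriv hu.supp) hx⟩
  have ha : α * (1/8) < 1/2 ∨ 3/2 < α * (1/8) := Or.inl (by linarith [hα.2])
  have hb : α * 3 < 1/2 ∨ 3/2 < α * 3 := Or.inr (by linarith [hα.1])
  have hα2 : α ^ 2 ≤ 9 := by nlinarith [hα.2]
  have key := norm_integral_le_of_large_slope (a := 1/8) (b := 3) (K := 9 * K)
    (Q := l * |E - 4/3 * N| / 2) (by norm_num) (by positivity)
    (u := fun ρ => u (α * ρ)) (u₁ := fun ρ => α * deriv u (α * ρ))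
    (u₂ := fun ρ => α ^ 2 * deriv (deriv u) (α * ρ))
    (fun ρ _ => (hasDerivAt_amp hu ρ).1) (fun ρ _ => (hasDerivAt_amp hu ρ).2)
    (by
      have := (Amp.smooth_deriv (Amp.smooth_deriv hu.smooth)).continuous
      fun_prop)
    (H.hasDerivAt_phase N E) (H.hasDerivAt_slope N E)
    (fun ρ hρ => (H.hasDerivAt₂ ρ hρ).const_mul ((N : ℝ) / l))
    (continuousOn_const.mul H.cont₃) (hz _ ha).1 (hz _ hb).1 (by rw [(hz _ ha).2, mul_zero])
    (by rw [(hz _ hb).2, mul_zero]) (fun ρ _ => ⟨?_, ?_, ?_⟩) (fun ρ hρ => ?_) (fun ρ hρ => ?_)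
    (fun ρ hρ => ?_)
  · refine key.trans ?_
    have e : 8 * (9 * K) / (l * |E - 4/3 * N| / 2) ^ 2 * (3 - 1/8) =
        828 * K / (l * |E - 4/3 * N|) ^ 2 := by
      field_simp
      ring
    rw [e]
    gcongr
    norm_num
  · linarith [hu.bound (α * ρ)]
  · rw [abs_mul, abs_of_nonneg hα0]
    exact mul_le_mul (by linarith [hα.2]) (hu.bound_deriv _) (abs_nonneg _) (by norm_num)
  · rw [abs_mul, abs_of_nonneg (by positivity)]
    exact mul_le_mul hα2 (hu.bound_deriv₂ _) (abs_nonneg _) (by norm_num)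
  · have t1 : |N / l * b₁ ρ| ≤ l * |E - 4/3 * N| / 2 := by
      rw [abs_mul, habs]
      have := mul_le_mul_of_nonneg_left (H.bound₁ ρ hρ) (by positivity : 0 ≤ |(N : ℝ)| / l)
      linarith
    have t2 : |l * (E - 4/3 * N)| = l * |E - 4/3 * N| := by rw [abs_mul, abs_of_pos hl]
    have t3 := abs_sub_abs_le_abs_sub (l * (E - 4/3 * N)) (-(N / l * b₁ ρ))
    rw [sub_neg_eq_add, abs_neg] at t3
    linarith
  · have := mul_le_mul_of_nonneg_left (H.bound₂ ρ hρ) (by positivity : 0 ≤ |(N : ℝ)| / l)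
    rw [abs_mul, habs, abs_of_nonneg (hc.le.trans (H.le₂ ρ hρ))]
    linarith
  · have := mul_le_mul_of_nonneg_left (H.bound₃ ρ hρ) (by positivity : 0 ≤ |(N : ℝ)| / l)
    rw [abs_mul, habs]
    linarith

end ReflPhase
theorem card_le_of_abs_sub_le {F : Finset ℤ} {t r : ℝ} (hr : 0 ≤ r)
    (h : ∀ N ∈ F, |t - (N : ℝ)| ≤ r) : (F.card : ℝ) ≤ 2 * r + 1 := by
  have hsub : F ⊆ Finset.Icc ⌈t - r⌉ ⌊t + r⌋ := fun N hN => by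
    have := abs_le.1 (h N hN)
    rw [Finset.mem_Icc, Int.ceil_le, Int.le_floor]
    constructor <;> linarith
  have h1 : (F.card : ℝ) ≤ ((Finset.Icc ⌈t - r⌉ ⌊t + r⌋).card : ℝ) := by
    exact_mod_cast Finset.card_le_card hsub
  refine h1.trans ?_
  rw [Int.card_Icc]
  have h2 : (((⌊t + r⌋ + 1 - ⌈t - r⌉).toNat : ℤ) : ℝ) =
      ((max (⌊t + r⌋ + 1 - ⌈t - r⌉) 0 : ℤ) : ℝ) := by
    rw [Int.toNat_eq_max]
  rw [Int.cast_natCast] at h2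
  rw [h2, Int.cast_max]
  refine max_le ?_ (by push_cast; linarith)
  push_cast
  linarith [Int.floor_le (t + r), Int.le_ceil (t - r)]

theorem exists_sum_one_div_sq_le : ∃ Z : ℝ, 0 ≤ Z ∧ ∀ (F : Finset ℤ) (E : ℝ),
    (∀ N ∈ F, 1 ≤ |E - 4/3 * (N : ℝ)|) → ∑ N ∈ F, 1 / |E - 4/3 * (N : ℝ)| ^ 2 ≤ Z := by
  have hs : Summable fun m : ℤ => 1 / (1 + |(m : ℝ)|) ^ 2 := by
    have hn : Summable fun n : ℕ => 1 / (1 + (n : ℝ)) ^ 2 := by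
      have := (summable_nat_add_iff 1).2 (Real.summable_one_div_nat_pow.2 (by norm_num : 1 < 2))
      refine this.congr fun n => ?_
      push_cast; rw [add_comm]
    refine Summable.of_nat_of_neg ?_ ?_ <;> simpa using hn
  refine ⟨8 * ∑' m : ℤ, 1 / (1 + |(m : ℝ)|) ^ 2, by positivity, fun F E hF => ?_⟩
  set m₀ := ⌊3/4 * E⌋ with hm₀
  have hle : ∀ N ∈ F, 1 / |E - 4/3 * (N : ℝ)| ^ 2 ≤ 8 * (1 / (1 + |((N - m₀ : ℤ) : ℝ)|) ^ 2) := by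
    intro N hN
    have h1 := hF N hN
    have f1 := Int.floor_le (3/4 * E)
    have f2 := Int.lt_floor_add_one (3/4 * E)
    have key : 1 + |((N - m₀ : ℤ) : ℝ)| ≤ 11/4 * |E - 4/3 * (N : ℝ)| := by
      push_cast
      have : |(N : ℝ) - m₀| ≤ 3/4 * |E - 4/3 * (N : ℝ)| + 1 := by
        rw [abs_le]
        have := neg_abs_le (E - 4/3 * (N : ℝ))
        have := le_abs_self (E - 4/3 * (N : ℝ))
        constructor <;> linarith
      linarith
    have hp : (0:ℝ) < 1 + |((N - m₀ : ℤ) : ℝ)| := by positivity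
    rw [mul_one_div, div_le_div_iff₀ (by positivity) (by positivity), one_mul]
    calc (1 + |((N - m₀ : ℤ) : ℝ)|) ^ 2 ≤ (11/4 * |E - 4/3 * (N : ℝ)|) ^ 2 := by gcongr
      _ = 121/16 * |E - 4/3 * (N : ℝ)| ^ 2 := by ring
      _ ≤ _ := by gcongr; norm_num
  refine (Finset.sum_le_sum hle).trans ?_
  rw [← Finset.mul_sum]
  refine mul_le_mul_of_nonneg_left ?_ (by norm_num)
  have := (hs.comp_injective (Equiv.subRight m₀).injective).sum_le_tsum F (fun _ _ => by
    simp only [Function.comp_apply]; positivity)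
  refine this.trans (le_of_eq ?_)
  exact (Equiv.subRight m₀).tsum_eq (fun m : ℤ => 1 / (1 + |(m : ℝ)|) ^ 2)

namespace ReflPhase

theorem norm_integral_le_const {l K α E : ℝ} {u ph : ℝ → ℝ} (hu : Amp K u) (N : ℤ) :
    ‖∫ ρ in (1/8 : ℝ)..3, (u (α * ρ) : ℂ) * Complex.exp (I * (l * ρ * E + N * ph ρ : ℝ))‖ ≤
      3 * K := by
  refine (intervalIntegral.norm_integral_le_of_norm_le_const (C := K) fun ρ _ => ?_).trans ?_
  · rw [norm_mul, mul_comm I, norm_exp_ofReal_mul_I, mul_one, norm_real]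
    exact hu.bound _
  · rw [abs_of_nonneg (by norm_num), mul_comm]
    have := hu.nonneg
    nlinarith

/-- Summation over reflections, given a bound `B` for the nearly stationary ones. -/
theorem exists_norm_freqInt_reflSum_le_of_near (C : ℝ) : ∃ Z : ℝ, 0 ≤ Z ∧
    ∀ {l c : ℝ} {ph b₁ b₂ b₃ : ℝ → ℝ}, ReflPhase l c C ph b₁ b₂ b₃ → 0 < c → 0 < l →
    6 * C ≤ l ^ 2 → ∀ {K α : ℝ} {u : ℝ → ℝ}, Amp K u → α ∈ Set.Icc (27/50 : ℝ) (29/10) →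
    ∀ (F : Finset ℤ) (E B : ℝ), 0 ≤ B → (∀ N : ℤ, |E| ≤ 5/3 * |(N : ℝ)| + 1 →
      ‖∫ ρ in (1/8 : ℝ)..3, (u (α * ρ) : ℂ) * Complex.exp (I * (l * ρ * E + N * ph ρ : ℝ))‖ ≤ B) →
    ‖freqInt (reflSum F ph) l α u E‖ ≤ (5/2 + 3 * C * (|E| + 1) / l ^ 2) * B + Z * K / l ^ 2 := by
  obtain ⟨Z, hZ, hsum⟩ := exists_sum_one_div_sq_le
  refine ⟨864 * Z, by positivity,
    fun {l c ph b₁ b₂ b₃} H hc hl hCl {K α u} hu hα F E B hB hnear => ?_⟩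
  have hC := H.const_nonneg
  have hK := hu.nonneg
  have hratio : 2 * C / l ^ 2 ≤ 1/3 := by
    rw [div_le_iff₀ (by positivity)]; linarith
  rw [freqInt_reflSum F H.cont l α hu.smooth.continuous]
  refine (norm_sum_le _ _).trans ?_
  rw [← Finset.sum_filter_add_sum_filter_not F
    (fun N : ℤ => |E - 4/3 * (N : ℝ)| < max 1 (2 * C * |(N : ℝ)| / l ^ 2))]
  refine add_le_add ?_ ?_
  · have hN : ∀ N ∈ F.filter (fun N : ℤ => |E - 4/3 * (N : ℝ)| < max 1 (2 * C * |(N : ℝ)| / l ^ 2)),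
        |E| ≤ 5/3 * |(N : ℝ)| + 1 ∧ |3/4 * E - N| ≤ 3/4 * (1 + 2 * C * (|E| + 1) / l ^ 2) := by
      intro N hN
      have h1 := (Finset.mem_filter.1 hN).2
      have h2 : 2 * C * |(N : ℝ)| / l ^ 2 = 2 * C / l ^ 2 * |(N : ℝ)| := by ring
      have h3 : 2 * C / l ^ 2 * |(N : ℝ)| ≤ 1/3 * |(N : ℝ)| := by gcongr
      have hq : 0 ≤ 2 * C / l ^ 2 := by positivity
      have h4 : max 1 (2 * C * |(N : ℝ)| / l ^ 2) ≤ 1 + 2 * C / l ^ 2 * |(N : ℝ)| := by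
        rw [h2]
        have := mul_nonneg hq (abs_nonneg (N : ℝ))
        exact max_le (by linarith) (by linarith)
      have e4 : |4/3 * (N : ℝ)| = 4/3 * |(N : ℝ)| := by rw [abs_mul, abs_of_pos (by norm_num)]
      have h5 := abs_sub_abs_le_abs_sub E (4/3 * (N : ℝ))
      have h6 := abs_sub_abs_le_abs_sub (4/3 * (N : ℝ)) E
      rw [abs_sub_comm (4/3 * (N : ℝ)) E] at h6
      rw [e4] at h5 h6
      have h7 : |(N : ℝ)| ≤ |E| + 1 := by linarith
      refine ⟨by linarith, ?_⟩
      have e5 : 3/4 * E - N = 3/4 * (E - 4/3 * N) := by ring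
      rw [e5, abs_mul, abs_of_pos (by norm_num : (0:ℝ) < 3/4)]
      refine mul_le_mul_of_nonneg_left ?_ (by norm_num)
      have h8 := mul_le_mul_of_nonneg_left h7 hq
      have e6 : 2 * C * (|E| + 1) / l ^ 2 = 2 * C / l ^ 2 * (|E| + 1) := by ring
      rw [e6]; linarith
    have hcard := card_le_of_abs_sub_le (t := 3/4 * E) (by positivity) fun N h => (hN N h).2
    refine (Finset.sum_le_card_nsmul _ _ B fun N h => hnear N (hN N h).1).trans ?_
    rw [nsmul_eq_mul]
    refine mul_le_mul_of_nonneg_right (hcard.trans (le_of_eq ?_)) hB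
    ring
  · have hN : ∀ N ∈ F.filter (fun N : ℤ =>
        ¬ |E - 4/3 * (N : ℝ)| < max 1 (2 * C * |(N : ℝ)| / l ^ 2)),
        1 ≤ |E - 4/3 * (N : ℝ)| ∧ 2 * C * |(N : ℝ)| / l ^ 2 ≤ |E - 4/3 * (N : ℝ)| := fun N hN =>
      max_le_iff.1 (not_lt.1 (Finset.mem_filter.1 hN).2)
    have h1 := hsum _ E fun N h => (hN N h).1
    calc _ ≤ ∑ N ∈ F.filter (fun N : ℤ =>
            ¬ |E - 4/3 * (N : ℝ)| < max 1 (2 * C * |(N : ℝ)| / l ^ 2)),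
          864 * K / l ^ 2 * (1 / |E - 4/3 * (N : ℝ)| ^ 2) := by
          refine Finset.sum_le_sum fun N h => ?_
          refine (H.norm_integral_le_far hc hl hu hα (by linarith [(hN N h).1]) (hN N h).2).trans
            (le_of_eq ?_)
          rw [mul_pow, div_mul_div_comm, mul_one]
      _ = 864 * K / l ^ 2 * _ := (Finset.mul_sum _ _ _).symm
      _ ≤ 864 * K / l ^ 2 * Z := by gcongr
      _ = _ := by ring

/-- Summation over reflections. -/
theorem exists_norm_freqInt_reflSum_le (c C c₀ : ℝ) (hc : 0 < c) (hc₀ : 0 < c₀) :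
    ∃ C' : ℝ, 0 ≤ C' ∧
    ∀ {l : ℝ} {ph b₁ b₂ b₃ : ℝ → ℝ}, ReflPhase l c C ph b₁ b₂ b₃ → 1 ≤ l →
    6 * C ≤ l ^ 2 → ∀ {K α : ℝ} {u : ℝ → ℝ}, Amp K u → α ∈ Set.Icc (27/50 : ℝ) (29/10) →
    ∀ (F : Finset ℤ) (E : ℝ),
    ‖freqInt (reflSum F ph) l α u E‖ ≤ C' * K * (1 + √(|E| / l ^ 3)) ∧
    (c₀ * l ^ 2 ≤ |E| → 3 ≤ |E| → ‖freqInt (reflSum F ph) l α u E‖ ≤ C' * K * √(|E| / l ^ 3)) := by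
  obtain ⟨Z, hZ, hnear⟩ := exists_norm_freqInt_reflSum_le_of_near C
  set d := 32 + 2 / c with hd
  have hd0 : 0 < d := by positivity
  have hq : ∀ {l E : ℝ}, 0 < l → 0 < |E| → |E| / l ^ 2 * √(l / |E|) = √(|E| / l ^ 3) := by
    intro l E hl hE
    rw [← Real.sqrt_sq (by positivity : 0 ≤ |E| / l ^ 2), ← Real.sqrt_mul (by positivity)]
    congr 1; field_simp
  refine ⟨13.5 + 8 * |C| * d + Z + 5 / c₀ * d, by positivity,
    fun {l ph b₁ b₂ b₃} H hl hCl {K α u} hu hα F E => ?_⟩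
  have hK := hu.nonneg
  have hC := H.const_nonneg
  rw [abs_of_nonneg hC]
  have hl0 : 0 < l := by linarith
  have hl2 : 1 ≤ l ^ 2 := by nlinarith
  have hZK : Z * K / l ^ 2 ≤ Z * K := div_le_self (by positivity) hl2
  have hsqrt : 3 ≤ |E| → ∀ N : ℤ, |E| ≤ 5/3 * |(N : ℝ)| + 1 →
      ‖∫ ρ in (1/8 : ℝ)..3, (u (α * ρ) : ℂ) * Complex.exp (I * (l * ρ * E + N * ph ρ : ℝ))‖ ≤
      2 * d * K * √(l / |E|) := by
    intro hE N hN
    have hN0 : 0 < |(N : ℝ)| := by linarith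
    have hN0' : N ≠ 0 := by rintro rfl; simp at hN0
    refine (H.norm_integral_le_sqrt hc hl0 hu hα hN0' E).trans ?_
    have : √(l / |(N : ℝ)|) ≤ 2 * √(l / |E|) := by
      rw [← Real.sqrt_sq (by norm_num : (0:ℝ) ≤ 2), ← Real.sqrt_mul (by norm_num)]
      refine Real.sqrt_le_sqrt ?_
      rw [mul_div_assoc', div_le_div_iff₀ hN0 (by linarith)]
      nlinarith
    calc d * K * √(l / |(N : ℝ)|) ≤ d * K * (2 * √(l / |E|)) := by gcongr
      _ = _ := by ring
  have hcount : 3 ≤ |E| → 3 * C * (|E| + 1) / l ^ 2 ≤ 4 * C * (|E| / l ^ 2) := fun hE => by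
    rw [mul_div_assoc']
    refine div_le_div_of_nonneg_right ?_ (by positivity)
    nlinarith
  constructor
  · rcases lt_or_ge |E| 3 with hE | hE
    · have h := hnear H hc hl0 hCl hu hα F E (3 * K) (by positivity)
        fun N _ => norm_integral_le_const hu N
      have h1 : 3 * C * (|E| + 1) / l ^ 2 ≤ 2 := by
        rw [div_le_iff₀ (by positivity)]; nlinarith
      have h2 : (5/2 + 3 * C * (|E| + 1) / l ^ 2) * (3 * K) ≤ (5/2 + 2) * (3 * K) := by gcongr
      have h3 : 0 ≤ √(|E| / l ^ 3) := Real.sqrt_nonneg _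
      have h4 : (13.5 + Z) * K ≤ (13.5 + 8 * C * d + Z + 5 / c₀ * d) * K := by
        refine mul_le_mul_of_nonneg_right ?_ hK
        have : 0 ≤ 8 * C * d := by positivity
        have : 0 ≤ 5 / c₀ * d := by positivity
        linarith
      have h5 : (13.5 + 8 * C * d + Z + 5 / c₀ * d) * K * 1 ≤
          (13.5 + 8 * C * d + Z + 5 / c₀ * d) * K * (1 + √(|E| / l ^ 3)) := by
        gcongr; linarith
      linarith
    · have h := hnear H hc hl0 hCl hu hα F E (min (3 * K) (2 * d * K * √(l / |E|)))
        (by positivity) fun N hN => le_min (norm_integral_le_const hu N) (hsqrt hE N hN)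
      have h1 : (5/2 + 3 * C * (|E| + 1) / l ^ 2) * min (3 * K) (2 * d * K * √(l / |E|)) ≤
          5/2 * (3 * K) + 4 * C * (|E| / l ^ 2) * (2 * d * K * √(l / |E|)) := by
        rw [add_mul]
        exact add_le_add (mul_le_mul_of_nonneg_left (min_le_left _ _) (by norm_num))
          (mul_le_mul (hcount hE) (min_le_right _ _) (by positivity) (by positivity))
      have h2 : 4 * C * (|E| / l ^ 2) * (2 * d * K * √(l / |E|)) =
          8 * C * d * K * √(|E| / l ^ 3) := by
        rw [← hq hl0 (by linarith : 0 < |E|)]; ring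
      have h3 : 0 ≤ √(|E| / l ^ 3) := Real.sqrt_nonneg _
      have h4 : 0 ≤ (8 * C * d + 5 / c₀ * d) * K := by positivity
      have h5 : 0 ≤ (13.5 + Z + 5 / c₀ * d) * K * √(|E| / l ^ 3) := by positivity
      have h6 : 0 ≤ 6 * K := by positivity
      rw [h2] at h1
      linarith
  · intro hE0 hE
    have h := hnear H hc hl0 hCl hu hα F E (2 * d * K * √(l / |E|))
        (by positivity) fun N hN => hsqrt hE N hN
    have h0 : (5/2 : ℝ) ≤ 5/2 * (1 / c₀) * (|E| / l ^ 2) := by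
      have : 1 ≤ 1 / c₀ * (|E| / l ^ 2) := by
        rw [div_mul_div_comm, one_mul, le_div_iff₀ (by positivity)]; linarith
      linarith
    have h1 : (5/2 + 3 * C * (|E| + 1) / l ^ 2) * (2 * d * K * √(l / |E|)) ≤
          (5/2 * (1 / c₀) * (|E| / l ^ 2) + 4 * C * (|E| / l ^ 2)) * (2 * d * K * √(l / |E|)) := by
      gcongr ?_ * _
      exact add_le_add h0 (hcount hE)
    have h2 : (5/2 * (1 / c₀) * (|E| / l ^ 2) + 4 * C * (|E| / l ^ 2)) * (2 * d * K * √(l / |E|)) =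
          (5 / c₀ * d + 8 * C * d) * K * √(|E| / l ^ 3) := by
      rw [← hq hl0 (by linarith : 0 < |E|)]; ring
    have h3 : 1 / l ^ 2 ≤ √(|E| / l ^ 3) := by
      refine Real.le_sqrt_of_sq_le ?_
      rw [div_pow, div_le_div_iff₀ (by positivity) (by positivity)]
      have : l ^ 3 * 1 ≤ l ^ 3 * (|E| * l) := by gcongr; nlinarith
      nlinarith
    have h4 : Z * K / l ^ 2 ≤ Z * K * √(|E| / l ^ 3) := by
      rw [← mul_one_div]; gcongr
    have h5 : 0 ≤ 13.5 * K * √(|E| / l ^ 3) := by positivity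
    linarith

end ReflPhase
theorem continuous_intervalIntegral {E : Type*} [TopologicalSpace E] {φ : E → ℝ → ℂ}
    (h : Continuous φ.uncurry) (a b : ℝ) : Continuous fun p => ∫ x in a..b, φ p x :=
  intervalIntegral.continuous_parametric_intervalIntegral_of_continuous' h _ _

/-- Differentiation under a triple integral. -/
theorem hasDerivAt_tripleIntegral {f g : ℝ → ℝ} (hf : Continuous f) (hg : Continuous g)
    {φ φ' : ℝ → ℝ → ℝ → ℝ → ℂ}
    (hφ : Continuous fun p : ℝ × ℝ × ℝ × ℝ => φ p.1 p.2.1 p.2.2.1 p.2.2.2)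
    (hφ' : Continuous fun p : ℝ × ℝ × ℝ × ℝ => φ' p.1 p.2.1 p.2.2.1 p.2.2.2)
    (hd : ∀ w S U ρ, HasDerivAt (fun w => φ w S U ρ) (φ' w S U ρ) w) (a b a' b' w : ℝ) :
    HasDerivAt (fun w => ∫ S in a..b, (f S : ℂ) * ∫ U in a..b, (g U : ℂ) *
      ∫ ρ in a'..b', φ w S U ρ)
      (∫ S in a..b, (f S : ℂ) * ∫ U in a..b, (g U : ℂ) * ∫ ρ in a'..b', φ' w S U ρ) w := by
  have c1 : ∀ {φ : ℝ → ℝ → ℝ → ℝ → ℂ},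
      (Continuous fun p : ℝ × ℝ × ℝ × ℝ => φ p.1 p.2.1 p.2.2.1 p.2.2.2) →
      Continuous fun p : ℝ × ℝ × ℝ => ∫ ρ in a'..b', φ p.1 p.2.1 p.2.2 ρ := fun {φ} h =>
    continuous_intervalIntegral (φ := fun (p : ℝ × ℝ × ℝ) ρ => φ p.1 p.2.1 p.2.2 ρ) (by
      exact h.comp (f := fun q : (ℝ × ℝ × ℝ) × ℝ => (q.1.1, q.1.2.1, q.1.2.2, q.2)) (by fun_prop)) _ _
  have c2 : ∀ {φ : ℝ → ℝ → ℝ → ℝ → ℂ},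
      (Continuous fun p : ℝ × ℝ × ℝ × ℝ => φ p.1 p.2.1 p.2.2.1 p.2.2.2) →
      Continuous fun p : ℝ × ℝ => ∫ U in a..b, (g U : ℂ) * ∫ ρ in a'..b', φ p.1 p.2 U ρ :=
    fun {φ} h => continuous_intervalIntegral
      (φ := fun (p : ℝ × ℝ) U => (g U : ℂ) * ∫ ρ in a'..b', φ p.1 p.2 U ρ) (by
      have := (c1 h).comp (f := fun q : (ℝ × ℝ) × ℝ => (q.1.1, q.1.2, q.2)) (by fun_prop)
      simp only [Function.comp_def] at this
      simp only [Function.uncurry_def]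
      fun_prop) _ _
  refine hasDerivAt_intervalIntegral
    (F := fun w S => (f S : ℂ) * ∫ U in a..b, (g U : ℂ) * ∫ ρ in a'..b', φ w S U ρ)
    (F' := fun w S => (f S : ℂ) * ∫ U in a..b, (g U : ℂ) * ∫ ρ in a'..b', φ' w S U ρ)
    ?_ ?_ (fun w S => ?_) _ _ w
  · have := c2 hφ
    simp only [Function.uncurry_def]; fun_prop
  · have := c2 hφ'
    simp only [Function.uncurry_def]; fun_prop
  refine HasDerivAt.const_mul _ (hasDerivAt_intervalIntegral
    (F := fun w U => (g U : ℂ) * ∫ ρ in a'..b', φ w S U ρ)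
    (F' := fun w U => (g U : ℂ) * ∫ ρ in a'..b', φ' w S U ρ) ?_ ?_ (fun w U => ?_) _ _ w)
  · have := (c1 hφ).comp (f := fun q : ℝ × ℝ => (q.1, S, q.2)) (by fun_prop)
    simp only [Function.comp_def] at this
    simp only [Function.uncurry_def]; fun_prop
  · have := (c1 hφ').comp (f := fun q : ℝ × ℝ => (q.1, S, q.2)) (by fun_prop)
    simp only [Function.comp_def] at this
    simp only [Function.uncurry_def]; fun_prop
  refine HasDerivAt.const_mul _ (hasDerivAt_intervalIntegral (F := fun w ρ => φ w S U ρ)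
    (F' := fun w ρ => φ' w S U ρ) ?_ ?_ (fun w ρ => hd w S U ρ) _ _ w)
  · exact hφ.comp (f := fun q : ℝ × ℝ => (q.1, S, U, q.2)) (by fun_prop)
  · exact hφ'.comp (f := fun q : ℝ × ℝ => (q.1, S, U, q.2)) (by fun_prop)

theorem airyInt_add {f : ℝ → ℝ} (hf : Continuous f) (p α : ℝ) {F G : ℝ → ℂ} (hF : Continuous F)
    (hG : Continuous G) (z : ℝ) :
    airyInt f p α (fun x => F x + G x) z = airyInt f p α F z + airyInt f p α G z := by
  rw [airyInt, airyInt, airyInt, ← intervalIntegral.integral_add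
    (Continuous.intervalIntegrable (by fun_prop) _ _)
    (Continuous.intervalIntegrable (by fun_prop) _ _)]
  congr 1; ext x; ring

theorem integral_mul_cubic {f : ℝ → ℝ} (hf : Continuous f) (p α : ℝ) {F G : ℝ → ℂ}
    (hF : Continuous F) (hG : Continuous G) (z : ℝ) (b c : ℂ) :
    ∫ x in (-(3/2))..(3/2), (f x : ℂ) * (F (z + α * (x ^ 3 / 3 + p * x)) +
      (b * x ^ 3 + c * x) * G (z + α * (x ^ 3 / 3 + p * x))) =
    airyInt f p α F z + b * airyInt (fun x => f x * x ^ 3) p α G z +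
      c * airyInt (fun x => f x * x) p α G z := by
  rw [airyInt, airyInt, airyInt, ← intervalIntegral.integral_const_mul,
    ← intervalIntegral.integral_const_mul, ← intervalIntegral.integral_add
    (Continuous.intervalIntegrable (by fun_prop) _ _)
    (Continuous.intervalIntegrable (by fun_prop) _ _), ← intervalIntegral.integral_add
    (Continuous.intervalIntegrable (by fun_prop) _ _)
    (Continuous.intervalIntegrable (by fun_prop) _ _)]
  congr 1; ext x; push_cast; ring

/-- The integral over `S`, `Υ` and the rescaled frequency, as a function of `w = log A`; here
`α = A^{-3/2}` and `ζ` stands for `Y + T (A - 1) / (√(1 + γ A) + √(1 + γ))`. -/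
noncomputable def innerInt (D : ℝ → ℂ) (l X κ : ℝ) (ζ : ℝ → ℝ) (f g u : ℝ → ℝ) (w : ℝ) : ℂ :=
  airyInt f (κ - Real.exp w) (Real.exp (-(3/2) * w))
    (airyInt g (X - Real.exp w) (Real.exp (-(3/2) * w)) (freqInt D l (Real.exp (-(3/2) * w)) u))
    (Real.exp (-(3/2) * w) * ζ w)

/-- The phase derivative with respect to `ρ` of `innerInt`, up to the factor `l`. -/
noncomputable def innerPhase (X κ : ℝ) (ζ : ℝ → ℝ) (w S U : ℝ) : ℝ :=
  Real.exp (-(3/2) * w) * ζ w + Real.exp (-(3/2) * w) * (S ^ 3 / 3 + (κ - Real.exp w) * S) +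
    Real.exp (-(3/2) * w) * (U ^ 3 / 3 + (X - Real.exp w) * U)

theorem innerInt_eq (D : ℝ → ℂ) (l X κ : ℝ) (ζ : ℝ → ℝ) (f g u : ℝ → ℝ) (w : ℝ) :
    innerInt D l X κ ζ f g u w = ∫ S in (-(3/2))..(3/2), (f S : ℂ) *
      ∫ U in (-(3/2))..(3/2), (g U : ℂ) *
      ∫ ρ in (1/8 : ℝ)..3, (u (Real.exp (-(3/2) * w) * ρ) : ℂ) * D ρ *
        Complex.exp (I * (l * ρ * innerPhase X κ ζ w S U : ℝ)) := rfl

/-- The remainder terms in the derivative of `innerInt`. -/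
noncomputable def innerRem (D : ℝ → ℂ) (l X κ : ℝ) (ζ : ℝ → ℝ) (f g u : ℝ → ℝ) (w : ℝ) : ℂ :=
  ((-(1/2) : ℝ) : ℂ) * innerInt D l X κ ζ f (fun x => g x * x ^ 3) u w +
  ((-(3/2) * X + 1/2 * Real.exp w : ℝ) : ℂ) * innerInt D l X κ ζ f (fun x => g x * x) u w +
  ((-(1/2) : ℝ) : ℂ) * innerInt D l X κ ζ (fun x => f x * x ^ 3) g u w +
  ((-(3/2) * κ + 1/2 * Real.exp w : ℝ) : ℂ) * innerInt D l X κ ζ (fun x => f x * x) g u w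

theorem continuous_innerInt {D : ℝ → ℂ} (hD : Continuous D) (l X κ : ℝ) {ζ : ℝ → ℝ}
    (hζ : Continuous ζ) {f g u : ℝ → ℝ} (hf : Continuous f) (hg : Continuous g)
    (hu : Continuous u) : Continuous (innerInt D l X κ ζ f g u) := by
  simp only [funext (innerInt_eq D l X κ ζ f g u)]
  have c0 : Continuous fun p : ℝ × ℝ × ℝ × ℝ => (u (Real.exp (-(3/2) * p.1) * p.2.2.2) : ℂ) *
      D p.2.2.2 * Complex.exp (I * (l * p.2.2.2 * innerPhase X κ ζ p.1 p.2.1 p.2.2.1 : ℝ)) := by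
    unfold innerPhase; fun_prop
  have c1 : Continuous fun p : ℝ × ℝ × ℝ => ∫ ρ in (1/8 : ℝ)..3,
      (u (Real.exp (-(3/2) * p.1) * ρ) : ℂ) * D ρ *
        Complex.exp (I * (l * ρ * innerPhase X κ ζ p.1 p.2.1 p.2.2 : ℝ)) :=
    continuous_intervalIntegral (φ := fun (p : ℝ × ℝ × ℝ) ρ =>
      (u (Real.exp (-(3/2) * p.1) * ρ) : ℂ) * D ρ *
        Complex.exp (I * (l * ρ * innerPhase X κ ζ p.1 p.2.1 p.2.2 : ℝ)))
      (c0.comp (f := fun q : (ℝ × ℝ × ℝ) × ℝ => (q.1.1, q.1.2.1, q.1.2.2, q.2)) (by fun_prop)) _ _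
  have c2 : Continuous fun p : ℝ × ℝ => ∫ U in (-(3/2))..(3/2), (g U : ℂ) *
      ∫ ρ in (1/8 : ℝ)..3, (u (Real.exp (-(3/2) * p.1) * ρ) : ℂ) * D ρ *
        Complex.exp (I * (l * ρ * innerPhase X κ ζ p.1 p.2 U : ℝ)) := by
    refine continuous_intervalIntegral (φ := fun (p : ℝ × ℝ) U => (g U : ℂ) *
      ∫ ρ in (1/8 : ℝ)..3, (u (Real.exp (-(3/2) * p.1) * ρ) : ℂ) * D ρ *
        Complex.exp (I * (l * ρ * innerPhase X κ ζ p.1 p.2 U : ℝ))) ?_ _ _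
    have := c1.comp (f := fun q : (ℝ × ℝ) × ℝ => (q.1.1, q.1.2, q.2)) (by fun_prop)
    simp only [Function.comp_def] at this
    simp only [Function.uncurry_def]
    fun_prop
  refine continuous_intervalIntegral (φ := fun w S => (f S : ℂ) *
    ∫ U in (-(3/2))..(3/2), (g U : ℂ) *
      ∫ ρ in (1/8 : ℝ)..3, (u (Real.exp (-(3/2) * w) * ρ) : ℂ) * D ρ *
        Complex.exp (I * (l * ρ * innerPhase X κ ζ w S U : ℝ))) ?_ _ _
  simp only [Function.uncurry_def]
  fun_prop

theorem hasDerivAt_innerInt {D : ℝ → ℂ} (hD : Continuous D) (l X κ : ℝ) {ζ ζ' : ℝ → ℝ}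
    (hζ : ∀ w, HasDerivAt ζ (ζ' w) w) (hζ' : Continuous ζ') {f g u u₁ : ℝ → ℝ}
    (hf : Continuous f) (hg : Continuous g) (hu₁ : ContDiff ℝ (⊤ : ℕ∞) u₁)
    (h : ∀ x, x * u₁ x = u x) (w : ℝ) :
    HasDerivAt (innerInt D l X κ ζ f g u₁)
      (-(3/2) * innerInt D l X κ ζ f g (fun x => x * deriv u₁ x) w -
        I * l / 2 * (3 * ζ w - 2 * ζ' w : ℝ) * innerInt D l X κ ζ f g u w +
        I * l * innerRem D l X κ ζ f g u w) w := by
  have cζ : Continuous ζ := continuous_iff_continuousAt.2 fun z => (hζ z).continuousAt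
  have cu₁ := hu₁.continuous
  have cdu₁ := (Amp.smooth_deriv hu₁).continuous
  have cu : Continuous u := by
    have : u = fun x => x * u₁ x := funext fun x => (h x).symm
    rw [this]; fun_prop
  rw [funext (innerInt_eq D l X κ ζ f g u₁)]
  have hα : ∀ w : ℝ, HasDerivAt (fun w => Real.exp (-(3/2) * w))
      (-(3/2) * Real.exp (-(3/2) * w)) w := fun w => by
    have : HasDerivAt (fun w : ℝ => -(3/2) * w) (-(3/2)) w := by
      simpa using (hasDerivAt_id w).const_mul (-(3/2) : ℝ)
    exact this.exp.congr_deriv (by ring)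
  have hA : ∀ (p w S : ℝ), HasDerivAt (fun w => S ^ 3 / 3 + (p - Real.exp w) * S)
      (-Real.exp w * S) w := fun p w S => by
    exact (((Real.hasDerivAt_exp w).const_sub p).mul_const S).const_add _
  have hE : ∀ w S U : ℝ, HasDerivAt (fun w => innerPhase X κ ζ w S U)
      (Real.exp (-(3/2) * w) * (-(1/2) * (3 * ζ w - 2 * ζ' w) - 1/2 * U ^ 3 +
        (-(3/2) * X + 1/2 * Real.exp w) * U - 1/2 * S ^ 3 +
        (-(3/2) * κ + 1/2 * Real.exp w) * S)) w := fun w S U => by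
    refine ((((hα w).mul (hζ w)).add ((hα w).mul (hA κ w S))).add
      ((hα w).mul (hA X w U))).congr_deriv ?_
    ring
  have key := hasDerivAt_tripleIntegral hf hg
    (φ := fun w S U ρ => (u₁ (Real.exp (-(3/2) * w) * ρ) : ℂ) * D ρ *
        Complex.exp (I * (l * ρ * innerPhase X κ ζ w S U : ℝ)))
    (φ' := fun w S U ρ => (((-(3/2) * Real.exp (-(3/2) * w) * ρ) *
        deriv u₁ (Real.exp (-(3/2) * w) * ρ) : ℝ) : ℂ) * D ρ *
        Complex.exp (I * (l * ρ * innerPhase X κ ζ w S U : ℝ)) +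
        (u₁ (Real.exp (-(3/2) * w) * ρ) : ℂ) * D ρ *
        (Complex.exp (I * (l * ρ * innerPhase X κ ζ w S U : ℝ)) * (I * (l * ρ *
        (Real.exp (-(3/2) * w) * (-(1/2) * (3 * ζ w - 2 * ζ' w) - 1/2 * U ^ 3 +
        (-(3/2) * X + 1/2 * Real.exp w) * U - 1/2 * S ^ 3 +
        (-(3/2) * κ + 1/2 * Real.exp w) * S)) : ℝ)))) ?_ ?_ ?_ (-(3/2)) (3/2) (1/8) 3 w
  · refine key.congr_deriv ?_
    set α := Real.exp (-(3/2) * w) with hαd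
    set Fa := freqInt D l α (fun x => x * deriv u₁ x) with hFa
    set Fu := freqInt D l α u with hFu
    have cFa : Continuous Fa := continuous_freqInt hD l α (by fun_prop)
    have cFu : Continuous Fu := continuous_freqInt hD l α cu
    have inner : ∀ S U : ℝ, (∫ ρ in (1/8 : ℝ)..3, (((((-(3/2) * α * ρ) *
        deriv u₁ (α * ρ) : ℝ) : ℂ) * D ρ *
        Complex.exp (I * (l * ρ * innerPhase X κ ζ w S U : ℝ)) +
        (u₁ (α * ρ) : ℂ) * D ρ *
        (Complex.exp (I * (l * ρ * innerPhase X κ ζ w S U : ℝ)) * (I * (l * ρ *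
        (α * (-(1/2) * (3 * ζ w - 2 * ζ' w) - 1/2 * U ^ 3 +
        (-(3/2) * X + 1/2 * Real.exp w) * U - 1/2 * S ^ 3 +
        (-(3/2) * κ + 1/2 * Real.exp w) * S)) : ℝ)))))) =
        -(3/2) * Fa (innerPhase X κ ζ w S U) + I * l * ((-(1/2) * (3 * ζ w - 2 * ζ' w) -
          1/2 * U ^ 3 + (-(3/2) * X + 1/2 * Real.exp w) * U - 1/2 * S ^ 3 +
        (-(3/2) * κ + 1/2 * Real.exp w) * S : ℝ) : ℂ) * Fu (innerPhase X κ ζ w S U) := by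
      intro S U
      rw [hFa, hFu, freqInt, freqInt, ← intervalIntegral.integral_const_mul,
        ← intervalIntegral.integral_const_mul, ← intervalIntegral.integral_add
        (Continuous.intervalIntegrable (by fun_prop) _ _)
        (Continuous.intervalIntegrable (by fun_prop) _ _)]
      congr 1; ext ρ
      rw [← h (α * ρ)]
      push_cast
      ring
    simp only [inner]
    set c₀ : ℂ := I * l * ((-(1/2) * (3 * ζ w - 2 * ζ' w) : ℝ) : ℂ) with hc₀
    set b : ℂ := I * l * ((-(1/2) : ℝ) : ℂ) with hb
    set cU : ℂ := I * l * ((-(3/2) * X + 1/2 * Real.exp w : ℝ) : ℂ) with hcU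
    set cS : ℂ := I * l * ((-(3/2) * κ + 1/2 * Real.exp w : ℝ) : ℂ) with hcS
    set q := X - Real.exp w with hq
    have mid : ∀ S : ℝ, (∫ U in (-(3/2) : ℝ)..(3/2), (g U : ℂ) *
        (-(3/2) * Fa (innerPhase X κ ζ w S U) + I * l * ((-(1/2) * (3 * ζ w - 2 * ζ' w) -
          1/2 * U ^ 3 + (-(3/2) * X + 1/2 * Real.exp w) * U - 1/2 * S ^ 3 +
        (-(3/2) * κ + 1/2 * Real.exp w) * S : ℝ) : ℂ) * Fu (innerPhase X κ ζ w S U))) =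
        (-(3/2) * airyInt g q α Fa (α * ζ w + α * (S ^ 3 / 3 + (κ - Real.exp w) * S)) +
        (c₀ * airyInt g q α Fu (α * ζ w + α * (S ^ 3 / 3 + (κ - Real.exp w) * S)) +
        (b * airyInt (fun x => g x * x ^ 3) q α Fu
          (α * ζ w + α * (S ^ 3 / 3 + (κ - Real.exp w) * S)) +
        cU * airyInt (fun x => g x * x) q α Fu
          (α * ζ w + α * (S ^ 3 / 3 + (κ - Real.exp w) * S))))) +
        (b * S ^ 3 + cS * S) *
        airyInt g q α Fu (α * ζ w + α * (S ^ 3 / 3 + (κ - Real.exp w) * S)) := by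
      intro S
      set z := α * ζ w + α * (S ^ 3 / 3 + (κ - Real.exp w) * S) with hz
      have := integral_mul_cubic hg q α (F := fun y => -(3/2) * Fa y +
        (c₀ + (b * S ^ 3 + cS * S)) * Fu y) (by fun_prop) cFu z b cU
      rw [airyInt_add hg q α (F := fun y => -(3/2) * Fa y) (G := fun y =>
        (c₀ + (b * S ^ 3 + cS * S)) * Fu y) (by fun_prop) (by fun_prop), airyInt_const_mul,
        airyInt_const_mul] at this
      trans (-(3/2) * airyInt g q α Fa z + (c₀ + (b * S ^ 3 + cS * S)) * airyInt g q α Fu z +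
        b * airyInt (fun x => g x * x ^ 3) q α Fu z + cU * airyInt (fun x => g x * x) q α Fu z)
      · rw [← this]
        congr 1; ext U
        have e : innerPhase X κ ζ w S U = z + α * (U ^ 3 / 3 + q * U) := by
          rw [innerPhase]
        rw [e, hc₀, hb, hcU, hcS]
        push_cast
        ring
      · ring
    simp only [mid]
    have cGa := continuous_airyInt hg q α cFa
    have cGu := continuous_airyInt hg q α cFu
    have cG3 := continuous_airyInt (f := fun x => g x * x ^ 3) (by fun_prop) q α cFu
    have cG1 := continuous_airyInt (f := fun x => g x * x) (by fun_prop) q α cFu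
    rw [integral_mul_cubic hf (κ - Real.exp w) α (F := fun y => -(3/2) * airyInt g q α Fa y +
        (c₀ * airyInt g q α Fu y + (b * airyInt (fun x => g x * x ^ 3) q α Fu y +
        cU * airyInt (fun x => g x * x) q α Fu y))) (by fun_prop) cGu (α * ζ w) b cS,
      airyInt_add hf _ α (F := fun y => -(3/2) * airyInt g q α Fa y) (G := fun y =>
        (c₀ * airyInt g q α Fu y + (b * airyInt (fun x => g x * x ^ 3) q α Fu y +
        cU * airyInt (fun x => g x * x) q α Fu y))) (by fun_prop) (by fun_prop),
      airyInt_add hf _ α (F := fun y => c₀ * airyInt g q α Fu y) (G := fun y =>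
        (b * airyInt (fun x => g x * x ^ 3) q α Fu y +
        cU * airyInt (fun x => g x * x) q α Fu y)) (by fun_prop) (by fun_prop),
      airyInt_add hf _ α (F := fun y => b * airyInt (fun x => g x * x ^ 3) q α Fu y) (G := fun y =>
        cU * airyInt (fun x => g x * x) q α Fu y) (by fun_prop) (by fun_prop),
      airyInt_const_mul, airyInt_const_mul, airyInt_const_mul, airyInt_const_mul]
    simp only [innerRem, innerInt]
    rw [hc₀, hb, hcU, hcS]
    push_cast
    ring
  · unfold innerPhase; fun_prop
  · unfold innerPhase; fun_prop
  · intro w S U ρ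
    have d1 : HasDerivAt (fun w => u₁ (Real.exp (-(3/2) * w) * ρ))
        ((-(3/2) * Real.exp (-(3/2) * w) * ρ) * deriv u₁ (Real.exp (-(3/2) * w) * ρ)) w := by
      have e1 : HasDerivAt u₁ (deriv u₁ (Real.exp (-(3/2) * w) * ρ)) (Real.exp (-(3/2) * w) * ρ) :=
        (hu₁.differentiable (by simp) _).hasDerivAt
      exact (e1.comp w ((hα w).mul_const ρ)).congr_deriv (by ring)
    have d2 := (((hE w S U).const_mul (l * ρ)).ofReal_comp.const_mul I).cexp
    exact ((d1.ofReal_comp.mul_const (D ρ)).mul d2)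

namespace Amp

variable {u : ℝ → ℝ}

theorem smooth_div_pow (hu : ContDiff ℝ (⊤ : ℕ∞) u) (hs : tsupport u ⊆ Set.Icc (1/2 : ℝ) (3/2))
    (j : ℕ) : ContDiff ℝ (⊤ : ℕ∞) (fun x => u x / x ^ j) ∧
      tsupport (fun x => u x / x ^ j) ⊆ Set.Icc (1/2 : ℝ) (3/2) := by
  induction j with
  | zero =>
    simp only [pow_zero, div_one]
    exact ⟨hu, hs⟩
  | succ j ih =>
    have e : (fun x => u x / x ^ (j + 1)) = fun x => u x / x ^ j / x := by
      ext x; rw [pow_succ, div_div]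
    rw [e]
    exact ⟨smooth_div_id ih.1 ih.2, supp_div_id ih.2⟩

theorem mul_div_pow_succ (hs : tsupport u ⊆ Set.Icc (1/2 : ℝ) (3/2)) (j : ℕ) (x : ℝ) :
    x * (u x / x ^ (j + 1)) = u x / x ^ j := by
  rcases eq_or_ne x 0 with rfl | hx
  · rw [eq_zero_of_lt hs (Or.inl (by norm_num))]; simp
  · field_simp
    ring

end Amp

/-- Amplitudes all of whose quotients `u / xʲ`, `j ≤ k`, satisfy uniform bounds. -/
structure AmpFamily (k : ℕ) (K : ℝ) (u : ℝ → ℝ) : Prop where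
  smooth : ContDiff ℝ (⊤ : ℕ∞) u
  supp : tsupport u ⊆ Set.Icc (1/2 : ℝ) (3/2)
  amp : ∀ j ≤ k, Amp K (fun x => u x / x ^ j)

theorem exists_ampFamily (k : ℕ) {u : ℝ → ℝ} (hu : ContDiff ℝ (⊤ : ℕ∞) u)
    (hs : tsupport u ⊆ Set.Icc (1/2 : ℝ) (3/2)) : ∃ K₀, ∀ K, K₀ ≤ K → AmpFamily k K u := by
  choose B hB using fun j => Amp.exists_of_smooth (Amp.smooth_div_pow hu hs j).1
    (Amp.smooth_div_pow hu hs j).2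
  refine ⟨∑ j ∈ Finset.range (k + 1), B j, fun K hK => ⟨hu, hs, fun j hj => (hB j).mono
    (le_trans ?_ hK)⟩⟩
  exact Finset.single_le_sum (f := B) (fun i _ => (hB i).nonneg) (Finset.mem_range.2 (by omega))

/-- Cutoffs bounded together with their derivative on `[-3/2, 3/2]`. -/
structure Cutoff (K : ℝ) (f : ℝ → ℝ) : Prop where
  smooth : ContDiff ℝ (⊤ : ℕ∞) f
  bound : ∀ x ∈ Set.Icc (-(3/2) : ℝ) (3/2), |f x| ≤ K
  bound_deriv : ∀ x ∈ Set.Icc (-(3/2) : ℝ) (3/2), |deriv f x| ≤ K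

theorem exists_cutoff {f : ℝ → ℝ} (hf : ContDiff ℝ (⊤ : ℕ∞) f) :
    ∃ K₀, ∀ K, K₀ ≤ K → Cutoff K f := by
  obtain ⟨K₁, h₁⟩ := (isCompact_Icc (a := (-(3/2) : ℝ)) (b := 3/2)).exists_bound_of_continuousOn
    hf.continuous.continuousOn
  obtain ⟨K₂, h₂⟩ := (isCompact_Icc (a := (-(3/2) : ℝ)) (b := 3/2)).exists_bound_of_continuousOn
    (Amp.smooth_deriv hf).continuous.continuousOn
  exact ⟨max K₁ K₂, fun K hK => ⟨hf, fun x hx => (h₁ x hx).trans ((le_max_left _ _).trans hK),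
    fun x hx => (h₂ x hx).trans ((le_max_right _ _).trans hK)⟩⟩

theorem Cutoff.hasDerivAt {K : ℝ} {f : ℝ → ℝ} (h : Cutoff K f) (x : ℝ) :
    HasDerivAt f (deriv f x) x := (h.smooth.differentiable (by simp) _).hasDerivAt

theorem Cutoff.nonneg {K : ℝ} {f : ℝ → ℝ} (h : Cutoff K f) : 0 ≤ K :=
  (abs_nonneg _).trans (h.bound 0 (by norm_num))

theorem exp_neg_mul_mem {w : ℝ} (hw : Real.exp w ∈ Set.Icc (1/2 : ℝ) (3/2)) :
    Real.exp (-(3/2) * w) ∈ Set.Icc (27/50 : ℝ) (29/10) := by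
  set x := Real.exp (-(3/2) * w) with hx
  have h0 : 0 < x := Real.exp_pos _
  have hA : 0 < Real.exp w := Real.exp_pos _
  have h : x ^ 2 * Real.exp w ^ 3 = 1 := by
    rw [hx, ← Real.exp_nat_mul, ← Real.exp_nat_mul, ← Real.exp_add]
    rw [← Real.exp_zero]; congr 1; push_cast; ring
  have h3l : (1/2 : ℝ) ^ 3 ≤ Real.exp w ^ 3 := by gcongr; exact hw.1
  have h3u : Real.exp w ^ 3 ≤ (3/2 : ℝ) ^ 3 := by gcongr; exact hw.2
  constructor
  · by_contra hcon
    push Not at hcon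
    have : x ^ 2 < (27/50) ^ 2 := by gcongr
    nlinarith
  · by_contra hcon
    push Not at hcon
    have : (29/10 : ℝ) ^ 2 < x ^ 2 := by gcongr
    nlinarith

/-- Antiderivatives of `freqInt`. -/
theorem hasDerivAt_const_mul_freqInt {D : ℝ → ℂ} (hD : Continuous D) {l : ℝ} (hl : 0 < l) {α : ℝ}
    (hα : 0 < α) {u u₁ : ℝ → ℝ} (hu₁ : Continuous u₁) (h : ∀ x, x * u₁ x = u x) (E : ℝ) :
    HasDerivAt (fun E => α / (I * l) * freqInt D l α u₁ E) (freqInt D l α u E) E := by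
  refine ((hasDerivAt_freqInt hD l hα.ne' hu₁ h E).const_mul _).congr_deriv ?_
  have h1 : (α : ℂ) ≠ 0 := by exact_mod_cast hα.ne'
  have h2 : (l : ℂ) ≠ 0 := by exact_mod_cast hl.ne'
  field_simp [I_ne_zero]

theorem norm_div_I_mul {l α : ℝ} (hl : 0 < l) (hα : 0 < α) : ‖(α : ℂ) / (I * l)‖ = α / l := by
  rw [norm_div, norm_mul, norm_I, one_mul, norm_real, norm_real, Real.norm_eq_abs, Real.norm_eq_abs,
    abs_of_pos hα, abs_of_pos hl]

/-- Van der Corput estimate for the integral over `S` and `Υ`. -/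
theorem norm_innerInt_le {D : ℝ → ℂ} (hD : Continuous D) {l X κ : ℝ} (hl : 0 < l) (hκ : κ ≤ 1/4)
    {ζ : ℝ → ℝ} {K K' M w : ℝ} {f g u : ℝ → ℝ} (hf : Cutoff K f) (hg : Cutoff K g)
    (hu : AmpFamily 2 K' u) (hw : Real.exp w ∈ Set.Icc (1/2 : ℝ) (3/2))
    (hM : ∀ v, Amp K' v → ∀ S ∈ Set.Icc (-(3/2) : ℝ) (3/2), ∀ U ∈ Set.Icc (-(3/2) : ℝ) (3/2),
      ‖freqInt D l (Real.exp (-(3/2) * w)) v (innerPhase X κ ζ w S U)‖ ≤ M) :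
    ‖innerInt D l X κ ζ f g u w‖ ≤ 5460 * K ^ 2 * M * l ^ (-(5/6) : ℝ) := by
  have hαm := exp_neg_mul_mem hw
  set α := Real.exp (-(3/2) * w) with hα
  have hα0 : 0 < α := Real.exp_pos _
  have hα2 : 1/2 ≤ α := by linarith [hαm.1]
  have hα3 : α ≤ 3 := by linarith [hαm.2]
  have hK := hf.nonneg
  have hM0 : 0 ≤ M := (norm_nonneg _).trans (hM _ (hu.amp 0 (by norm_num)) 0 (by norm_num) 0
    (by norm_num))
  set v : ℕ → ℝ → ℝ := fun j x => u x / x ^ j with hv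
  have hvs : ∀ j, v j = fun x => u x / x ^ j := fun j => rfl
  have cv : ∀ j, Continuous (v j) := fun j => (Amp.smooth_div_pow hu.smooth hu.supp j).1.continuous
  have hv0 : v 0 = u := by ext x; simp [hv]
  have mulv : ∀ j x, x * v (j + 1) x = v j x := fun j x => Amp.mul_div_pow_succ hu.supp j x
  have hΛ : 0 < l / 3 := by positivity
  have cF : ∀ j, Continuous (freqInt D l α (v j)) := fun j => continuous_freqInt hD l α (cv j)
  have hc : ∀ x : ℂ, ‖(α : ℂ) / (I * l) * x‖ ≤ ‖x‖ / (l / 3) := fun x => by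
    rw [norm_mul, norm_div_I_mul hl hα0, div_mul_eq_mul_div, div_div_eq_mul_div, mul_comm]
    gcongr
  -- the integral over `Υ`
  have hin : ∀ j ≤ 1, ∀ S ∈ Set.Icc (-(3/2) : ℝ) (3/2),
      ‖airyInt g (X - Real.exp w) α (freqInt D l α (v j))
        (α * ζ w + α * (S ^ 3 / 3 + (κ - Real.exp w) * S))‖ ≤
        26 * K * M * (l / 3) ^ (-(1/3) : ℝ) := fun j hj S hS =>
    norm_airyInt_le_third hg.hasDerivAt (Amp.smooth_deriv hg.smooth).continuous hg.bound
      hg.bound_deriv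
      (hasDerivAt_const_mul_freqInt hD hl hα0 (cv (j + 1)) (mulv j)) (cF j) hα2 hΛ
      (fun U hU => hM _ (hu.amp j (by omega)) S hS U hU)
      (fun U hU => (hc _).trans (div_le_div_of_nonneg_right
        (hM _ (hu.amp (j + 1) (by omega)) S hS U hU) hΛ.le))
  have hout := norm_airyInt_le_half (z := α * ζ w) hf.hasDerivAt
    (Amp.smooth_deriv hf.smooth).continuous
    hf.bound hf.bound_deriv
    (F := airyInt g (X - Real.exp w) α (freqInt D l α (v 0)))
    (F₁ := fun z => α / (I * l) * airyInt g (X - Real.exp w) α (freqInt D l α (v 1)) z)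
    (p := κ - Real.exp w) (α := α) (M := 26 * K * M * (l / 3) ^ (-(1/3) : ℝ)) (fun y => ?_)
    (continuous_airyInt hg.smooth.continuous _ _ (cF 0)) hα2 hΛ (by linarith [hw.1])
    (hin 0 (by norm_num)) (fun S hS => (hc _).trans (div_le_div_of_nonneg_right
      (hin 1 le_rfl S hS) hΛ.le))
  · rw [hv0] at hout
    refine hout.trans ?_
    have e1 : (l / 3) ^ (-(1/3) : ℝ) * (l / 3) ^ (-(1/2) : ℝ) = (l / 3) ^ (-(5/6) : ℝ) := by
      rw [← Real.rpow_add hΛ]; norm_num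
    have e2 : (l / 3) ^ (-(5/6) : ℝ) ≤ 3 * l ^ (-(5/6) : ℝ) := by
      rw [Real.div_rpow hl.le (by norm_num), div_le_iff₀ (by positivity)]
      have : (3:ℝ) * 3 ^ (-(5/6) : ℝ) = 3 ^ (1/6 : ℝ) := by
        nth_rw 1 [← Real.rpow_one 3]
        rw [← Real.rpow_add (by norm_num)]; norm_num
      have h1 : (1:ℝ) ≤ 3 ^ (1/6 : ℝ) := Real.one_le_rpow (by norm_num) (by norm_num)
      have h2 : 0 ≤ l ^ (-(5/6) : ℝ) := by positivity
      calc l ^ (-(5/6) : ℝ) = l ^ (-(5/6) : ℝ) * 1 := (mul_one _).symm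
        _ ≤ l ^ (-(5/6) : ℝ) * (3 * 3 ^ (-(5/6) : ℝ)) := by rw [this]; gcongr
        _ = _ := by ring
    calc 70 * K * (26 * K * M * (l / 3) ^ (-(1/3) : ℝ)) * (l / 3) ^ (-(1/2) : ℝ) =
          1820 * K ^ 2 * M * ((l / 3) ^ (-(1/3) : ℝ) * (l / 3) ^ (-(1/2) : ℝ)) := by ring
      _ ≤ 1820 * K ^ 2 * M * (3 * l ^ (-(5/6) : ℝ)) := by rw [e1]; gcongr
      _ = _ := by ring
  · have := hasDerivAt_airyInt hg.smooth.continuous (X - Real.exp w) α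
      (hasDerivAt_const_mul_freqInt hD hl hα0 (cv 1) (mulv 0)) (cF 0) y
    refine this.congr_of_eventuallyEq (Eventually.of_forall fun z => ?_)
    simp only [airyInt_const_mul]

/-- Nonstationary estimate for `X ≥ 2`. -/
theorem exists_norm_innerInt_le_of_large (k : ℕ) {g : ℝ → ℝ} (hg : ContDiff ℝ (⊤ : ℕ∞) g)
    (hgs : tsupport g ⊆ Set.Ioo (-(3/2) : ℝ) (3/2)) : ∃ C, 0 ≤ C ∧
    ∀ {D : ℝ → ℂ}, Continuous D → ∀ {l X κ : ℝ}, 0 < l → 2 ≤ X →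
    ∀ {ζ : ℝ → ℝ} {K K' M w : ℝ} {f u : ℝ → ℝ}, Cutoff K f → AmpFamily k K' u →
    Real.exp w ∈ Set.Icc (1/2 : ℝ) (3/2) → (∀ ρ, ‖D ρ‖ ≤ M) →
    ‖innerInt D l X κ ζ f g u w‖ ≤ C * K * (K' * M) / l ^ k := by
  obtain ⟨C, hC⟩ := exists_norm_airyInt_le_of_nonstationary k hg hgs
  refine ⟨9 * |C| * 3 ^ k, by positivity,
    fun {D} hD {l X κ} hl hX {ζ K K' M w f u} hf hu hw hDM => ?_⟩
  have hαm := exp_neg_mul_mem hw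
  set α := Real.exp (-(3/2) * w) with hα
  have hα0 : 0 < α := Real.exp_pos _
  have hα3 : α ≤ 3 := by linarith [hαm.2]
  have hK := hf.nonneg
  have hM0 : 0 ≤ M := (norm_nonneg _).trans (hDM 0)
  have hK' : 0 ≤ K' := (hu.amp 0 (by omega)).nonneg
  have hv0 : (fun x => u x / x ^ 0) = u := by ext x; simp
  have hin : ∀ z, ‖airyInt g (X - Real.exp w) α (freqInt D l α u) z‖ ≤
      |C| * ((3 / l) ^ k * (3 * (K' * M))) := fun z => by
    have := hC (p := X - Real.exp w) (α := α) (z := z) (M := (3 / l) ^ k * (3 * (K' * M)))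
      (F := fun j E => (α / (I * l) : ℂ) ^ j * freqInt D l α (fun x => u x / x ^ j) E)
      (by linarith [hw.2]) (by linarith [hαm.1]) (fun j y => ?_) ?_ (fun y => ?_)
    · simp only [pow_zero, one_mul, div_one] at this
      refine this.trans ?_
      gcongr
      exact le_abs_self C
    · have := (hasDerivAt_const_mul_freqInt hD hl hα0
        (Amp.smooth_div_pow hu.smooth hu.supp (j + 1)).1.continuous
        (Amp.mul_div_pow_succ hu.supp j) y).const_mul ((α / (I * l) : ℂ) ^ j)
      refine this.congr_of_eventuallyEq (Eventually.of_forall fun z => ?_)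
      simp only [pow_succ]; ring
    · simp only [pow_zero, one_mul, div_one]
      exact continuous_freqInt hD l α hu.smooth.continuous
    · rw [norm_mul, norm_pow, norm_div_I_mul hl hα0]
      exact mul_le_mul (by gcongr) (norm_freqInt_le (hu.amp k le_rfl) hDM) (norm_nonneg _)
        (by positivity)
  refine (norm_airyInt_le (z := α * ζ w) hf.bound fun S _ => hin _).trans (le_of_eq ?_)
  rw [div_pow]
  ring

/-- `T (e^w - 1) / (√(1 + γ e^w) + √(1 + γ)) + Y`. -/
noncomputable def shift (γ T Y w : ℝ) : ℝ :=
  Y + T * ((Real.exp w - 1) / (√(1 + γ * Real.exp w) + √(1 + γ)))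

noncomputable def shift₁ (γ T w : ℝ) : ℝ := T * (Real.exp w / (2 * √(1 + γ * Real.exp w)))

noncomputable def slope (γ T Y w : ℝ) : ℝ := 3 * shift γ T Y w - 2 * shift₁ γ T w

noncomputable def slope₁ (γ T w : ℝ) : ℝ :=
  T * (Real.exp w / (2 * √(1 + γ * Real.exp w)) +
    γ * Real.exp w ^ 2 / (2 * √(1 + γ * Real.exp w) ^ 3))

theorem hasDerivAt_sqrt_exp {γ : ℝ} (hγ : 0 < γ) (w : ℝ) :
    HasDerivAt (fun w => √(1 + γ * Real.exp w))
      (γ * Real.exp w / (2 * √(1 + γ * Real.exp w))) w := by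
  have h : 0 < 1 + γ * Real.exp w := by positivity
  exact (((Real.hasDerivAt_exp w).const_mul γ).const_add 1).sqrt h.ne'

theorem hasDerivAt_shift {γ : ℝ} (hγ : 0 < γ) (T Y w : ℝ) :
    HasDerivAt (shift γ T Y) (shift₁ γ T w) w := by
  have e : shift γ T Y = fun w => Y + T * ((√(1 + γ * Real.exp w) - √(1 + γ)) / γ) := by
    ext w
    rw [shift]
    have h1 : 0 < √(1 + γ * Real.exp w) := Real.sqrt_pos.2 (by positivity)
    have h2 : 0 < √(1 + γ) := Real.sqrt_pos.2 (by positivity)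
    have s1 := Real.sq_sqrt (by positivity : 0 ≤ 1 + γ * Real.exp w)
    have s2 := Real.sq_sqrt (by positivity : 0 ≤ 1 + γ)
    congr 2
    rw [div_eq_div_iff (by positivity) hγ.ne']
    linear_combination s2 - s1
  rw [e]
  refine ((((hasDerivAt_sqrt_exp hγ w).sub_const _).div_const γ).const_mul T).const_add Y
    |>.congr_deriv ?_
  rw [shift₁]
  field_simp

theorem continuous_shift₁ {γ : ℝ} (hγ : 0 < γ) (T : ℝ) : Continuous (shift₁ γ T) := by
  unfold shift₁
  refine continuous_const.mul (Real.continuous_exp.div (by fun_prop) fun w => ?_)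
  have : 0 < √(1 + γ * Real.exp w) := Real.sqrt_pos.2 (by positivity)
  positivity

theorem hasDerivAt_slope {γ : ℝ} (hγ : 0 < γ) (T Y w : ℝ) :
    HasDerivAt (slope γ T Y) (slope₁ γ T w) w := by
  have hD : 0 < √(1 + γ * Real.exp w) := Real.sqrt_pos.2 (by positivity)
  have d1 : HasDerivAt (shift₁ γ T) (T * ((Real.exp w * (2 * √(1 + γ * Real.exp w)) -
      Real.exp w * (2 * (γ * Real.exp w / (2 * √(1 + γ * Real.exp w))))) /
      (2 * √(1 + γ * Real.exp w)) ^ 2)) w :=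
    ((Real.hasDerivAt_exp w).div ((hasDerivAt_sqrt_exp hγ w).const_mul 2)
      (by positivity)).const_mul T
  refine (((hasDerivAt_shift hγ T Y w).const_mul 3).sub (d1.const_mul 2)).congr_deriv ?_
  rw [shift₁, slope₁]
  field_simp
  ring

theorem continuous_slope₁ {γ : ℝ} (hγ : 0 < γ) (T : ℝ) : Continuous (slope₁ γ T) := by
  have h : ∀ w, 0 < √(1 + γ * Real.exp w) := fun w => Real.sqrt_pos.2 (by positivity)
  unfold slope₁
  refine continuous_const.mul ((Real.continuous_exp.div (by fun_prop) fun w => ?_).add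
    (Continuous.div (by fun_prop) (by fun_prop) fun w => ?_))
  · have := h w; positivity
  · have := h w; positivity

section Estimates

variable {γ T Y w : ℝ}

theorem sqrt_mem (hγ : 0 < γ) (hγ₁ : γ ≤ 1) (hw : Real.exp w ∈ Set.Icc (1/2 : ℝ) (3/2)) :
    1 ≤ √(1 + γ * Real.exp w) ∧ √(1 + γ * Real.exp w) ≤ 8/5 := by
  have hA := Real.exp_pos w
  constructor
  · rw [Real.one_le_sqrt]; nlinarith [mul_pos hγ hA]
  · rw [Real.sqrt_le_left (by norm_num)]
    nlinarith [hw.2]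

theorem shift₁_bounds (hγ : 0 < γ) (hγ₁ : γ ≤ 1) (hw : Real.exp w ∈ Set.Icc (1/2 : ℝ) (3/2)) :
    5/32 * |T| ≤ |shift₁ γ T w| ∧ |shift₁ γ T w| ≤ 3/4 * |T| := by
  obtain ⟨h1, h2⟩ := sqrt_mem hγ hγ₁ hw
  have hA := Real.exp_pos w
  have hD : 0 < √(1 + γ * Real.exp w) := by linarith
  have hQ : 0 < Real.exp w / (2 * √(1 + γ * Real.exp w)) := by positivity
  have h3 : 5/32 ≤ Real.exp w / (2 * √(1 + γ * Real.exp w)) := by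
    rw [le_div_iff₀ (by positivity)]; linarith [hw.1]
  have h4 : Real.exp w / (2 * √(1 + γ * Real.exp w)) ≤ 3/4 := by
    rw [div_le_iff₀ (by positivity)]; linarith [hw.2]
  rw [shift₁, abs_mul, abs_of_pos hQ, mul_comm |T|]
  exact ⟨mul_le_mul_of_nonneg_right h3 (abs_nonneg T),
    mul_le_mul_of_nonneg_right h4 (abs_nonneg T)⟩

theorem abs_shift_sub_le (hγ : 0 < γ) (hw : Real.exp w ∈ Set.Icc (1/2 : ℝ) (3/2)) :
    |shift γ T Y w - Y| ≤ 1/4 * |T| := by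
  have h1 : 1 ≤ √(1 + γ * Real.exp w) := by
    rw [Real.one_le_sqrt]; nlinarith [mul_pos hγ (Real.exp_pos w)]
  have h2 : 1 ≤ √(1 + γ) := by rw [Real.one_le_sqrt]; linarith
  have hA : |Real.exp w - 1| ≤ 1/2 := by rw [abs_le]; constructor <;> linarith [hw.1, hw.2]
  rw [shift, add_sub_cancel_left, abs_mul, mul_comm, abs_div,
    abs_of_pos (by positivity : 0 < √(1 + γ * Real.exp w) + √(1 + γ))]
  refine mul_le_mul_of_nonneg_right ?_ (abs_nonneg T)
  rw [div_le_iff₀ (by positivity)]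
  linarith

theorem abs_mul_slope₁_ge (hγ : 0 < γ) (hγ₁ : γ ≤ 1) (hw : Real.exp w ∈ Set.Icc (1/2 : ℝ) (3/2))
    {σ : ℝ} (hσ : σ * T = |T|) : |T| / 8 ≤ σ * slope₁ γ T w := by
  obtain ⟨h1, h2⟩ := sqrt_mem hγ hγ₁ hw
  have hA := Real.exp_pos w
  rw [slope₁, ← mul_assoc, hσ, div_eq_mul_one_div]
  refine mul_le_mul_of_nonneg_left ?_ (abs_nonneg T)
  have h3 : 0 ≤ γ * Real.exp w ^ 2 / (2 * √(1 + γ * Real.exp w) ^ 3) := by positivity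
  have h4 : 1/8 ≤ Real.exp w / (2 * √(1 + γ * Real.exp w)) := by
    rw [le_div_iff₀ (by positivity)]; linarith [hw.1]
  linarith

theorem abs_slope_ge (hγ : 0 < γ) (hγ₁ : γ ≤ 1) (hw : Real.exp w ∈ Set.Icc (1/2 : ℝ) (3/2)) :
    3 * |Y| - 9/4 * |T| ≤ |slope γ T Y w| := by
  have h1 := abs_shift_sub_le (T := T) (Y := Y) hγ hw
  have h2 := (shift₁_bounds (T := T) hγ hγ₁ hw).2
  have h3 : |3 * Y| ≤ |slope γ T Y w| + |3 * (shift γ T Y w - Y)| + |2 * shift₁ γ T w| := by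
    have e : 3 * Y = slope γ T Y w - 3 * (shift γ T Y w - Y) + 2 * shift₁ γ T w := by
      rw [slope]; ring
    rw [e]
    exact (abs_add_le _ _).trans (add_le_add_left (abs_sub _ _) _)
  rw [abs_mul, abs_mul, abs_mul, abs_of_pos (by norm_num : (0:ℝ) < 3),
    abs_of_pos (by norm_num : (0:ℝ) < 2)] at h3
  linarith

theorem abs_innerPhase_sub_le {X κ : ℝ} (hX : 0 ≤ X) (hX₂ : X ≤ 2) (hκ : 0 ≤ κ) (hκ₁ : κ ≤ 1/4)
    (hw : Real.exp w ∈ Set.Icc (1/2 : ℝ) (3/2)) (ζ : ℝ → ℝ) {S U : ℝ}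
    (hS : S ∈ Set.Icc (-(3/2) : ℝ) (3/2)) (hU : U ∈ Set.Icc (-(3/2) : ℝ) (3/2)) :
    |innerPhase X κ ζ w S U - Real.exp (-(3/2) * w) * ζ w| ≤ 20 := by
  have hα := exp_neg_mul_mem hw
  set α := Real.exp (-(3/2) * w) with hαd
  have hcub : ∀ {S p : ℝ}, S ∈ Set.Icc (-(3/2) : ℝ) (3/2) → |p| ≤ 3/2 →
      |S ^ 3 / 3 + p * S| ≤ 27/8 := by
    intro S p hS hp
    have hS' : |S| ≤ 3/2 := abs_le.2 hS
    refine (abs_add_le _ _).trans ?_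
    rw [abs_div, abs_pow, abs_mul, abs_of_pos (by norm_num : (0:ℝ) < 3)]
    have h1 : |S| ^ 3 ≤ (3/2) ^ 3 := by gcongr
    have h2 : |p| * |S| ≤ 3/2 * (3/2) := by gcongr
    linarith
  have e : innerPhase X κ ζ w S U - α * ζ w =
      α * ((S ^ 3 / 3 + (κ - Real.exp w) * S) + (U ^ 3 / 3 + (X - Real.exp w) * U)) := by
    rw [innerPhase]; ring
  rw [e, abs_mul, abs_of_pos (Real.exp_pos _)]
  have h1 := hcub hS (p := κ - Real.exp w) (by rw [abs_le]; constructor <;> linarith [hw.1, hw.2])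
  have h2 := hcub hU (p := X - Real.exp w) (by rw [abs_le]; constructor <;> linarith [hw.1, hw.2])
  calc α * _ ≤ 29/10 * (27/8 + 27/8) := by
        gcongr
        · exact hα.2
        · exact (abs_add_le _ _).trans (add_le_add h1 h2)
    _ ≤ 20 := by norm_num

theorem abs_innerPhase_le {X κ : ℝ} (hX : 0 ≤ X) (hX₂ : X ≤ 2) (hκ : 0 ≤ κ) (hκ₁ : κ ≤ 1/4)
    (hγ : 0 < γ) (hw : Real.exp w ∈ Set.Icc (1/2 : ℝ) (3/2)) {S U : ℝ}
    (hS : S ∈ Set.Icc (-(3/2) : ℝ) (3/2)) (hU : U ∈ Set.Icc (-(3/2) : ℝ) (3/2)) :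
    |innerPhase X κ (shift γ T Y) w S U| ≤ 29/10 * (|Y| + 1/4 * |T|) + 20 := by
  have h1 := abs_innerPhase_sub_le hX hX₂ hκ hκ₁ hw (shift γ T Y) hS hU
  have h2 := abs_shift_sub_le (T := T) (Y := Y) hγ hw
  have hα := exp_neg_mul_mem hw
  set α := Real.exp (-(3/2) * w) with hαd
  have h3 : |shift γ T Y w| ≤ |Y| + 1/4 * |T| := by
    have := abs_sub_abs_le_abs_sub (shift γ T Y w) Y
    linarith
  have h4 : |α * shift γ T Y w| ≤ 29/10 * (|Y| + 1/4 * |T|) := by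
    rw [abs_mul, abs_of_pos (Real.exp_pos _)]
    exact mul_le_mul hα.2 h3 (abs_nonneg _) (by norm_num)
  have h5 := abs_sub_abs_le_abs_sub (innerPhase X κ (shift γ T Y) w S U) (α * shift γ T Y w)
  linarith

/-- Where the slope is small the phase is comparable to `T`. -/
theorem abs_innerPhase_mem_of_slope_le {X κ : ℝ} (hX : 0 ≤ X) (hX₂ : X ≤ 2) (hκ : 0 ≤ κ)
    (hκ₁ : κ ≤ 1/4) (hγ : 0 < γ) (hγ₁ : γ ≤ 1) (hw : Real.exp w ∈ Set.Icc (1/2 : ℝ) (3/2))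
    (hs : |slope γ T Y w| ≤ |T| / 10) (hT : 4000 ≤ |T|) {S U : ℝ}
    (hS : S ∈ Set.Icc (-(3/2) : ℝ) (3/2)) (hU : U ∈ Set.Icc (-(3/2) : ℝ) (3/2)) :
    |T| / 50 ≤ |innerPhase X κ (shift γ T Y) w S U| ∧
      |innerPhase X κ (shift γ T Y) w S U| ≤ 2 * |T| := by
  have h1 := abs_innerPhase_sub_le hX hX₂ hκ hκ₁ hw (shift γ T Y) hS hU
  obtain ⟨h2, h2'⟩ := shift₁_bounds (T := T) hγ hγ₁ hw
  have hα := exp_neg_mul_mem hw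
  set α := Real.exp (-(3/2) * w) with hαd
  have e : slope γ T Y w = 3 * shift γ T Y w - 2 * shift₁ γ T w := rfl
  have a1 : |3 * shift γ T Y w| = 3 * |shift γ T Y w| := by rw [abs_mul, abs_of_pos (by norm_num)]
  have a2 : |2 * shift₁ γ T w| = 2 * |shift₁ γ T w| := by rw [abs_mul, abs_of_pos (by norm_num)]
  have a3 : |α * shift γ T Y w| = α * |shift γ T Y w| := by
    rw [abs_mul, abs_of_pos (Real.exp_pos _)]
  have b1 := abs_sub_abs_le_abs_sub (3 * shift γ T Y w) (2 * shift₁ γ T w)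
  have b2 := abs_sub_abs_le_abs_sub (2 * shift₁ γ T w) (3 * shift γ T Y w)
  rw [abs_sub_comm (2 * shift₁ γ T w)] at b2
  rw [← e, a1, a2] at b1 b2
  have b3 := abs_sub_abs_le_abs_sub (innerPhase X κ (shift γ T Y) w S U) (α * shift γ T Y w)
  have b4 := abs_sub_abs_le_abs_sub (α * shift γ T Y w) (innerPhase X κ (shift γ T Y) w S U)
  rw [abs_sub_comm (α * shift γ T Y w)] at b4
  rw [a3] at b3 b4
  have c1 : 27/50 * |shift γ T Y w| ≤ α * |shift γ T Y w| :=
    mul_le_mul_of_nonneg_right hα.1 (abs_nonneg _)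
  have c2 : α * |shift γ T Y w| ≤ 29/10 * |shift γ T Y w| :=
    mul_le_mul_of_nonneg_right hα.2 (abs_nonneg _)
  constructor <;> linarith

end Estimates

/-- Bounds on the cutoffs entering the integral over `w = log A`. -/
structure Weights (K : ℝ) (χ Ψ ω₀ ω₁ : ℝ → ℝ) : Prop where
  cutoff : Cutoff K χ
  cutoff_one : Cutoff K fun x => χ x * x
  cutoff_three : Cutoff K fun x => χ x * x ^ 3
  amp : AmpFamily 2 K Ψ
  amp_div : AmpFamily 2 K fun x => Ψ x / x
  amp_deriv : AmpFamily 2 K fun x => x * deriv (fun x => Ψ x / x) x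
  hasDerivAt : ∀ w, HasDerivAt ω₀ (ω₁ w) w
  cont : Continuous ω₁
  bound : ∀ w, Real.exp w ∈ Set.Icc (1/2 : ℝ) (3/2) → |ω₀ w| ≤ K
  bound₁ : ∀ w, Real.exp w ∈ Set.Icc (1/2 : ℝ) (3/2) → |ω₁ w| ≤ K

/-- The integral over `w = log A`. -/
noncomputable def outerInt (D : ℝ → ℂ) (l X κ γ T Y : ℝ) (χ Ψ ω₀ : ℝ → ℝ) : ℂ :=
  ∫ w in (Real.log (1/2))..(Real.log (3/2)),
    (ω₀ w : ℂ) * innerInt D l X κ (shift γ T Y) χ χ Ψ w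

theorem exp_mem_of_mem_log {w : ℝ} (hw : w ∈ Set.Icc (Real.log (1/2)) (Real.log (3/2))) :
    Real.exp w ∈ Set.Icc (1/2 : ℝ) (3/2) :=
  ⟨(Real.log_le_iff_le_exp (by norm_num)).1 hw.1, (Real.le_log_iff_exp_le (by norm_num)).1 hw.2⟩

theorem log_half_le : Real.log (1/2) ≤ Real.log (3/2) :=
  Real.log_le_log (by norm_num) (by norm_num)

theorem log_sub_log_half_le : Real.log (3/2) - Real.log (1/2) ≤ 2 := by
  rw [← Real.log_div (by norm_num) (by norm_num)]
  refine (Real.log_le_sub_one_of_pos (by norm_num)).trans (by norm_num)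

section Outer

variable {D : ℝ → ℂ} {l X κ γ T Y σ K : ℝ} {χ Ψ ω₀ ω₁ : ℝ → ℝ}

/-- The primitive-type amplitude. -/
noncomputable def outerPrim (D : ℝ → ℂ) (l X κ γ T Y σ : ℝ) (χ Ψ ω₀ : ℝ → ℝ) (w : ℝ) : ℂ :=
  σ * (2 * I / l) * ((ω₀ w : ℂ) * innerInt D l X κ (shift γ T Y) χ χ (fun x => Ψ x / x) w)

noncomputable def outerRem (D : ℝ → ℂ) (l X κ γ T Y σ : ℝ) (χ Ψ ω₀ ω₁ : ℝ → ℝ) (w : ℝ) : ℂ :=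
  σ * (2 * I / l * ((ω₁ w : ℂ) * innerInt D l X κ (shift γ T Y) χ χ (fun x => Ψ x / x) w +
    (ω₀ w : ℂ) * (-(3/2) * innerInt D l X κ (shift γ T Y) χ χ
      (fun x => x * deriv (fun x => Ψ x / x) x) w)) -
    2 * ((ω₀ w : ℂ) * innerRem D l X κ (shift γ T Y) χ χ Ψ w))

theorem Weights.oscData (W : Weights K χ Ψ ω₀ ω₁) (hD : Continuous D) (hl : 0 < l) (hγ : 0 < γ)
    (hγ₁ : γ ≤ 1) (X κ : ℝ) (hσ : σ * T = |T|) :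
    OscData (Real.log (1/2)) (Real.log (3/2)) (fun w => σ * slope γ T Y w)
      (fun w => σ * slope₁ γ T w)
      (fun w => (ω₀ w : ℂ) * innerInt D l X κ (shift γ T Y) χ χ Ψ w)
      (outerPrim D l X κ γ T Y σ χ Ψ ω₀) (outerRem D l X κ γ T Y σ χ Ψ ω₀ ω₁) := by
  have cζ : Continuous (shift γ T Y) :=
    continuous_iff_continuousAt.2 fun z => (hasDerivAt_shift hγ T Y z).continuousAt
  have cω : Continuous ω₀ :=
    continuous_iff_continuousAt.2 fun z => (W.hasDerivAt z).continuousAt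
  have cω₁ := W.cont
  have cχ := W.cutoff.smooth.continuous
  have cI := fun {f g u : ℝ → ℝ} (hf : Continuous f) (hg : Continuous g) (hu : Continuous u) =>
    continuous_innerInt hD l X κ cζ hf hg hu
  have i0 := cI cχ cχ W.amp.smooth.continuous
  have i1 := cI cχ cχ W.amp_div.smooth.continuous
  have i2 := cI cχ cχ W.amp_deriv.smooth.continuous
  have i3 := cI cχ W.cutoff_three.smooth.continuous W.amp.smooth.continuous
  have i4 := cI cχ W.cutoff_one.smooth.continuous W.amp.smooth.continuous
  have i5 := cI W.cutoff_three.smooth.continuous cχ W.amp.smooth.continuous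
  have i6 := cI W.cutoff_one.smooth.continuous cχ W.amp.smooth.continuous
  refine ⟨fun w _ => (hasDerivAt_slope hγ T Y w).const_mul σ, fun w _ => ?_,
    ((continuous_slope₁ hγ T).const_mul σ).continuousOn,
    Continuous.continuousOn (by fun_prop), Continuous.continuousOn ?_, fun w hw => ?_⟩
  · have hmul : ∀ x, x * (Ψ x / x) = Ψ x := fun x => by
      simpa using Amp.mul_div_pow_succ W.amp.supp 0 x
    have hσ2 : (l : ℂ) ≠ 0 := by exact_mod_cast hl.ne'
    have d := hasDerivAt_innerInt hD l X κ (hasDerivAt_shift hγ T Y) (continuous_shift₁ hγ T)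
      cχ cχ W.amp_div.smooth hmul w
    refine (((W.hasDerivAt w).ofReal_comp.mul d).const_mul ((σ : ℂ) * (2 * I / l))).congr_deriv ?_
    rw [outerRem, slope]
    push_cast
    field_simp
    ring_nf
    rw [I_sq]
    ring
  · unfold outerRem innerRem
    fun_prop
  · have := abs_mul_slope₁_ge hγ hγ₁ (exp_mem_of_mem_log hw) hσ
    exact (by positivity : 0 ≤ |T| / 8).trans this

theorem Weights.norm_le (W : Weights K χ Ψ ω₀ ω₁) (hD : Continuous D) (hl : 1 ≤ l)
    (hX : 0 ≤ X) (hX₂ : X ≤ 2) (hκ : 0 ≤ κ) (hκ₁ : κ ≤ 1/4) (hσ : |σ| = 1) {M w : ℝ}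
    (hw : Real.exp w ∈ Set.Icc (1/2 : ℝ) (3/2))
    (hM : ∀ v, Amp K v → ∀ S ∈ Set.Icc (-(3/2) : ℝ) (3/2), ∀ U ∈ Set.Icc (-(3/2) : ℝ) (3/2),
      ‖freqInt D l (Real.exp (-(3/2) * w)) v (innerPhase X κ (shift γ T Y) w S U)‖ ≤ M) :
    ‖(ω₀ w : ℂ) * innerInt D l X κ (shift γ T Y) χ χ Ψ w‖ ≤
        K * (5460 * K ^ 2 * M * l ^ (-(5/6) : ℝ)) ∧
    ‖outerPrim D l X κ γ T Y σ χ Ψ ω₀ w‖ ≤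
        2 * (K * (5460 * K ^ 2 * M * l ^ (-(5/6) : ℝ))) / l ∧
    ‖outerRem D l X κ γ T Y σ χ Ψ ω₀ ω₁ w‖ ≤
        15 * (K * (5460 * K ^ 2 * M * l ^ (-(5/6) : ℝ))) := by
  have hl0 : 0 < l := by linarith
  set Q := 5460 * K ^ 2 * M * l ^ (-(5/6) : ℝ) with hQ
  have q : ∀ {f g u : ℝ → ℝ}, Cutoff K f → Cutoff K g → AmpFamily 2 K u →
      ‖innerInt D l X κ (shift γ T Y) f g u w‖ ≤ Q := fun hf hg hu =>
    norm_innerInt_le hD hl0 hκ₁ hf hg hu hw hM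
  have hK := W.cutoff.nonneg
  have i0 := q W.cutoff W.cutoff W.amp
  have i1 := q W.cutoff W.cutoff W.amp_div
  have i2 := q W.cutoff W.cutoff W.amp_deriv
  have i3 := q W.cutoff W.cutoff_three W.amp
  have i4 := q W.cutoff W.cutoff_one W.amp
  have i5 := q W.cutoff_three W.cutoff W.amp
  have i6 := q W.cutoff_one W.cutoff W.amp
  have hQ0 : 0 ≤ Q := (norm_nonneg _).trans i0
  have b0 := W.bound w hw
  have b1 := W.bound₁ w hw
  have hrem : ‖innerRem D l X κ (shift γ T Y) χ χ Ψ w‖ ≤ 5 * Q := by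
    rw [innerRem]
    have c1 : |-(3/2) * X + 1/2 * Real.exp w| ≤ 3 := by
      rw [abs_le]; constructor <;> linarith [hw.1, hw.2]
    have c2 : |-(3/2) * κ + 1/2 * Real.exp w| ≤ 1 := by
      rw [abs_le]; constructor <;> linarith [hw.1, hw.2]
    have c3 : |(-(1/2) : ℝ)| ≤ 1/2 := by norm_num [abs_of_pos]
    refine (norm_add_le_of_le (norm_add_le_of_le (norm_add_le_of_le
      (norm_mul_le_of_le ((Complex.norm_real _).trans_le c3) i3)
      (norm_mul_le_of_le ((Complex.norm_real _).trans_le c1) i4))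
      (norm_mul_le_of_le ((Complex.norm_real _).trans_le c3) i5))
      (norm_mul_le_of_le ((Complex.norm_real _).trans_le c2) i6)).trans_eq ?_
    ring
  have n0 : ‖(ω₀ w : ℂ)‖ ≤ K := (Complex.norm_real _).trans_le b0
  have n1 : ‖(ω₁ w : ℂ)‖ ≤ K := (Complex.norm_real _).trans_le b1
  have nl : ‖2 * I / (l : ℂ)‖ = 2 / l := by
    rw [norm_div, norm_mul, norm_I, Complex.norm_real, Real.norm_of_nonneg hl0.le]; norm_num
  have nσ : ‖(σ : ℂ)‖ = 1 := (Complex.norm_real _).trans hσ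
  refine ⟨norm_mul_le_of_le n0 i0, ?_, ?_⟩
  · rw [outerPrim, norm_mul, norm_mul, nσ, nl, one_mul]
    refine (mul_le_mul_of_nonneg_left (norm_mul_le_of_le n0 i1) (by positivity)).trans_eq ?_
    ring
  · rw [outerRem, norm_mul, nσ, one_mul]
    have h2 : 2 / l ≤ 2 := by rw [div_le_iff₀ hl0]; linarith
    have n32 : ‖(-(3/2) : ℂ)‖ ≤ 3/2 := by norm_num
    have n2 : ‖(2 : ℂ)‖ ≤ 2 := by norm_num
    refine (norm_sub_le_of_le (norm_mul_le_of_le (nl.trans_le h2) (norm_add_le_of_le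
      (norm_mul_le_of_le n1 i1) (norm_mul_le_of_le n0 (norm_mul_le_of_le n32 i2))))
      (norm_mul_le_of_le n2 (norm_mul_le_of_le n0 hrem))).trans_eq ?_
    ring

/-- Integration by parts away from the stationary points. -/
theorem Weights.norm_outerInt_le_far (W : Weights K χ Ψ ω₀ ω₁) (hD : Continuous D) (hl : 1 ≤ l)
    (hγ : 0 < γ) (hγ₁ : γ ≤ 1) (hX : 0 ≤ X) (hX₂ : X ≤ 2) (hκ : 0 ≤ κ) (hκ₁ : κ ≤ 1/4) {g M : ℝ}
    (hg : 0 < g) (hs : ∀ w, Real.exp w ∈ Set.Icc (1/2 : ℝ) (3/2) → g ≤ |slope γ T Y w|)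
    (hM : ∀ w, Real.exp w ∈ Set.Icc (1/2 : ℝ) (3/2) → ∀ v, Amp K v →
      ∀ S ∈ Set.Icc (-(3/2) : ℝ) (3/2), ∀ U ∈ Set.Icc (-(3/2) : ℝ) (3/2),
      ‖freqInt D l (Real.exp (-(3/2) * w)) v (innerPhase X κ (shift γ T Y) w S U)‖ ≤ M) :
    ‖outerInt D l X κ γ T Y χ Ψ ω₀‖ ≤ 5000000 * K ^ 3 * l ^ (-(5/6) : ℝ) * (M / g) := by
  obtain ⟨σ, hσ, hσT⟩ : ∃ σ : ℝ, |σ| = 1 ∧ σ * T = |T| := by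
    rcases le_total 0 T with h | h
    · exact ⟨1, by simp, by rw [abs_of_nonneg h, one_mul]⟩
    · exact ⟨-1, by simp, by rw [abs_of_nonpos h]; ring⟩
  have hl0 : 0 < l := by linarith
  have H := W.oscData (Y := Y) hD hl0 hγ hγ₁ X κ hσT
  have B := fun w hw => W.norm_le hD hl hX hX₂ hκ hκ₁ hσ (exp_mem_of_mem_log hw)
    (hM w (exp_mem_of_mem_log hw))
  have hK := W.cutoff.nonneg
  have hM0 : 0 ≤ M := (norm_nonneg _).trans
    (hM 0 (by norm_num) _ (W.amp.amp 0 (by norm_num)) 0 (by norm_num) 0 (by norm_num))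
  have hle := H.norm_integral_le_far log_half_le hg (fun w hw => by
    rw [abs_mul, hσ, one_mul]; exact hs w (exp_mem_of_mem_log hw)) (fun w hw => (B w hw).2.1)
    (fun w hw => (B w hw).2.2)
  rw [outerInt]
  refine hle.trans ?_
  set R := l ^ (-(5/6) : ℝ) with hR
  have hR0 : 0 < R := Real.rpow_pos_of_pos hl0 _
  calc _ ≤ 4 * (2 * (K * (5460 * K ^ 2 * M * R))) / g + 15 * (K * (5460 * K ^ 2 * M * R)) *
        (2 / g) := by
        gcongr
        · exact div_le_self (by positivity) hl
        · exact log_sub_log_half_le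
    _ = 207480 * (K ^ 3 * R * (M / g)) := by ring
    _ ≤ 5000000 * (K ^ 3 * R * (M / g)) := by gcongr; norm_num
    _ = _ := by ring

/-- The stationary points are nondegenerate. -/
theorem Weights.norm_outerInt_le (W : Weights K χ Ψ ω₀ ω₁) (hD : Continuous D) (hl : 8 ≤ l)
    (hγ : 0 < γ) (hγ₁ : γ ≤ 1) (hX : 0 ≤ X) (hX₂ : X ≤ 2) (hκ : 0 ≤ κ) (hκ₁ : κ ≤ 1/4)
    (hT : l ^ 2 ≤ |T|) {M Mn : ℝ}
    (hM : ∀ w, Real.exp w ∈ Set.Icc (1/2 : ℝ) (3/2) → ∀ v, Amp K v →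
      ∀ S ∈ Set.Icc (-(3/2) : ℝ) (3/2), ∀ U ∈ Set.Icc (-(3/2) : ℝ) (3/2),
      ‖freqInt D l (Real.exp (-(3/2) * w)) v (innerPhase X κ (shift γ T Y) w S U)‖ ≤ M)
    (hMn : ∀ w, Real.exp w ∈ Set.Icc (1/2 : ℝ) (3/2) → |slope γ T Y w| ≤ |T| / 10 → ∀ v, Amp K v →
      ∀ S ∈ Set.Icc (-(3/2) : ℝ) (3/2), ∀ U ∈ Set.Icc (-(3/2) : ℝ) (3/2),
      ‖freqInt D l (Real.exp (-(3/2) * w)) v (innerPhase X κ (shift γ T Y) w S U)‖ ≤ Mn)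
    (hMn0 : 0 ≤ Mn) :
    ‖outerInt D l X κ γ T Y χ Ψ ω₀‖ ≤
      5000000 * K ^ 3 * l ^ (-(5/6) : ℝ) * (M / |T| + Mn / √(l * |T|)) := by
  obtain ⟨σ, hσ, hσT⟩ : ∃ σ : ℝ, |σ| = 1 ∧ σ * T = |T| := by
    rcases le_total 0 T with h | h
    · exact ⟨1, by simp, by rw [abs_of_nonneg h, one_mul]⟩
    · exact ⟨-1, by simp, by rw [abs_of_nonpos h]; ring⟩
  have hl0 : 0 < l := by linarith
  have hl1 : 1 ≤ l := by linarith
  have H := W.oscData (Y := Y) hD hl0 hγ hγ₁ X κ hσT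
  have B := fun w hw => W.norm_le hD hl1 hX hX₂ hκ hκ₁ hσ (exp_mem_of_mem_log hw)
    (hM w (exp_mem_of_mem_log hw))
  have Bn := fun w hw hs => W.norm_le hD hl1 hX hX₂ hκ hκ₁ hσ (exp_mem_of_mem_log hw)
    (hMn w (exp_mem_of_mem_log hw) hs)
  have hK := W.cutoff.nonneg
  have hM0 : 0 ≤ M := (norm_nonneg _).trans
    (hM 0 (by norm_num) _ (W.amp.amp 0 (by norm_num)) 0 (by norm_num) 0 (by norm_num))
  have ha : ∀ w, |σ * slope γ T Y w| = |slope γ T Y w| := fun w => by rw [abs_mul, hσ, one_mul]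
  set R := l ^ (-(5/6) : ℝ) with hR
  have hR0 : 0 < R := Real.rpow_pos_of_pos hl0 _
  set t := |T| with ht
  have ht0 : 64 ≤ t := by nlinarith
  set s := √(l * t) with hs
  have hs0 : 0 < s := Real.sqrt_pos.2 (by positivity)
  have hss : s ^ 2 = l * t := Real.sq_sqrt (by positivity)
  have hs10 : 10 ≤ s := by rw [hs]; apply Real.le_sqrt_of_sq_le; nlinarith
  have hδg : t / s ≤ t / 10 := by gcongr
  have hδ0 : 0 < t / s := by positivity
  have hlog0 : 0 ≤ Real.log (t / 10 / (t / s)) := Real.log_nonneg ((one_le_div hδ0).2 hδg)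
  have hlog : Real.log (t / 10 / (t / s)) ≤ 3 * (t / s) := by
    have e : t / 10 / (t / s) = s / 10 := by field_simp
    have h1 : s / 10 ≤ (t / s) ^ 3 := by
      rw [div_pow, le_div_iff₀ (by positivity)]
      have h2 : s ^ 4 ≤ t ^ 3 := by
        calc s ^ 4 = (s ^ 2) ^ 2 := by ring
          _ = l ^ 2 * t ^ 2 := by rw [hss]; ring
          _ ≤ t * t ^ 2 := by gcongr
          _ = t ^ 3 := by ring
      have : 0 ≤ s ^ 4 := by positivity
      calc s / 10 * s ^ 3 = s ^ 4 / 10 := by ring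
        _ ≤ t ^ 3 := by linarith
    rw [e]
    calc Real.log (s / 10) ≤ Real.log ((t / s) ^ 3) := Real.log_le_log (by positivity) h1
      _ = 3 * Real.log (t / s) := by rw [Real.log_pow]; norm_num
      _ ≤ 3 * (t / s) := by
        have := Real.log_le_sub_one_of_pos hδ0
        linarith
  have hle := H.norm_integral_le_near_far log_half_le (g := t / 10) (m := t / 8)
    (M := K * (5460 * K ^ 2 * Mn * R)) (M₁ := 2 * (K * (5460 * K ^ 2 * Mn * R)) / l)
    (D := 15 * (K * (5460 * K ^ 2 * Mn * R))) (Mf := 2 * (K * (5460 * K ^ 2 * M * R)) / l)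
    (Df := 15 * (K * (5460 * K ^ 2 * M * R))) hδ0 hδg (by positivity)
    (fun w hw => abs_mul_slope₁_ge hγ hγ₁ (exp_mem_of_mem_log hw) hσT) (by positivity)
    (by positivity) (by positivity) (by positivity) (by positivity)
    (fun w hw h => (Bn w hw (by rwa [ha] at h)).1) (fun w hw h => (Bn w hw (by rwa [ha] at h)).2.1)
    (fun w hw h => (Bn w hw (by rwa [ha] at h)).2.2) (fun w hw _ => (B w hw).2.1)
    (fun w hw _ => (B w hw).2.2)
  rw [outerInt]
  refine hle.trans ?_
  have e1 : l * (t / s) = s := by field_simp; linarith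
  have e2 : 3 * (t / s) / (t / 8) = 24 / s := by field_simp; norm_num
  have e3 : 2 * (t / s) / (t / 8) = 16 / s := by field_simp; norm_num
  calc _ ≤ 2 * (4 * (2 * (K * (5460 * K ^ 2 * M * R))) / (t / 10) +
        15 * (K * (5460 * K ^ 2 * M * R)) * (2 / (t / 10))) +
      (2 * (4 * (2 * (K * (5460 * K ^ 2 * Mn * R)) / l) / (t / s) +
        15 * (K * (5460 * K ^ 2 * Mn * R)) * (3 * (t / s) / (t / 8))) +
        K * (5460 * K ^ 2 * Mn * R) * (2 * (t / s) / (t / 8))) := by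
        gcongr
        · exact div_le_self (by positivity) hl1
        · exact log_sub_log_half_le
    _ = K ^ 3 * R * (5460 * 760 * (M / t) +
          5460 * (16 * (Mn / (l * (t / s))) + 736 * (Mn / s))) := by
        rw [e2, e3]; ring
    _ ≤ K ^ 3 * R * (5000000 * (M / t) + 5000000 * (Mn / s)) := by
        rw [e1]
        have h1 : 0 ≤ M / t := by positivity
        have h2 : 0 ≤ Mn / s := by positivity
        refine mul_le_mul_of_nonneg_left ?_ (by positivity)
        linarith
    _ = _ := by ring

end Outer

theorem one_add_sqrt_le {l x : ℝ} (hl : 1 ≤ l) (hx : l ^ 2 ≤ x) :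
    1 + √(64 * x / l ^ 3) ≤ 9 * (x / l ^ 2) := by
  have hl0 : 0 < l := by linarith
  have hx0 : 0 < x := lt_of_lt_of_le (by positivity) hx
  have h1 : 1 ≤ x / l ^ 2 := by rwa [one_le_div (by positivity)]
  have hlx : l ≤ x := le_trans (by nlinarith) hx
  have h2 : √(64 * x / l ^ 3) ≤ 8 * (x / l ^ 2) := by
    rw [Real.sqrt_le_left (by positivity)]
    calc 64 * x / l ^ 3 = 64 * (x / l ^ 4) * l := by field_simp
      _ ≤ 64 * (x / l ^ 4) * x := by gcongr
      _ = (8 * (x / l ^ 2)) ^ 2 := by ring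
  linarith

section Bounds

variable {l c C X κ γ T Y K : ℝ} {ph b₁ b₂ b₃ χ Ψ ω₀ ω₁ : ℝ → ℝ}

/-- The contribution of all reflections. -/
theorem exists_norm_outerInt_reflSum_le (c C : ℝ) (hc : 0 < c) : ∃ C' : ℝ, 0 ≤ C' ∧
    ∀ {l X κ γ T Y K : ℝ} {ph b₁ b₂ b₃ χ Ψ ω₀ ω₁ : ℝ → ℝ}, ReflPhase l c C ph b₁ b₂ b₃ →
    Weights K χ Ψ ω₀ ω₁ → 8 ≤ l → 6 * C ≤ l ^ 2 → 4000 ≤ l ^ 2 → 0 < γ → γ ≤ 1 → 0 ≤ X → X ≤ 2 →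
    0 ≤ κ → κ ≤ 1/4 → l ^ 2 ≤ |T| → ∀ F : Finset ℤ,
    ‖outerInt (reflSum F ph) l X κ γ T Y χ Ψ ω₀‖ ≤
      C' * K ^ 4 * (l ^ (-(5/6) : ℝ) / l ^ 2) := by
  obtain ⟨Z, hZ, hfreq⟩ := ReflPhase.exists_norm_freqInt_reflSum_le c C (1/50) hc (by norm_num)
  refine ⟨5000000 * (11 * Z), by positivity, ?_⟩
  intro l X κ γ T Y K ph b₁ b₂ b₃ χ Ψ ω₀ ω₁ H W hl hCl hl4 hγ hγ₁ hX hX₂ hκ hκ₁ hT F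
  have hl0 : 0 < l := by linarith
  have hl1 : 1 ≤ l := by linarith
  have hK := W.cutoff.nonneg
  have hD := continuous_reflSum F H.cont
  have hR0 : 0 < l ^ (-(5/6) : ℝ) := Real.rpow_pos_of_pos hl0 _
  set R := l ^ (-(5/6) : ℝ) with hR
  have hT4 : 4000 ≤ |T| := hl4.trans hT
  have hglob : ∀ {B : ℝ}, l ^ 2 ≤ B → 29/10 * (|Y| + 1/4 * |T|) + 20 ≤ 64 * B →
      ∀ w, Real.exp w ∈ Set.Icc (1/2 : ℝ) (3/2) → ∀ v, Amp K v →
      ∀ S ∈ Set.Icc (-(3/2) : ℝ) (3/2), ∀ U ∈ Set.Icc (-(3/2) : ℝ) (3/2),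
      ‖freqInt (reflSum F ph) l (Real.exp (-(3/2) * w)) v
        (innerPhase X κ (shift γ T Y) w S U)‖ ≤ Z * K * (9 * (B / l ^ 2)) := by
    intro B hB hYB w hw v hv S hS U hU
    refine ((hfreq H hl1 hCl hv (exp_neg_mul_mem hw) F _).1).trans ?_
    refine mul_le_mul_of_nonneg_left (le_trans ?_ (one_add_sqrt_le hl1 hB)) (by positivity)
    have := abs_innerPhase_le (T := T) (Y := Y) hX hX₂ hκ hκ₁ hγ hw hS hU
    gcongr
    exact this.trans hYB
  rcases le_total |Y| (20 * |T|) with hY | hY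
  · have hnear : ∀ w, Real.exp w ∈ Set.Icc (1/2 : ℝ) (3/2) → |slope γ T Y w| ≤ |T| / 10 →
        ∀ v, Amp K v →
        ∀ S ∈ Set.Icc (-(3/2) : ℝ) (3/2), ∀ U ∈ Set.Icc (-(3/2) : ℝ) (3/2),
        ‖freqInt (reflSum F ph) l (Real.exp (-(3/2) * w)) v
          (innerPhase X κ (shift γ T Y) w S U)‖ ≤ Z * K * √(2 * |T| / l ^ 3) := by
      intro w hw hs v hv S hS U hU
      obtain ⟨e1, e2⟩ := abs_innerPhase_mem_of_slope_le hX hX₂ hκ hκ₁ hγ hγ₁ hw hs hT4 hS hU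
      refine ((hfreq H hl1 hCl hv (exp_neg_mul_mem hw) F _).2 (by linarith) (by linarith)).trans ?_
      gcongr
    have hT0 : 0 < |T| := by linarith
    refine (W.norm_outerInt_le hD hl hγ hγ₁ hX hX₂ hκ hκ₁ hT (hglob hT (by linarith)) hnear
      (by positivity)).trans ?_
    have h1 : √(2 * |T| / l ^ 3) ≤ 2 / l ^ 2 * √(l * |T|) := by
      rw [Real.sqrt_le_left (by positivity), mul_pow, Real.sq_sqrt (by positivity)]
      have e : (2 / l ^ 2) ^ 2 * (l * |T|) = 2 * (2 * |T| / l ^ 3) := by field_simp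
      have : 0 ≤ 2 * |T| / l ^ 3 := by positivity
      linarith
    have hs : 0 < √(l * |T|) := Real.sqrt_pos.2 (by positivity)
    have h2 : √(2 * |T| / l ^ 3) / √(l * |T|) ≤ 2 / l ^ 2 := by rwa [div_le_iff₀ hs]
    calc 5000000 * K ^ 3 * R * (Z * K * (9 * (|T| / l ^ 2)) / |T| +
          Z * K * √(2 * |T| / l ^ 3) / √(l * |T|))
        = 5000000 * K ^ 3 * R * (Z * K * 9 / l ^ 2 +
          Z * K * (√(2 * |T| / l ^ 3) / √(l * |T|))) := by
          congr 2
          · field_simp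
          · ring
      _ ≤ 5000000 * K ^ 3 * R * (Z * K * 9 / l ^ 2 + Z * K * (2 / l ^ 2)) := by gcongr
      _ = _ := by ring
  · have hY0 : 0 < |Y| := by linarith
    refine (W.norm_outerInt_le_far hD hl1 hγ hγ₁ hX hX₂ hκ hκ₁ hY0 (fun w hw => ?_)
      (hglob (B := |Y|) (by linarith) (by linarith))).trans ?_
    · have := abs_slope_ge (T := T) (Y := Y) hγ hγ₁ hw
      linarith
    · have e : Z * K * (9 * (|Y| / l ^ 2)) / |Y| = Z * K * 9 / l ^ 2 := by field_simp
      rw [e]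
      calc 5000000 * K ^ 3 * R * (Z * K * 9 / l ^ 2)
          = 5000000 * (9 * Z) * K ^ 4 * (R / l ^ 2) := by ring
        _ ≤ _ := by gcongr; norm_num

/-- The contribution of one reflection. -/
theorem norm_outerInt_reflSum_singleton_le (H : ReflPhase l c C ph b₁ b₂ b₃)
    (W : Weights K χ Ψ ω₀ ω₁) (hc : 0 < c) (hl : 8 ≤ l) (hCl : 6 * C ≤ l ^ 2) (hl4 : 4000 ≤ l ^ 2)
    (hγ : 0 < γ) (hγ₁ : γ ≤ 1) (hX : 0 ≤ X) (hX₂ : X ≤ 2) (hκ : 0 ≤ κ) (hκ₁ : κ ≤ 1/4)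
    (hT : l ^ 2 ≤ |T|) {N : ℤ} (hN : l ^ 2 ≤ |(N : ℝ)|) :
    ‖outerInt (reflSum {N} ph) l X κ γ T Y χ Ψ ω₀‖ ≤
      5000000 * (42 * (64 + 2 / c)) * K ^ 4 * (l ^ (-(5/6) : ℝ) / |(N : ℝ)|) := by
  have hl0 : 0 < l := by linarith
  have hl1 : 1 ≤ l := by linarith
  have hK := W.cutoff.nonneg
  have hD := continuous_reflSum {N} H.cont
  have hR0 : 0 < l ^ (-(5/6) : ℝ) := Real.rpow_pos_of_pos hl0 _
  set R := l ^ (-(5/6) : ℝ) with hR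
  set n := |(N : ℝ)| with hn
  have hn0 : 0 < n := by linarith
  have hN0 : N ≠ 0 := by
    rintro rfl
    simp [hn] at hn0
  have hT0 : 0 < |T| := by linarith
  have hln : l ≤ n := le_trans (by nlinarith) hN
  have hs1 : √(l / n) ≤ 1 := by
    rw [Real.sqrt_le_one]; exact (div_le_one hn0).2 hln
  have hfreq : ∀ {α : ℝ} {v : ℝ → ℝ} (E : ℝ), Amp K v → freqInt (reflSum {N} ph) l α v E =
      ∫ ρ in (1/8 : ℝ)..3, (v (α * ρ) : ℂ) * Complex.exp (I * (l * ρ * E + N * ph ρ : ℝ)) :=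
    fun {α v} E hv => by
      rw [freqInt_reflSum _ H.cont l α hv.smooth.continuous, Finset.sum_singleton]
  have hglob : ∀ w, Real.exp w ∈ Set.Icc (1/2 : ℝ) (3/2) → ∀ v, Amp K v →
      ∀ S ∈ Set.Icc (-(3/2) : ℝ) (3/2), ∀ U ∈ Set.Icc (-(3/2) : ℝ) (3/2),
      ‖freqInt (reflSum {N} ph) l (Real.exp (-(3/2) * w)) v
        (innerPhase X κ (shift γ T Y) w S U)‖ ≤ (32 + 2 / c) * K * √(l / n) :=
    fun w hw v hv S _ U _ => by
      rw [hfreq _ hv]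
      exact H.norm_integral_le_sqrt hc hl0 hv (exp_neg_mul_mem hw) hN0 _
  set d := 32 + 2 / c with hd
  have hd0 : 0 < d := by positivity
  have hd' : 64 + 2 / c = d + 32 := by rw [hd]; ring
  rw [hd']
  rcases le_or_gt n (36 * |T|) with hNT | hNT
  · refine (W.norm_outerInt_le hD hl hγ hγ₁ hX hX₂ hκ hκ₁ hT hglob
      (fun w hw _ => hglob w hw) (by positivity)).trans ?_
    have hs : 0 < √(l * |T|) := Real.sqrt_pos.2 (by positivity)
    have h1 : √(l / n) / |T| ≤ 36 / n := by
      rw [div_le_div_iff₀ hT0 hn0]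
      nlinarith
    have h2 : √(l / n) / √(l * |T|) ≤ 6 / n := by
      rw [div_le_iff₀ hs, Real.sqrt_le_left (by positivity), mul_pow, Real.sq_sqrt (by positivity)]
      calc l / n = l * n / n ^ 2 := by field_simp
        _ ≤ l * (36 * |T|) / n ^ 2 := by gcongr
        _ = (6 / n) ^ 2 * (l * |T|) := by ring
    calc 5000000 * K ^ 3 * R * (d * K * √(l / n) / |T| + d * K * √(l / n) / √(l * |T|))
        = 5000000 * d * K ^ 4 * R * (√(l / n) / |T| + √(l / n) / √(l * |T|)) := by ring
      _ ≤ 5000000 * d * K ^ 4 * R * (36 / n + 6 / n) := by gcongr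
      _ = 5000000 * (42 * d) * K ^ 4 * (R / n) := by ring
      _ ≤ _ := by gcongr; linarith
  rcases le_total (n / 24) |Y| with hY | hY
  · refine (W.norm_outerInt_le_far hD hl1 hγ hγ₁ hX hX₂ hκ hκ₁ (g := n / 16) (by positivity)
      (fun w hw => ?_) hglob).trans ?_
    · have := abs_slope_ge (T := T) (Y := Y) hγ hγ₁ hw
      linarith
    · calc 5000000 * K ^ 3 * R * (d * K * √(l / n) / (n / 16))
          ≤ 5000000 * K ^ 3 * R * (d * K * 1 / (n / 16)) := by gcongr
        _ = 5000000 * (16 * d) * K ^ 4 * (R / n) := by field_simp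
        _ ≤ _ := by gcongr <;> linarith
  have hfar : ∀ w, Real.exp w ∈ Set.Icc (1/2 : ℝ) (3/2) → ∀ v, Amp K v →
      ∀ S ∈ Set.Icc (-(3/2) : ℝ) (3/2), ∀ U ∈ Set.Icc (-(3/2) : ℝ) (3/2),
      ‖freqInt (reflSum {N} ph) l (Real.exp (-(3/2) * w)) v
        (innerPhase X κ (shift γ T Y) w S U)‖ ≤ 864 * K / n := by
    intro w hw v hv S hS U hU
    rw [hfreq _ hv]
    set E := innerPhase X κ (shift γ T Y) w S U with hE
    have h1 : |E| ≤ n / 3 := by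
      have := abs_innerPhase_le (T := T) (Y := Y) hX hX₂ hκ hκ₁ hγ hw hS hU
      linarith
    have h2 : n ≤ |E - 4/3 * N| := by
      have := abs_sub_abs_le_abs_sub (4/3 * (N : ℝ)) E
      rw [abs_sub_comm, abs_mul, abs_of_pos (by norm_num : (0:ℝ) < 4/3)] at this
      linarith
    have h3 : 2 * C * n / l ^ 2 ≤ n := by
      rw [div_le_iff₀ (by positivity)]
      nlinarith
    refine (H.norm_integral_le_far hc hl0 hv (exp_neg_mul_mem hw) (hn0.trans_le h2)
      (h3.trans h2)).trans ?_
    refine div_le_div_of_nonneg_left (by positivity) hn0 ?_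
    nlinarith [mul_le_mul hl1 h2 hn0.le hl0.le]
  have hle : ∀ w ∈ Set.uIoc (Real.log (1/2)) (Real.log (3/2)),
      ‖(ω₀ w : ℂ) * innerInt (reflSum {N} ph) l X κ (shift γ T Y) χ χ Ψ w‖ ≤
        K * (5460 * K ^ 2 * (864 * K / n) * R) := fun w hw => by
    rw [Set.uIoc_of_le log_half_le] at hw
    have hw' := exp_mem_of_mem_log (Set.Ioc_subset_Icc_self hw)
    exact (W.norm_le (σ := 1) hD hl1 hX hX₂ hκ hκ₁ (by simp) hw' (hfar w hw')).1
  rw [outerInt]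
  refine (intervalIntegral.norm_integral_le_of_norm_le_const hle).trans ?_
  rw [abs_of_nonneg (sub_nonneg.2 log_half_le)]
  calc _ ≤ K * (5460 * K ^ 2 * (864 * K / n) * R) * 2 := by gcongr; exact log_sub_log_half_le
    _ = 5000000 * (42 * (0.0449280)) * K ^ 4 * (R / n) := by ring
    _ ≤ _ := by gcongr; linarith

/-- Large `X`. -/
theorem exists_norm_outerInt_le_of_large (k : ℕ) {χ : ℝ → ℝ} (hχ : ContDiff ℝ (⊤ : ℕ∞) χ)
    (hχs : tsupport χ ⊆ Set.Ioo (-(3/2) : ℝ) (3/2)) : ∃ C, 0 ≤ C ∧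
    ∀ {D : ℝ → ℂ}, Continuous D → ∀ {l X κ γ T Y K M : ℝ} {Ψ ω₀ ω₁ : ℝ → ℝ},
    Weights K χ Ψ ω₀ ω₁ → AmpFamily k K Ψ → 0 < l → 2 ≤ X → (∀ ρ, ‖D ρ‖ ≤ M) →
    ‖outerInt D l X κ γ T Y χ Ψ ω₀‖ ≤ C * K ^ 3 * M / l ^ k := by
  obtain ⟨Z, hZ, hI⟩ := exists_norm_innerInt_le_of_large k hχ hχs
  refine ⟨2 * Z, by positivity, fun {D} hD {l X κ γ T Y K M Ψ ω₀ ω₁} W hΨ hl hX hM => ?_⟩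
  have hK := W.cutoff.nonneg
  have hM0 : 0 ≤ M := (norm_nonneg _).trans (hM 0)
  have hle : ∀ w ∈ Set.uIoc (Real.log (1/2)) (Real.log (3/2)),
      ‖(ω₀ w : ℂ) * innerInt D l X κ (shift γ T Y) χ χ Ψ w‖ ≤
        K * (Z * K * (K * M) / l ^ k) := fun w hw => by
    rw [Set.uIoc_of_le log_half_le] at hw
    have hw' := exp_mem_of_mem_log (Set.Ioc_subset_Icc_self hw)
    exact norm_mul_le_of_le ((Complex.norm_real _).trans_le (W.bound w hw'))
      (hI hD hl hX W.cutoff hΨ hw' hM)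
  rw [outerInt]
  refine (intervalIntegral.norm_integral_le_of_norm_le_const hle).trans ?_
  rw [abs_of_nonneg (sub_nonneg.2 log_half_le)]
  calc _ ≤ K * (Z * K * (K * M) / l ^ k) * 2 := by gcongr; exact log_sub_log_half_le
    _ = _ := by ring

end Bounds

/-- Fubini for continuous functions vanishing outside a compact box, one factor at a time. -/
theorem integral_prod_eq_intervalIntegral {β : Type*} [TopologicalSpace β] [T2Space β]
    [SecondCountableTopology β] [MeasureSpace β] [BorelSpace β]
    [SFinite (volume : Measure β)]
    [IsFiniteMeasureOnCompacts (volume : Measure (ℝ × β))] {f : ℝ × β → ℂ} (hf : Continuous f)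
    {a b : ℝ} (hab : a ≤ b) {K : Set β} (hK : IsCompact K)
    (h : ∀ v ∉ Set.Icc a b ×ˢ K, f v = 0) :
    ∫ v, f v = ∫ x in a..b, ∫ y, f (x, y) := by
  have hc : HasCompactSupport f := HasCompactSupport.intro (isCompact_Icc.prod hK) h
  have hi : Integrable f (volume.prod volume) := hf.integrable_of_hasCompactSupport hc
  rw [Measure.volume_eq_prod, integral_prod f hi, intervalIntegral.integral_of_le hab,
    ← integral_Icc_eq_integral_Ioc, setIntegral_eq_integral_of_forall_compl_eq_zero]
  intro x hx
  simp [h (x, _) (fun hv => hx hv.1)]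

theorem integral_eq_intervalIntegral {f : ℝ → ℂ} {a b : ℝ} (hab : a ≤ b)
    (h : ∀ x ∉ Set.Icc a b, f x = 0) : ∫ x, f x = ∫ x in a..b, f x := by
  rw [intervalIntegral.integral_of_le hab, ← integral_Icc_eq_integral_Ioc,
    setIntegral_eq_integral_of_forall_compl_eq_zero h]

theorem intervalIntegral_swap_of_continuous {F : ℝ → ℝ → ℂ} (hF : Continuous F.uncurry)
    (a b c d : ℝ) : ∫ x in a..b, ∫ y in c..d, F x y = ∫ y in c..d, ∫ x in a..b, F x y := by
  refine intervalIntegral_intervalIntegral_swap ?_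
  exact (hF.continuousOn.integrableOn_compact (isCompact_uIcc.prod isCompact_uIcc)).mono_set
    (Set.prod_mono Set.uIoc_subset_uIcc Set.uIoc_subset_uIcc)

theorem integral_eq_iterated {F : ℝ × ℝ × ℝ × ℝ → ℂ} (hF : Continuous F) {a b c d e g : ℝ}
    (hab : a ≤ b) (hcd : c ≤ d) (heg : e ≤ g)
    (h : ∀ v ∉ Set.Icc a b ×ˢ Set.Icc a b ×ˢ Set.Icc c d ×ˢ Set.Icc e g, F v = 0) :
    ∫ v, F v = ∫ A in c..d, ∫ S in a..b, ∫ U in a..b, ∫ η in e..g, F (S, U, A, η) := by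
  have c1 : Continuous fun p : ℝ × ℝ × ℝ => ∫ η in e..g, F (p.1, p.2.1, p.2.2, η) :=
    continuous_intervalIntegral (φ := fun (p : ℝ × ℝ × ℝ) η => F (p.1, p.2.1, p.2.2, η))
      (hF.comp (f := fun q : (ℝ × ℝ × ℝ) × ℝ => (q.1.1, q.1.2.1, q.1.2.2, q.2)) (by fun_prop)) _ _
  have c2 : Continuous fun p : ℝ × ℝ => ∫ U in a..b, ∫ η in e..g, F (p.1, U, p.2, η) :=
    continuous_intervalIntegral
      (φ := fun (p : ℝ × ℝ) U => ∫ η in e..g, F (p.1, U, p.2, η))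
      (c1.comp (f := fun q : (ℝ × ℝ) × ℝ => (q.1.1, q.2, q.1.2)) (by fun_prop)) _ _
  rw [integral_prod_eq_intervalIntegral hF hab
    (isCompact_Icc.prod (isCompact_Icc.prod isCompact_Icc)) h]
  have s1 : ∀ S, ∫ y : ℝ × ℝ × ℝ, F (S, y) =
      ∫ A in c..d, ∫ U in a..b, ∫ η in e..g, F (S, U, A, η) := fun S => by
    rw [integral_prod_eq_intervalIntegral (f := fun y => F (S, y)) (by fun_prop) hab
      (isCompact_Icc.prod isCompact_Icc) fun v hv => h _ fun h' => hv h'.2]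
    rw [← intervalIntegral_swap_of_continuous
      (F := fun U A => ∫ η in e..g, F (S, U, A, η))
      (c1.comp (f := fun q : ℝ × ℝ => (S, q.1, q.2)) (by fun_prop))]
    refine intervalIntegral.integral_congr fun U _ => ?_
    rw [integral_prod_eq_intervalIntegral (f := fun y => F (S, U, y)) (by fun_prop) hcd
      isCompact_Icc fun v hv => h _ fun h' => hv h'.2.2]
    refine intervalIntegral.integral_congr fun A _ => ?_
    exact integral_eq_intervalIntegral heg fun x hx => h _ fun h' => hx h'.2.2.2
  simp only [s1]
  exact intervalIntegral_swap_of_continuous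
    (F := fun S A => ∫ U in a..b, ∫ η in e..g, F (S, U, A, η)) c2 _ _ _ _

theorem eq_zero_of_notMem {f : ℝ → ℝ} {s : Set ℝ} (hs : tsupport f ⊆ s) {x : ℝ} (hx : x ∉ s) :
    f x = 0 := image_eq_zero_of_notMem_tsupport fun h => hx (hs h)

/-- The integrand over `(S, Υ, A, η)` for a reflection factor `D`. -/
noncomputable def waveIntegrand (D : ℝ → ℂ) (l X κ γ T Y : ℝ) (χ ψ ψ₂ : ℝ → ℝ)
    (v : ℝ × ℝ × ℝ × ℝ) : ℂ :=
  Complex.exp (I * ((l * (v.2.2.2 * (Y + v.2.1 ^ 3 / 3 +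
      v.2.1 * (X - v.2.2.1) + v.1 ^ 3 / 3 + v.1 * (κ - v.2.2.1) +
      T * (v.2.2.1 - 1) / (√(1 + γ * v.2.2.1) + √(1 + γ)))) : ℝ) : ℂ)) *
    D (v.2.2.2 * v.2.2.1 ^ ((3:ℝ)/2)) *
    ((v.2.2.2 ^ 2 * ψ v.2.2.2 * χ v.1 * χ v.2.1 * ψ₂ v.2.2.1 : ℝ) : ℂ)

section Reduction

variable {D : ℝ → ℂ} {l X κ γ T Y : ℝ} {χ ψ ψ₂ : ℝ → ℝ}

theorem continuous_waveIntegrand (hD : Continuous D) (hγ : 0 < γ) (hχ : Continuous χ)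
    (hψ : Continuous ψ) (hψ₂ : Continuous ψ₂) :
    Continuous (waveIntegrand D l X κ γ T Y χ ψ ψ₂) := by
  have h0 : 0 < √(1 + γ) := Real.sqrt_pos.2 (by positivity)
  have h1 : Continuous fun v : ℝ × ℝ × ℝ × ℝ =>
      T * (v.2.2.1 - 1) / (√(1 + γ * v.2.2.1) + √(1 + γ)) :=
    Continuous.div (by fun_prop) (by fun_prop) fun v => by positivity
  have h2 : Continuous fun x : ℝ => x ^ ((3:ℝ)/2) := Real.continuous_rpow_const (by norm_num)
  have h3 : Continuous fun v : ℝ × ℝ × ℝ × ℝ => v.2.2.1 ^ ((3:ℝ)/2) :=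
    h2.comp (f := fun v : ℝ × ℝ × ℝ × ℝ => v.2.2.1) (by fun_prop)
  unfold waveIntegrand
  fun_prop

theorem waveIntegrand_eq_zero (hχs : tsupport χ ⊆ Set.Ioo (-(3/2) : ℝ) (3/2))
    (hψs : tsupport ψ ⊆ Set.Icc (1/2 : ℝ) (3/2)) (hψ₂s : tsupport ψ₂ ⊆ Set.Icc (1/2 : ℝ) (3/2)) :
    ∀ v ∉ Set.Icc (-(3/2) : ℝ) (3/2) ×ˢ Set.Icc (-(3/2) : ℝ) (3/2) ×ˢ
      Set.Icc (1/2 : ℝ) (3/2) ×ˢ Set.Icc (1/2 : ℝ) (3/2),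
    waveIntegrand D l X κ γ T Y χ ψ ψ₂ v = 0 := by
  rintro ⟨S, U, A, η⟩ hv
  have hχ0 : ∀ x ∉ Set.Icc (-(3/2) : ℝ) (3/2), χ x = 0 := fun x hx =>
    eq_zero_of_notMem hχs fun h => hx (Set.Ioo_subset_Icc_self h)
  simp only [Set.mem_prod, not_and_or] at hv
  simp only [waveIntegrand]
  rcases hv with h | h | h | h
  · rw [hχ0 S h]; simp
  · rw [hχ0 U h]; simp
  · rw [eq_zero_of_notMem hψ₂s h]; simp
  · rw [eq_zero_of_notMem hψs h]; simp

theorem integrable_waveIntegrand (hD : Continuous D) (hγ : 0 < γ) (hχ : Continuous χ)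
    (hψ : Continuous ψ) (hψ₂ : Continuous ψ₂) (hχs : tsupport χ ⊆ Set.Ioo (-(3/2) : ℝ) (3/2))
    (hψs : tsupport ψ ⊆ Set.Icc (1/2 : ℝ) (3/2)) (hψ₂s : tsupport ψ₂ ⊆ Set.Icc (1/2 : ℝ) (3/2)) :
    Integrable (waveIntegrand D l X κ γ T Y χ ψ ψ₂) :=
  (continuous_waveIntegrand hD hγ hχ hψ hψ₂).integrable_of_hasCompactSupport
    (HasCompactSupport.intro (isCompact_Icc.prod (isCompact_Icc.prod
      (isCompact_Icc.prod isCompact_Icc))) (waveIntegrand_eq_zero hχs hψs hψ₂s))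

/-- Reduction of the oscillatory integral over `(S, Υ, A, η)` to `outerInt`. -/
theorem integral_waveIntegrand (hD : Continuous D) (hγ : 0 < γ) (hχ : Continuous χ)
    (hψ : Continuous ψ) (hψ₂ : Continuous ψ₂) (hχs : tsupport χ ⊆ Set.Ioo (-(3/2) : ℝ) (3/2))
    (hψs : tsupport ψ ⊆ Set.Icc (1/2 : ℝ) (3/2)) (hψ₂s : tsupport ψ₂ ⊆ Set.Icc (1/2 : ℝ) (3/2)) :
    ∫ v, waveIntegrand D l X κ γ T Y χ ψ ψ₂ v =
    outerInt D l X κ γ T Y χ (fun x => x ^ 2 * ψ x)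
      (fun w => ψ₂ (Real.exp w) * Real.exp (-(1/2) * w)) := by
  have hF : Continuous (waveIntegrand D l X κ γ T Y χ ψ ψ₂) :=
    continuous_waveIntegrand hD hγ hχ hψ hψ₂
  have hsupp := waveIntegrand_eq_zero (D := D) (l := l) (X := X) (κ := κ) (γ := γ) (T := T)
    (Y := Y) hχs hψs hψ₂s
  set F := waveIntegrand D l X κ γ T Y χ ψ ψ₂ with hFdef
  rw [integral_eq_iterated hF (by norm_num) (by norm_num) (by norm_num) hsupp]
  have c1 : Continuous fun p : ℝ × ℝ × ℝ => ∫ η in (1/2 : ℝ)..3/2, F (p.2.1, p.2.2, p.1, η) :=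
    continuous_intervalIntegral (φ := fun (p : ℝ × ℝ × ℝ) η => F (p.2.1, p.2.2, p.1, η))
      (hF.comp (f := fun q : (ℝ × ℝ × ℝ) × ℝ => (q.1.2.1, q.1.2.2, q.1.1, q.2)) (by fun_prop)) _ _
  have c2 : Continuous fun p : ℝ × ℝ => ∫ U in (-(3/2))..(3/2 : ℝ), ∫ η in (1/2 : ℝ)..3/2,
      F (p.2, U, p.1, η) :=
    continuous_intervalIntegral (φ := fun (p : ℝ × ℝ) U => ∫ η in (1/2 : ℝ)..3/2,
      F (p.2, U, p.1, η))
      (c1.comp (f := fun q : (ℝ × ℝ) × ℝ => (q.1.1, q.1.2, q.2)) (by fun_prop)) _ _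
  have c3 : Continuous fun A => ∫ S in (-(3/2))..(3/2 : ℝ), ∫ U in (-(3/2))..(3/2 : ℝ),
      ∫ η in (1/2 : ℝ)..3/2, F (S, U, A, η) :=
    continuous_intervalIntegral (φ := fun A S => ∫ U in (-(3/2))..(3/2 : ℝ),
      ∫ η in (1/2 : ℝ)..3/2, F (S, U, A, η)) c2 _ _
  have hsub := intervalIntegral.integral_deriv_smul_comp (a := Real.log (1/2))
    (b := Real.log (3/2)) (fun x _ => Real.hasDerivAt_exp x) Real.continuous_exp.continuousOn c3
  rw [Real.exp_log (by norm_num), Real.exp_log (by norm_num)] at hsub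
  rw [← hsub, outerInt]
  refine intervalIntegral.integral_congr fun w hw => ?_
  rw [Set.uIcc_of_le log_half_le] at hw
  have hα := exp_neg_mul_mem (exp_mem_of_mem_log hw)
  simp only [Function.comp_apply, innerInt_eq]
  rw [← intervalIntegral.integral_smul, ← intervalIntegral.integral_const_mul]
  refine intervalIntegral.integral_congr fun S _ => ?_
  rw [← intervalIntegral.integral_smul, ← intervalIntegral.integral_const_mul,
    ← intervalIntegral.integral_const_mul]
  refine intervalIntegral.integral_congr fun U _ => ?_
  set α := Real.exp (-(3/2) * w) with hαd
  have hα0 : 0 < α := Real.exp_pos _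
  have hres : ∫ η in (1/2 : ℝ)..3/2, F (S, U, Real.exp w, η) =
      α • ∫ ρ in (1/8 : ℝ)..3, F (S, U, Real.exp w, α * ρ) := by
    have hz : ∀ η ∉ Set.Icc (1/2 : ℝ) (3/2), F (S, U, Real.exp w, η) = 0 := fun η hη =>
      hsupp _ fun h => hη h.2.2.2
    rw [intervalIntegral.integral_comp_mul_left (fun η => F (S, U, Real.exp w, η)) hα0.ne',
      smul_inv_smul₀ hα0.ne', ← integral_eq_intervalIntegral (by norm_num) hz,
      ← integral_eq_intervalIntegral (by nlinarith) fun η hη => hz η fun h => hη ?_]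
    exact ⟨by linarith [h.1, hα.2], by linarith [h.2, hα.1]⟩
  rw [hres, smul_smul, ← intervalIntegral.integral_smul, ← intervalIntegral.integral_const_mul,
    ← intervalIntegral.integral_const_mul, ← intervalIntegral.integral_const_mul]
  refine intervalIntegral.integral_congr fun ρ _ => ?_
  have e1 : Real.exp w ^ ((3:ℝ)/2) * α = 1 := by
    rw [← Real.exp_mul, hαd, ← Real.exp_add]; ring_nf; exact Real.exp_zero
  have e2 : α * ρ * Real.exp w ^ ((3:ℝ)/2) = ρ := by linear_combination ρ * e1
  have e3 : Real.exp w * α = Real.exp (-(1/2) * w) := by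
    rw [hαd, ← Real.exp_add]; congr 1; ring
  have e4 : l * (α * ρ * (Y + U ^ 3 / 3 + U * (X - Real.exp w) + S ^ 3 / 3 +
      S * (κ - Real.exp w) + T * (Real.exp w - 1) / (√(1 + γ * Real.exp w) + √(1 + γ)))) =
      l * ρ * innerPhase X κ (shift γ T Y) w S U := by
    rw [innerPhase, shift, ← hαd]; ring
  simp only [hFdef, waveIntegrand]
  rw [e2, e3, e4, Complex.real_smul]
  push_cast
  ring

end Reduction

/-- The phase picked up at each reflection. -/
noncomputable def reflPhase (L : ℝ → ℝ) (l ρ : ℝ) : ℝ := Bfun L (l * ρ) - 4/3 * (l * ρ)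

theorem continuous_reflPhase {L : ℝ → ℝ} (hL : Continuous L) (l : ℝ) :
    Continuous (reflPhase L l) := by
  have h2 : Continuous fun x : ℝ => x ^ ((2:ℝ)/3) := Real.continuous_rpow_const (by norm_num)
  have h3 : Continuous fun ρ : ℝ => (l * ρ) ^ ((2:ℝ)/3) :=
    h2.comp (f := fun ρ : ℝ => l * ρ) (by fun_prop)
  unfold reflPhase Bfun
  fun_prop

theorem IsAiry.exists_reflPhase {Ai : ℂ → ℂ} (H : IsAiry Ai) {L : ℝ → ℝ} (hLc : Continuous L)
    (hAp : ∀ w : ℝ, Aplus Ai w ≠ 0)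
    (hL : ∀ w : ℝ, Complex.exp (-(L w : ℂ) * Complex.I) = -(Aminus Ai w) / (Aplus Ai w)) :
    ∃ c > 0, ∃ C : ℝ, ∀ l : ℝ, 8 ≤ l → ∃ b₁ b₂ b₃ : ℝ → ℝ,
      ReflPhase l c C (reflPhase L l) b₁ b₂ b₃ := by
  obtain ⟨c, hc, C, h⟩ := H.exists_remainder_bounds hLc hAp hL
  refine ⟨c, hc, C, fun l hl => ?_⟩
  obtain ⟨b₁, b₂, b₃, hb, hb₃⟩ := h l hl
  have hl0 : l ≠ 0 := by linarith
  refine ⟨b₁, b₂, b₃, continuous_reflPhase hLc l, fun ρ hρ => ?_, fun ρ hρ => (hb ρ hρ).2.1,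
    fun ρ hρ => (hb ρ hρ).2.2.1, hb₃, fun ρ hρ => (hb ρ hρ).2.2.2.1,
    fun ρ hρ => (hb ρ hρ).2.2.2.2.1, fun ρ hρ => (hb ρ hρ).2.2.2.2.2.1,
    fun ρ hρ => (hb ρ hρ).2.2.2.2.2.2⟩
  have h1 := ((hb ρ hρ).1.div_const l).sub ((((hasDerivAt_id ρ).const_mul l).const_mul (4/3)))
  refine (h1.congr_of_eventuallyEq (Eventually.of_forall fun x => ?_)).congr_deriv ?_
  · simp only [reflPhase, Pi.sub_apply, id]
    rw [mul_div_cancel_left₀ _ hl0]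
  · ring

theorem sum_Wtrans_eq {L : ℝ → ℝ} (hLc : Continuous L) {ψ χ ψ₂ : ℝ → ℝ} (hχ : Continuous χ)
    (hψ : Continuous ψ) (hψ₂ : Continuous ψ₂) (hχs : tsupport χ ⊆ Set.Ioo (-(3/2) : ℝ) (3/2))
    (hψs : tsupport ψ ⊆ Set.Icc (1/2 : ℝ) (3/2)) (hψ₂s : tsupport ψ₂ ⊆ Set.Icc (1/2 : ℝ) (3/2))
    {h γ : ℝ} (hh : 0 < h) (hγ : 0 < γ) (a T X Y : ℝ) (F : Finset ℤ) :
    ∑ N ∈ F, Wtrans L ψ χ ψ₂ h γ a N T X Y = ((γ ^ 2 / (2 * Real.pi * h) ^ 3 : ℝ) : ℂ) *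
      outerInt (reflSum F (reflPhase L (γ ^ ((3:ℝ)/2) / h))) (γ ^ ((3:ℝ)/2) / h) X (a / γ) γ T Y χ
        (fun x => x ^ 2 * ψ x) (fun w => ψ₂ (Real.exp w) * Real.exp (-(1/2) * w)) := by
  have hl : γ ^ ((3:ℝ)/2) / h ≠ 0 := by positivity
  set l := γ ^ ((3:ℝ)/2) / h with hld
  have hp := continuous_reflPhase hLc l
  have hD : ∀ N : ℤ, Continuous fun ρ => Complex.exp (I * ((N * reflPhase L l ρ : ℝ) : ℂ)) :=
    fun N => by fun_prop
  rw [← integral_waveIntegrand (continuous_reflSum F hp) hγ hχ hψ hψ₂ hχs hψs hψ₂s]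
  have hsum : ∀ v, waveIntegrand (reflSum F (reflPhase L l)) l X (a / γ) γ T Y χ ψ ψ₂ v =
      ∑ N ∈ F, waveIntegrand (fun ρ => Complex.exp (I * ((N * reflPhase L l ρ : ℝ) : ℂ)))
        l X (a / γ) γ T Y χ ψ ψ₂ v := fun v => by
    simp only [waveIntegrand, reflSum, Finset.mul_sum, Finset.sum_mul]
  simp only [hsum]
  rw [integral_finsetSum _ fun N _ => integrable_waveIntegrand (hD N) hγ hχ hψ hψ₂ hχs hψs hψ₂s,
    Finset.mul_sum]
  refine Finset.sum_congr rfl fun N _ => ?_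
  rw [Wtrans]
  congr 2
  funext v
  obtain ⟨S, U, A, η⟩ := v
  rw [waveIntegrand, ← Complex.exp_add, ← mul_add, ← Complex.ofReal_add]
  congr 4
  dsimp only
  rw [PsiTrans, reflPhase, ← hld, show l * (η * A ^ ((3:ℝ)/2)) = η * l * A ^ ((3:ℝ)/2) by ring]
  field_simp
  ring

theorem contDiff_half_density {f : ℝ → ℝ} (hf : ContDiff ℝ (⊤ : ℕ∞) f) :
    ContDiff ℝ (⊤ : ℕ∞) fun w => f (Real.exp w) * Real.exp (-(1/2) * w) := by
  fun_prop

theorem exists_weights (k : ℕ) {ψ χ ψ₂ : ℝ → ℝ} (hχ : ContDiff ℝ (⊤ : ℕ∞) χ)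
    (hψ : ContDiff ℝ (⊤ : ℕ∞) ψ) (hψ₂ : ContDiff ℝ (⊤ : ℕ∞) ψ₂)
    (hψs : tsupport ψ ⊆ Set.Icc (1/2 : ℝ) (3/2)) :
    ∃ K ω₁, Weights K χ (fun x => x ^ 2 * ψ x)
        (fun w => ψ₂ (Real.exp w) * Real.exp (-(1/2) * w)) ω₁ ∧
      AmpFamily k K fun x => x ^ 2 * ψ x := by
  have hΨ : ContDiff ℝ (⊤ : ℕ∞) fun x => x ^ 2 * ψ x := by fun_prop
  have hΨs : tsupport (fun x => x ^ 2 * ψ x) ⊆ Set.Icc (1/2 : ℝ) (3/2) :=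
    (tsupport_mul_subset_right).trans hψs
  have hΨ' := Amp.smooth_div_pow hΨ hΨs 1
  simp only [pow_one] at hΨ'
  have hd : ContDiff ℝ (⊤ : ℕ∞) fun x => x * deriv (fun x => x ^ 2 * ψ x / x) x :=
    Amp.smooth_id_mul_deriv hΨ'.1
  have hds : tsupport (fun x => x * deriv (fun x => x ^ 2 * ψ x / x) x) ⊆
      Set.Icc (1/2 : ℝ) (3/2) := Amp.supp_id_mul_deriv hΨ'.2
  have hω := contDiff_half_density hψ₂
  have hω₁ := (Amp.smooth_deriv hω).continuous
  obtain ⟨K₁, h₁⟩ := exists_cutoff hχ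
  obtain ⟨K₂, h₂⟩ := exists_cutoff (f := fun x => χ x * x) (by fun_prop)
  obtain ⟨K₃, h₃⟩ := exists_cutoff (f := fun x => χ x * x ^ 3) (by fun_prop)
  obtain ⟨K₄, h₄⟩ := exists_ampFamily 2 hΨ hΨs
  obtain ⟨K₅, h₅⟩ := exists_ampFamily 2 hΨ'.1 hΨ'.2
  obtain ⟨K₆, h₆⟩ := exists_ampFamily 2 hd hds
  obtain ⟨K₇, h₇⟩ := exists_ampFamily k hΨ hΨs
  obtain ⟨K₈, h₈⟩ := (isCompact_Icc (a := Real.log (1/2))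
    (b := Real.log (3/2))).exists_bound_of_continuousOn hω.continuous.continuousOn
  obtain ⟨K₉, h₉⟩ := (isCompact_Icc (a := Real.log (1/2))
    (b := Real.log (3/2))).exists_bound_of_continuousOn hω₁.continuousOn
  obtain ⟨K, hK⟩ := (Set.toFinite {K₁, K₂, K₃, K₄, K₅, K₆, K₇, K₈, K₉}).bddAbove
  simp only [upperBounds_insert, upperBounds_singleton, Set.mem_inter_iff, Set.mem_Ici] at hK
  obtain ⟨a₁, a₂, a₃, a₄, a₅, a₆, a₇, a₈, a₉⟩ := hK
  have hlog : ∀ w, Real.exp w ∈ Set.Icc (1/2 : ℝ) (3/2) →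
      w ∈ Set.Icc (Real.log (1/2)) (Real.log (3/2)) := fun w hw =>
    ⟨(Real.log_le_iff_le_exp (by norm_num)).2 hw.1, (Real.le_log_iff_exp_le (by norm_num)).2 hw.2⟩
  exact ⟨K, deriv _, ⟨h₁ K a₁, h₂ K a₂, h₃ K a₃, h₄ K a₄, h₅ K a₅, h₆ K a₆,
    fun w => (hω.differentiable (by simp) w).hasDerivAt, hω₁,
    fun w hw => (h₈ w (hlog w hw)).trans a₈, fun w hw => (h₉ w (hlog w hw)).trans a₉⟩, h₇ K a₇⟩

section Parameters

variable {h γ ε : ℝ}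

theorem rpow_neg_le_param (hh : 0 < h) (hγ : h ^ ((2:ℝ)/3 - ε) ≤ γ) :
    h ^ (-(3/2) * ε) ≤ γ ^ ((3:ℝ)/2) / h := by
  rw [le_div_iff₀ hh, ← Real.rpow_add_one hh.ne']
  calc h ^ (-(3/2) * ε + 1) = (h ^ ((2:ℝ)/3 - ε)) ^ ((3:ℝ)/2) := by
        rw [← Real.rpow_mul hh.le]; congr 1; ring
    _ ≤ γ ^ ((3:ℝ)/2) := Real.rpow_le_rpow (by positivity) hγ (by norm_num)

theorem exists_forall_le_rpow_neg (hε : 0 < ε) (R : ℝ) :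
    ∃ h₀ ∈ Set.Ioo (0:ℝ) 1, ∀ h, 0 < h → h ≤ h₀ → R ≤ h ^ (-(3/2) * ε) := by
  have h2 : 1 < max R 2 := lt_of_lt_of_le (by norm_num) (le_max_right _ _)
  refine ⟨max R 2 ^ (-(2/(3*ε))), ⟨by positivity,
    Real.rpow_lt_one_of_one_lt_of_neg h2 (by simp only [neg_lt_zero]; positivity)⟩,
    fun h hh hle => ?_⟩
  calc R ≤ max R 2 := le_max_left _ _
    _ = (max R 2 ^ (-(2/(3*ε)))) ^ (-(3/2) * ε) := by
        rw [← Real.rpow_mul (by positivity)]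
        rw [show -(2/(3*ε)) * (-(3/2) * ε) = 1 by field_simp, Real.rpow_one]
    _ ≤ h ^ (-(3/2) * ε) := Real.rpow_le_rpow_of_nonpos hh hle (by nlinarith)

theorem one_div_sqrt_le_pow (hε : 0 < ε) (hh : 0 < h) (hh₁ : h ≤ 1)
    (hγ : h ^ ((2:ℝ)/3 - ε) ≤ γ) {m : ℕ} (hm : 2 / (9 * ε) ≤ m) :
    1 / √γ ≤ (γ ^ ((3:ℝ)/2) / h) ^ m := by
  have h1 : h ^ ((1:ℝ)/3) ≤ √γ := by
    refine Real.le_sqrt_of_sq_le (le_trans ?_ hγ)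
    rw [← Real.rpow_mul_natCast hh.le]
    exact Real.rpow_le_rpow_of_exponent_ge hh hh₁ (by push_cast; linarith)
  rw [div_le_iff₀ (by positivity)] at hm
  calc 1 / √γ ≤ 1 / h ^ ((1:ℝ)/3) := by gcongr
    _ = h ^ (-(1/3) : ℝ) := by rw [Real.rpow_neg hh.le, one_div]
    _ ≤ h ^ (-(3/2) * ε * m) := Real.rpow_le_rpow_of_exponent_ge hh hh₁ (by nlinarith)
    _ = (h ^ (-(3/2) * ε)) ^ m := Real.rpow_mul_natCast hh.le _ _
    _ ≤ _ := by gcongr; exact rpow_neg_le_param hh hγ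

theorem rpow_scaling (hh : 0 < h) (hγ : 0 < γ) {l : ℝ} (hl : l = γ ^ ((3:ℝ)/2) / h) :
    γ ^ 2 / h ^ 3 * (l ^ (-(5/6) : ℝ) / l ^ 2) = h ^ ((1:ℝ)/3) / (h ^ 2 * l ^ ((3:ℝ)/2)) := by
  have hl0 : 0 < l := by rw [hl]; positivity
  have e1 : l ^ ((4:ℝ)/3) * h ^ ((4:ℝ)/3) = γ ^ 2 := by
    rw [← Real.mul_rpow hl0.le hh.le, hl, div_mul_cancel₀ _ hh.ne', ← Real.rpow_mul hγ.le]
    norm_num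
  have e2 : l ^ (-(5/6) : ℝ) * l ^ ((3:ℝ)/2) * l ^ ((4:ℝ)/3) = l ^ 2 := by
    rw [← Real.rpow_add hl0, ← Real.rpow_add hl0]; norm_num
  have e3 : h ^ ((4:ℝ)/3) = h * h ^ ((1:ℝ)/3) := by
    rw [← Real.rpow_one_add' hh.le (by norm_num)]; norm_num
  rw [← e1, e3, div_mul_div_comm, div_eq_div_iff (by positivity) (by positivity)]
  linear_combination (h ^ 3 * h ^ ((1:ℝ)/3)) * e2

theorem inv_pow_three_le {l : ℝ} (hl : 1 ≤ l) : 1 / l ^ 3 ≤ l ^ (-(5/6) : ℝ) / l ^ 2 := by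
  have h0 : 0 < l := by linarith
  have : l⁻¹ ≤ l ^ (-(5/6) : ℝ) := by
    rw [← Real.rpow_neg_one]
    exact Real.rpow_le_rpow_of_exponent_le hl (by norm_num)
  calc 1 / l ^ 3 = l⁻¹ / l ^ 2 := by field_simp
    _ ≤ _ := by gcongr

theorem norm_prefactor_le (hh : 0 < h) : ‖((γ ^ 2 / (2 * Real.pi * h) ^ 3 : ℝ) : ℂ)‖ ≤
    γ ^ 2 / h ^ 3 := by
  have hpi := Real.pi_gt_three
  rw [Complex.norm_real, Real.norm_of_nonneg (by positivity)]
  gcongr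
  nlinarith

end Parameters

theorem Gflat_eq_sum (L ψ χ ψ₂ : ℝ → ℝ) (h γ a T X Y : ℝ) : ∃ F : Finset ℤ,
    (∀ N ∈ F, |(N : ℝ)| ≤ 2 / √γ) ∧
    Gflat L ψ χ ψ₂ h γ a T X Y = ∑ N ∈ F, Wtrans L ψ χ ψ₂ h γ a N T X Y := by
  have hfin : {N : ℤ | |(N : ℝ)| ≤ 2 / √γ}.Finite :=
    (Set.finite_Icc ⌈-(2 / √γ)⌉ ⌊2 / √γ⌋).subset fun N hN =>
      ⟨Int.ceil_le.2 (abs_le.1 hN).1, Int.le_floor.2 (abs_le.1 hN).2⟩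
  refine ⟨hfin.toFinset, fun N hN => by simpa using hN, ?_⟩
  rw [Gflat, tsum_eq_sum (s := hfin.toFinset) fun N hN =>
    Set.indicator_of_notMem (by simpa using hN) _]
  exact Finset.sum_congr rfl fun N hN => Set.indicator_of_mem (by simpa using hN) _

end TransverseWave

/-- dispersive bounds in the regime `λ_γ² ≤ |T| ≤ 2γ^{−1/2}`:
(i) for each `λ_γ² ≤ |N| ≤ 2γ^{−1/2}`; and (ii) for the full sum `G^♭`. -/
theorem dispersion_transverse_hugeT
    (Ai : ℂ → ℂ)
    (hAi_diff : Differentiable ℂ Ai)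
    (hAi_diff' : Differentiable ℂ (deriv Ai))
    (hAi_ode : ∀ z : ℂ, deriv (deriv Ai) z = z * Ai z)
    (hAi_zero : Ai 0 = (3 : ℂ) ^ (-(2 : ℂ)/3) / Complex.Gamma (2/3))
    (hAi_zero' : deriv Ai 0 = -((3 : ℂ) ^ (-(1 : ℂ)/3)) / Complex.Gamma (1/3))
    (hAi_real : ∀ x : ℝ, (Ai x).im = 0)
    (L : ℝ → ℝ)
    (hL_cont : Continuous L)
    (hL_zero : L 0 = Real.pi / 3)
    (hAp_ne : ∀ w : ℝ, Aplus Ai w ≠ 0)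
    (hL_char : ∀ w : ℝ, Complex.exp (-(L w : ℂ) * Complex.I) = -(Aminus Ai w) / (Aplus Ai w))
    (ψ : ℝ → ℝ) (hψ : ContDiff ℝ (⊤ : ℕ∞) ψ) (hψs : tsupport ψ ⊆ Set.Icc (1/2 : ℝ) (3/2))
    (ψ₂ : ℝ → ℝ) (hψ₂ : ContDiff ℝ (⊤ : ℕ∞) ψ₂) (hψ₂s : tsupport ψ₂ ⊆ Set.Icc (1/2 : ℝ) (3/2))
    (χ₂ : ℝ → ℝ) (hχ₂ : ContDiff ℝ (⊤ : ℕ∞) χ₂)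
    (hχ₂s : tsupport χ₂ ⊆ Set.Ioo (-(3/2) : ℝ) (3/2))
    (ε : ℝ) (hε : ε ∈ Set.Ioo (0:ℝ) (1/10)) :
    ∃ γ₀ ∈ Set.Ioo (0:ℝ) 1, ∃ h₀ ∈ Set.Ioo (0:ℝ) 1, ∃ C : ℝ,
      ∀ h γ a : ℝ, 0 < h → h ≤ h₀ → h ^ ((2:ℝ)/3 - ε) ≤ γ → γ ≤ γ₀ →
      0 < a → a < γ / 4 →
      ∀ X : ℝ, 0 ≤ X → ∀ Y T : ℝ,
        (γ ^ ((3:ℝ)/2) / h) ^ 2 ≤ |T| → |T| ≤ 2 / Real.sqrt γ →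
        -- (i)
        (∀ N : ℤ, (γ ^ ((3:ℝ)/2) / h) ^ 2 ≤ |(N : ℝ)| → |(N : ℝ)| ≤ 2 / Real.sqrt γ →
          ‖Wtrans L ψ χ₂ ψ₂ h γ a N T X Y‖
            ≤ C * γ ^ 2 / (h ^ 3 * (γ ^ ((3:ℝ)/2) / h) ^ ((5:ℝ)/6) * |(N : ℝ)|)) ∧
        -- (ii)
        (‖Gflat L ψ χ₂ ψ₂ h γ a T X Y‖
          ≤ C * h ^ ((1:ℝ)/3) / (h ^ 2 * (γ ^ ((3:ℝ)/2) / h) ^ ((3:ℝ)/2))) := by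
  have H : TransverseWave.IsAiry Ai := ⟨hAi_diff, hAi_diff', hAi_ode, hAi_zero, hAi_zero'⟩
  obtain ⟨c, hc, C, hph⟩ := H.exists_reflPhase hL_cont hAp_ne hL_char
  obtain ⟨m, hm⟩ := exists_nat_ge (2 / (9 * ε))
  obtain ⟨K, ω₁, W, hK⟩ := TransverseWave.exists_weights (m + 3) hχ₂ hψ hψ₂ hψs
  obtain ⟨C₁, hC₁, hsmall⟩ := TransverseWave.exists_norm_outerInt_reflSum_le c C hc
  obtain ⟨C₂, hC₂, hlarge⟩ :=
    TransverseWave.exists_norm_outerInt_le_of_large (m + 3) hχ₂ hχ₂s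
  obtain ⟨h₀, hh₀, hR⟩ := TransverseWave.exists_forall_le_rpow_neg hε.1 (max 64 (6 * C))
  have hK0 := W.cutoff.nonneg
  have hKK : 0 ≤ C₂ * K ^ 3 := by positivity
  obtain ⟨M, hM⟩ := Finset.exists_le
    ({C₁ * K ^ 4, 5000000 * (42 * (64 + 2 / c)) * K ^ 4, 5 * (C₂ * K ^ 3)} : Finset ℝ)
  simp only [Finset.mem_insert, Finset.mem_singleton, forall_eq_or_imp, forall_eq] at hM
  obtain ⟨hM₁, hM₃, hM₂⟩ := hM
  have hM0 : 0 ≤ M := le_trans (by positivity) hM₂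
  refine ⟨1/2, by norm_num, h₀, hh₀, M, ?_⟩
  intro h γ a hh hle hγh hγ₀ ha haγ X hX Y T hT _
  have hγ : 0 < γ := by linarith
  have hκ : a / γ ≤ 1/4 := by rw [div_le_iff₀ hγ]; linarith
  have hκ0 : 0 ≤ a / γ := by positivity
  have hlR := (hR h hh hle).trans (TransverseWave.rpow_neg_le_param hh hγh)
  have hN := TransverseWave.one_div_sqrt_le_pow hε.1 hh (hle.trans hh₀.2.le) hγh hm
  have hsum := TransverseWave.sum_Wtrans_eq hL_cont hχ₂.continuous hψ.continuous hψ₂.continuous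
    hχ₂s hψs hψ₂s hh hγ a T X Y
  have hscale := TransverseWave.rpow_scaling hh hγ rfl
  have hl0 : 0 < γ ^ ((3:ℝ)/2) / h := by positivity
  generalize γ ^ ((3:ℝ)/2) / h = l at *
  have hl64 : 64 ≤ l := (le_max_left _ _).trans hlR
  have hlC : 6 * C ≤ l ^ 2 := ((le_max_right _ _).trans hlR).trans (by nlinarith)
  obtain ⟨b₁, b₂, b₃, hp⟩ := hph l (by linarith)
  have hpow := TransverseWave.inv_pow_three_le (l := l) (by linarith)
  have hlarge' : ∀ F : Finset ℤ, 2 ≤ X → ∀ B, (F.card : ℝ) ≤ B →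
      ‖TransverseWave.outerInt (TransverseWave.reflSum F (TransverseWave.reflPhase L l)) l X
        (a / γ) γ T Y χ₂ (fun x => x ^ 2 * ψ x)
        (fun w => ψ₂ (Real.exp w) * Real.exp (-(1/2) * w))‖ ≤ C₂ * K ^ 3 * B / l ^ (m + 3) :=
    fun F hX₂ B hB => hlarge (TransverseWave.continuous_reflSum F hp.cont) W hK hl0 hX₂
      fun ρ => (TransverseWave.norm_reflSum_le F _ ρ).trans hB
  constructor
  · intro N hlN hNγ
    have hN0 : 0 < |(N : ℝ)| := lt_of_lt_of_le (by positivity) hlN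
    have hW := hsum {N}
    rw [Finset.sum_singleton] at hW
    rw [hW, norm_mul, show M * γ ^ 2 / (h ^ 3 * l ^ ((5:ℝ)/6) * |(N : ℝ)|) =
      γ ^ 2 / h ^ 3 * (M * (l ^ (-(5/6) : ℝ) / |(N : ℝ)|)) by
        rw [Real.rpow_neg hl0.le]; field_simp]
    refine mul_le_mul (TransverseWave.norm_prefactor_le hh) ?_ (norm_nonneg _) (by positivity)
    rcases le_total X 2 with hX₂ | hX₂
    · refine (TransverseWave.norm_outerInt_reflSum_singleton_le hp W hc (by linarith) hlC
        (by nlinarith) hγ (by linarith) hX hX₂ hκ0 hκ hT hlN).trans ?_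
      gcongr
    · refine (hlarge' {N} hX₂ 1 (by simp)).trans ?_
      have hNm : |(N : ℝ)| ≤ 2 * l ^ m := hNγ.trans (by
        rw [show 2 / √γ = 2 * (1 / √γ) by ring]; gcongr)
      calc C₂ * K ^ 3 * 1 / l ^ (m + 3) = C₂ * K ^ 3 * (1 / l ^ 3) * (|(N : ℝ)| / l ^ m) /
            |(N : ℝ)| := by rw [pow_add]; field_simp
        _ ≤ C₂ * K ^ 3 * l ^ (-(5/6) : ℝ) * 2 / |(N : ℝ)| := by
            gcongr
            · refine hpow.trans (div_le_self (by positivity) ?_)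
              nlinarith
            · rwa [div_le_iff₀ (by positivity)]
        _ = 2 * (C₂ * K ^ 3) * (l ^ (-(5/6) : ℝ) / |(N : ℝ)|) := by ring
        _ ≤ _ := by
            gcongr
            linarith
  · obtain ⟨F, hF, hG⟩ := TransverseWave.Gflat_eq_sum L ψ χ₂ ψ₂ h γ a T X Y
    rw [hG, hsum F, norm_mul, mul_div_assoc, ← hscale,
      mul_left_comm M]
    refine mul_le_mul (TransverseWave.norm_prefactor_le hh) ?_ (norm_nonneg _) (by positivity)
    rcases le_total X 2 with hX₂ | hX₂
    · refine (hsmall hp W (by linarith) hlC (by nlinarith) hγ (by linarith) hX hX₂ hκ0 hκ hT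
        F).trans ?_
      gcongr
    · have hcard : (F.card : ℝ) ≤ 5 * l ^ m := by
        have h1 := TransverseWave.card_le_of_abs_sub_le (F := F) (t := 0) (r := 2 / √γ)
          (by positivity) fun N hN => by simpa using hF N hN
        have h2 : 2 / √γ = 2 * (1 / √γ) := by ring
        have h3 : 1 ≤ l ^ m := one_le_pow₀ (by linarith)
        linarith
      refine (hlarge' F hX₂ _ hcard).trans ?_
      calc C₂ * K ^ 3 * (5 * l ^ m) / l ^ (m + 3) = 5 * (C₂ * K ^ 3) * (1 / l ^ 3) := by
            rw [pow_add]; field_simp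
        _ ≤ 5 * (C₂ * K ^ 3) * (l ^ (-(5/6) : ℝ) / l ^ 2) := by gcongr
        _ ≤ _ := by
            gcongr
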